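/- Let D ⊆ ℂ be a simply connected domain with an analytic corner at 0 ∈ ∂D with interior angle θ ∈ (0, 2π], and let Φ : ℍ → D be a biholomorphic map which extends continuously to 0 with Φ(0) = 0. Then Φ extends holomorphically to a standard quadratic domain of the Riemann surface of the logarithm: there exist c, C > 0 and a holomorphic function G on W(c,C) = {w ∈ ℂ : Re w < log c − C·√|Im w|} such that G(w) = Φ(e^w) for every w ∈ W(c,C) with 0 < Im w < π. -/

import Mathlib

open Metric Set Filter Topology

/-- The upper half plane `ℍ = {z : Im z > 0}`. -/
def UpperHalf : Set ℂ := {z : ℂ | 0 < z.im}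

/-- The logarithmic chart `W(c,C) = {w : Re w < log c − C √|Im w|}` of the standard
quadratic domain `{0 < |z| < c exp(−C √|arg z|)}` on the Riemann surface of the
logarithm. -/
def StdQuadDomain (c C : ℝ) : Set ℂ :=
  {w : ℂ | w.re < Real.log c - C * Real.sqrt |w.im|}

/-- `D` has an analytic corner at `0 ∈ ∂D` with interior angle `θ`, with boundary arcs
given by the injective holomorphic maps `φ₁, φ₂` (regular at `0`): near `0` the boundary
of `D` is `φ₁([0,1)) ∪ φ₂([0,1))`, and, with `β = Arg φ₁'(0)`, the rays of argument
`β + s` with `δ ≤ s ≤ θ − δ` lie in `D` near `0`, while those with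
`θ + δ ≤ s ≤ 2π − δ` avoid `D` near `0`. -/
def HasAnalyticCornerAt (D : Set ℂ) (θ : ℝ) (φ₁ φ₂ : ℂ → ℂ) : Prop :=
  DifferentiableOn ℂ φ₁ (ball (0 : ℂ) 1) ∧ InjOn φ₁ (ball (0 : ℂ) 1) ∧
  φ₁ 0 = 0 ∧ deriv φ₁ 0 ≠ 0 ∧
  DifferentiableOn ℂ φ₂ (ball (0 : ℂ) 1) ∧ InjOn φ₂ (ball (0 : ℂ) 1) ∧
  φ₂ 0 = 0 ∧ deriv φ₂ 0 ≠ 0 ∧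
  (∃ ρ > 0, frontier D ∩ ball (0 : ℂ) ρ =
    (φ₁ '' (Complex.ofReal '' Ico (0 : ℝ) 1) ∪ φ₂ '' (Complex.ofReal '' Ico (0 : ℝ) 1)) ∩
      ball (0 : ℂ) ρ) ∧
  (∀ δ : ℝ, 0 < δ → δ < θ / 2 → ∃ ε > 0,
    (∀ t s : ℝ, 0 < t → t < ε → δ ≤ s → s ≤ θ - δ →
      (t : ℂ) * Complex.exp (Complex.I * (((deriv φ₁ 0).arg + s : ℝ) : ℂ)) ∈ D) ∧
    (∀ t s : ℝ, 0 < t → t < ε → θ + δ ≤ s → s ≤ 2 * Real.pi - δ →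
      (t : ℂ) * Complex.exp (Complex.I * (((deriv φ₁ 0).arg + s : ℝ) : ℂ)) ∉ D))

/-- `D` has an analytic corner at `0 ∈ ∂D` with interior angle `θ`. -/
def HasAnalyticCorner (D : Set ℂ) (θ : ℝ) : Prop :=
  ∃ φ₁ φ₂ : ℂ → ℂ, HasAnalyticCornerAt D θ φ₁ φ₂

section
theorem inj_nhds_le {U : Set ℂ} (hU : IsOpen U) {f : ℂ → ℂ} (hf : DifferentiableOn ℂ f U)
    (hi : InjOn f U) {z : ℂ} (hz : z ∈ U) : 𝓝 (f z) ≤ map f (𝓝 z) := by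
  have hA : AnalyticAt ℂ f z := hf.analyticAt (hU.mem_nhds hz)
  rcases hA.eventually_constant_or_nhds_le_map_nhds with h | h
  · exfalso
    have h1 : ∀ᶠ y in 𝓝[≠] z, False := by
      filter_upwards [h.filter_mono nhdsWithin_le_nhds, self_mem_nhdsWithin,
        (hU.mem_nhds hz |> mem_nhdsWithin_of_mem_nhds)] with y h1 h2 h3
      exact h2 (hi h3 hz h1)
    simpa using h1.exists
  · exact h

theorem inj_isOpen_image {U V : Set ℂ} (hU : IsOpen U) {f : ℂ → ℂ} (hf : DifferentiableOn ℂ f U)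
    (hi : InjOn f U) (hV : IsOpen V) (hVU : V ⊆ U) : IsOpen (f '' V) := by
  rw [isOpen_iff_mem_nhds]
  rintro _ ⟨z, hz, rfl⟩
  exact inj_nhds_le hU hf hi (hVU hz) (image_mem_map (hV.mem_nhds hz))

theorem inj_inv_continuousAt {U : Set ℂ} (hU : IsOpen U) {f : ℂ → ℂ} (hf : DifferentiableOn ℂ f U)
    (hi : InjOn f U) {g : ℂ → ℂ} (hg : ∀ z ∈ U, g (f z) = z) {z : ℂ} (hz : z ∈ U) :
    ContinuousAt g (f z) := by
  intro N hN
  rw [hg z hz] at hN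
  obtain ⟨V, hVN, hV, hzV⟩ := _root_.mem_nhds_iff.1 (inter_mem hN (hU.mem_nhds hz))
  have : f '' V ∈ 𝓝 (f z) :=
    (inj_isOpen_image hU hf hi hV (hVN.trans inter_subset_right)).mem_nhds ⟨z, hzV, rfl⟩
  rw [mem_map]
  filter_upwards [this]
  rintro _ ⟨y, hy, rfl⟩
  rw [mem_preimage, hg y (hVN hy).2]
  exact (hVN hy).1

theorem inj_inv_differentiable {U : Set ℂ} (hU : IsOpen U) {f : ℂ → ℂ}
    (hf : DifferentiableOn ℂ f U)
    (hi : InjOn f U) {g : ℂ → ℂ} (hg : ∀ z ∈ U, g (f z) = z) :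
    DifferentiableOn ℂ g (f '' U) := by
  have hO := inj_isOpen_image hU hf hi hU le_rfl
  have key : ∀ z ∈ U, deriv f z ≠ 0 → DifferentiableAt ℂ g (f z) := by
    intro z hz hd
    have h1 : HasDerivAt f (deriv f z) (g (f z)) := by
      rw [hg z hz]
      exact (hf.differentiableAt (hU.mem_nhds hz)).hasDerivAt
    refine (h1.of_local_left_inverse (inj_inv_continuousAt hU hf hi hg hz) hd ?_).differentiableAt
    filter_upwards [hO.mem_nhds ⟨z, hz, rfl⟩]
    rintro _ ⟨y, hy, rfl⟩
    rw [hg y hy]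
  rintro _ ⟨z, hz, rfl⟩
  apply DifferentiableAt.differentiableWithinAt
  by_cases hd : deriv f z = 0
  · have hA : AnalyticAt ℂ (deriv f) z := (hf.analyticAt (hU.mem_nhds hz)).deriv
    rcases hA.eventually_eq_zero_or_eventually_ne_zero with h | h
    · exfalso
      obtain ⟨ε, hε, hb⟩ := Metric.eventually_nhds_iff_ball.1 (h.and (hU.mem_nhds hz))
      have hmem : z + (ε/2 : ℝ) ∈ ball z ε := by
        simp [abs_of_pos hε]; linarith
      have h2 := (convex_ball z ε).is_const_of_fderivWithin_eq_zero (𝕜 := ℂ) (f := f)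
        (hf.mono fun y hy => (hb y hy).2) (fun y hy => by
          rw [fderivWithin_of_isOpen isOpen_ball hy]
          ext; simp [(hb y hy).1]) (mem_ball_self hε) hmem
      have := hi hz (hb _ hmem).2 h2
      simp at this
      exact hε.ne' this
    · apply AnalyticAt.differentiableAt
      apply Complex.analyticAt_of_differentiable_on_punctured_nhds_of_continuousAt _
        (inj_inv_continuousAt hU hf hi hg hz)
      obtain ⟨V, hV, hVo, hzV⟩ := _root_.eventually_nhds_iff.1 (eventually_nhdsWithin_iff.1 h)
      have : f '' (V ∩ U) ∈ 𝓝 (f z) :=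
        (inj_isOpen_image hU hf hi (hVo.inter hU) inter_subset_right).mem_nhds ⟨z, ⟨hzV, hz⟩, rfl⟩
      filter_upwards [mem_nhdsWithin_of_mem_nhds this, self_mem_nhdsWithin]
      rintro _ ⟨y, hy, rfl⟩ hne
      exact key y hy.2 (hV y hy.1 (fun h => hne (by rw [mem_singleton_iff.1 h]; rfl)))
  · exact key z hz hd
end

section
theorem holo_of_off_real {c : ℂ} {ρ : ℝ} {f : ℂ → ℂ} (hc : ContinuousOn f (ball c ρ))
    (hd : ∀ z ∈ ball c ρ, z.im ≠ 0 → DifferentiableAt ℂ f z) : DifferentiableOn ℂ f (ball c ρ) := by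
  rw [← Complex.isConservativeOn_and_continuousOn_iff_isDifferentiableOn isOpen_ball]
  refine ⟨?_, hc⟩
  intro z w hzw
  rw [← add_eq_zero_iff_eq_neg, Complex.wedgeIntegral_add_wedgeIntegral_eq]
  have hsub : ∀ x ∈ uIcc z.re w.re, ∀ y ∈ uIcc z.im w.im, (x + y * Complex.I : ℂ) ∈ ball c ρ := by
    intro x hx y hy
    apply hzw
    rw [Complex.Rectangle, Complex.mem_reProdIm]
    simpa using ⟨hx, hy⟩
  have rect : ∀ y₁ ∈ uIcc z.im w.im, ∀ y₂ ∈ uIcc z.im w.im, (0 : ℝ) ∉ Ioo (min y₁ y₂) (max y₁ y₂) →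
      (∫ x : ℝ in z.re..w.re, f (x + y₁ * Complex.I)) -
      (∫ x : ℝ in z.re..w.re, f (x + y₂ * Complex.I)) +
      Complex.I • (∫ y : ℝ in y₁..y₂, f (w.re + y * Complex.I)) -
      Complex.I • (∫ y : ℝ in y₁..y₂, f (z.re + y * Complex.I)) = 0 := by
    intro y₁ h₁ y₂ h₂ h0
    have hss : uIcc y₁ y₂ ⊆ uIcc z.im w.im := uIcc_subset_uIcc h₁ h₂
    have hmem : ∀ v : ℂ, v.re ∈ uIcc z.re w.re → v.im ∈ uIcc y₁ y₂ → v ∈ ball c ρ := by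
      intro v hv hv'
      have := hsub _ hv _ (hss hv')
      rwa [Complex.re_add_im] at this
    have := Complex.integral_boundary_rect_eq_zero_of_continuousOn_of_differentiableOn f
      ⟨z.re, y₁⟩ ⟨w.re, y₂⟩ (hc.mono ?_) ?_
    · simpa using this
    · intro v hv
      rw [Complex.mem_reProdIm] at hv
      exact hmem v hv.1 hv.2
    · intro v hv
      rw [Complex.mem_reProdIm] at hv
      refine (hd v (hmem v ?_ ?_) ?_).differentiableWithinAt
      · exact Ioo_subset_Icc_self hv.1
      · exact Ioo_subset_Icc_self hv.2
      · intro h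
        rw [h] at hv
        exact h0 hv.2
  by_cases h0 : (0 : ℝ) ∈ uIcc z.im w.im
  · have e1 := rect _ left_mem_uIcc 0 h0 (by
      rcases le_total z.im 0 with h | h <;> simp [h])
    have e2 := rect 0 h0 _ right_mem_uIcc (by
      rcases le_total w.im 0 with h | h <;> simp [h])
    have key : ∀ x ∈ uIcc z.re w.re, ∀ a ∈ uIcc z.im w.im, ∀ b ∈ uIcc z.im w.im,
        IntervalIntegrable (fun y : ℝ => f (x + y * Complex.I)) MeasureTheory.volume a b := by
      intro x hx a ha b hb
      apply ContinuousOn.intervalIntegrable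
      refine hc.comp (by fun_prop) ?_
      intro y hy
      exact hsub x hx y (uIcc_subset_uIcc ha hb hy)
    rw [← intervalIntegral.integral_add_adjacent_intervals
      (key _ right_mem_uIcc _ left_mem_uIcc 0 h0) (key _ right_mem_uIcc 0 h0 _ right_mem_uIcc),
      ← intervalIntegral.integral_add_adjacent_intervals
      (key _ left_mem_uIcc _ left_mem_uIcc 0 h0) (key _ left_mem_uIcc 0 h0 _ right_mem_uIcc)]
    simp only [smul_eq_mul] at *
    linear_combination e1 + e2
  · exact rect _ left_mem_uIcc _ right_mem_uIcc (fun h => h0 (Ioo_subset_Icc_self h))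

open ComplexConjugate in
theorem reflect_local {x₀ ρ : ℝ} {U : ℂ → ℂ}
    (hU : DifferentiableOn ℂ U (ball (x₀ : ℂ) ρ ∩ {z | 0 < z.im})) {M : ℝ}
    (hM : ∀ w ∈ ball (x₀ : ℂ) ρ ∩ {z | 0 < z.im}, ‖U w‖ ≤ M)
    (hlim : ∀ x : ℝ, (x : ℂ) ∈ ball (x₀ : ℂ) ρ →
      Tendsto (fun w => (U w).im) (𝓝[{z | 0 < z.im}] (x : ℂ)) (𝓝 0)) :
    ∃ V : ℂ → ℂ, DifferentiableOn ℂ V (ball (x₀ : ℂ) ρ) ∧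
      EqOn V U (ball (x₀ : ℂ) ρ ∩ {z | 0 < z.im}) ∧
      ∀ w ∈ ball (x₀ : ℂ) ρ, V (conj w) = conj (V w) := by
  set Hs : Set ℂ := ball (x₀ : ℂ) ρ ∩ {z | 0 < z.im} with hHs
  have hcv : Convex ℝ Hs := (convex_ball _ _).inter (convex_halfSpace_im_gt 0)
  have hop : IsOpen Hs := isOpen_ball.inter (isOpen_lt continuous_const Complex.continuous_im)
  obtain ⟨g, hg⟩ := hcv.exists_forall_hasDerivWithinAt hU
  have hLip : LipschitzOnWith (Real.toNNReal M) g Hs :=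
    hcv.lipschitzOnWith_of_nnnorm_hasDerivWithin_le hg (fun x hx => by
      rw [← NNReal.coe_le_coe, coe_nnnorm]
      exact (hM x hx).trans (Real.le_coe_toNNReal M))
  obtain ⟨gr, hgr, er⟩ := (show LipschitzOnWith (Real.toNNReal M) (fun z => (g z).re) Hs from
    LipschitzOnWith.of_dist_le_mul fun x hx y hy => by
      rw [Real.dist_eq, ← Complex.sub_re]
      exact (Complex.abs_re_le_norm _).trans (by
        rw [← Complex.dist_eq]; exact hLip.dist_le_mul x hx y hy)).extend_real
  obtain ⟨gi, hgi, ei⟩ := (show LipschitzOnWith (Real.toNNReal M) (fun z => (g z).im) Hs from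
    LipschitzOnWith.of_dist_le_mul fun x hx y hy => by
      rw [Real.dist_eq, ← Complex.sub_im]
      exact (Complex.abs_im_le_norm _).trans (by
        rw [← Complex.dist_eq]; exact hLip.dist_le_mul x hx y hy)).extend_real
  have conjball : ∀ w, w ∈ ball (x₀ : ℂ) ρ → conj w ∈ ball (x₀ : ℂ) ρ := by
    intro w hw
    rw [mem_ball, Complex.dist_eq] at *
    rw [← Complex.norm_conj] at hw
    simpa using hw
  -- imaginary part constant
  have hder : ∀ x : ℝ, (x : ℂ) ∈ ball (x₀ : ℂ) ρ → HasDerivAt (fun t : ℝ => gi t) 0 x := by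
    intro x hx
    rw [hasDerivAt_iff_isLittleO, Asymptotics.isLittleO_iff]
    intro η hη
    have h1 := (Metric.tendsto_nhds.1 (hlim x hx)) η hη
    rw [eventually_nhdsWithin_iff, Metric.eventually_nhds_iff_ball] at h1
    obtain ⟨δ₁, hδ₁, h1⟩ := h1
    obtain ⟨δ₂, hδ₂, h2⟩ := Metric.isOpen_iff.1 isOpen_ball _ hx
    set δ := min δ₁ δ₂ with hδ
    have hδ0 : 0 < δ := lt_min hδ₁ hδ₂
    have hin : ∀ s ∈ Ioo (x - δ/2) (x + δ/2), ∀ ε ∈ Ioo 0 (δ/2),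
        (s + ε * Complex.I : ℂ) ∈ ball (x : ℂ) δ := by
      intro s hs ε hε
      rw [mem_ball, Complex.dist_eq]
      have : (s + ε * Complex.I - x : ℂ) = ((s - x : ℝ) : ℂ) + ((ε : ℝ) : ℂ) * Complex.I := by
        push_cast; ring
      rw [this]
      refine (norm_add_le _ _).trans_lt ?_
      rw [norm_mul, Complex.norm_real, Complex.norm_real, Complex.norm_I, mul_one,
        Real.norm_eq_abs, Real.norm_eq_abs]
      have : |s - x| < δ/2 := by rw [abs_lt]; constructor <;> linarith [hs.1, hs.2]
      have : |ε| < δ/2 := by rw [abs_lt]; constructor <;> linarith [hε.1, hε.2]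
      linarith
    have hbd : ∀ y ∈ Ioo (x - δ/2) (x + δ/2), ∀ ε ∈ Ioo 0 (δ/2),
        ‖gi (y + ε * Complex.I) - gi (x + ε * Complex.I)‖ ≤ η * ‖y - x‖ := by
      intro y hy ε hε
      have hmH : ∀ s ∈ Ioo (x - δ/2) (x + δ/2), (s + ε * Complex.I : ℂ) ∈ Hs := fun s hs =>
        ⟨h2 (ball_subset_ball (min_le_right _ _) (hin s hs ε hε)), by simpa using hε.1⟩
      have hd : ∀ s ∈ Ioo (x - δ/2) (x + δ/2),
          HasDerivAt (fun s : ℝ => gi (s + ε * Complex.I)) (U (s + ε * Complex.I)).im s := by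
        intro s hs
        have a1 : HasDerivAt (fun s : ℂ => g (s + ε * Complex.I)) (U (s + ε * Complex.I)) (s : ℂ) :=
          ((hg _ (hmH s hs)).hasDerivAt (hop.mem_nhds (hmH s hs))).comp_add_const _ _
        have a2 := a1.comp_ofReal
        have a3 : HasDerivAt (fun s : ℝ => (g (s + ε * Complex.I)).im)
            (U (s + ε * Complex.I)).im s := by
          exact (Complex.imCLM.hasFDerivAt (x := g (s + ε * Complex.I))).comp_hasDerivAt s a2
        refine a3.congr_of_eventuallyEq ?_
        filter_upwards [isOpen_Ioo.mem_nhds hs] with t ht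
        exact (ei (hmH t ht)).symm
      refine Convex.norm_image_sub_le_of_norm_hasDerivWithin_le (s := Ioo (x - δ/2) (x + δ/2))
        (fun s hs => (hd s hs).hasDerivWithinAt) (fun s hs => ?_) (convex_Ioo _ _) ⟨by linarith, by linarith⟩ hy
      have := h1 _ (ball_subset_ball (min_le_left _ _) (hin s hs ε hε)) (by simpa using hε.1)
      rw [dist_zero_right] at this
      exact this.le
    filter_upwards [isOpen_Ioo.mem_nhds (show x ∈ Ioo (x - δ/2) (x + δ/2) from
      ⟨by linarith, by linarith⟩)] with y hy
    have hcont : ∀ y : ℝ, Tendsto (fun ε : ℝ => gi (y + ε * Complex.I)) (𝓝[>] 0) (𝓝 (gi y)) := by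
      intro y
      have : Continuous (fun ε : ℝ => gi (y + ε * Complex.I)) := hgi.continuous.comp (by fun_prop)
      have h3 := this.tendsto 0
      simp only [Complex.ofReal_zero, zero_mul, add_zero] at h3
      exact h3.mono_left nhdsWithin_le_nhds
    have := le_of_tendsto ((hcont y).sub (hcont x)).norm (b := η * ‖y - x‖) (by
      filter_upwards [Ioo_mem_nhdsGT (show (0 : ℝ) < δ/2 by linarith)] with ε hε
      exact hbd y hy ε hε)
    simpa using this
  have hconst : ∃ c : ℝ, ∀ x : ℝ, (x : ℂ) ∈ ball (x₀ : ℂ) ρ → gi x = c := by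
    refine ⟨gi x₀, fun x hx => ?_⟩
    have hI : ∀ x : ℝ, (x : ℂ) ∈ ball (x₀ : ℂ) ρ ↔ x ∈ ball x₀ ρ := by
      intro x
      rw [mem_ball, mem_ball, Complex.dist_eq, Real.dist_eq, ← Complex.ofReal_sub,
        Complex.norm_real, Real.norm_eq_abs]
    have hρ : 0 < ρ := pos_of_mem_ball hx
    have h := (convex_ball x₀ ρ).norm_image_sub_le_of_norm_hasDerivWithin_le
      (f := fun t : ℝ => gi t) (f' := fun _ => 0) (C := 0)
      (fun s hs => (hder s ((hI s).2 hs)).hasDerivWithinAt) (fun s hs => by simp)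
      (mem_ball_self hρ) ((hI x).1 hx)
    simpa [sub_eq_zero] using h
  obtain ⟨c, hc⟩ := hconst
  set p : ℂ → ℂ := fun w => gr w + (gi w - c : ℝ) * Complex.I with hp
  have hpc : Continuous p := by
    have := hgr.continuous; have := hgi.continuous
    fun_prop
  have hpg : ∀ w ∈ Hs, p w = g w - c * Complex.I := by
    intro w hw
    have h1 := er hw
    have h2 := ei hw
    simp only [Function.comp] at h1 h2
    apply Complex.ext <;> simp [hp, ← h1, ← h2]
  have hpr : ∀ w ∈ ball (x₀ : ℂ) ρ, w.im = 0 → conj (p w) = p w := by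
    intro w hw h
    have hw' : w = (w.re : ℂ) := by apply Complex.ext <;> simp [h]
    rw [Complex.conj_eq_iff_im]
    simp only [hp]
    have := hc w.re (hw' ▸ hw)
    rw [← hw'] at this
    simp [this]
  have hcr : ∀ w : ℂ, w.im = 0 → conj w = w := fun w h => Complex.conj_eq_iff_im.2 h
  set q : ℂ → ℂ := fun w => if 0 ≤ w.im then p w else conj (p (conj w)) with hq
  have hqc : ContinuousOn q (ball (x₀ : ℂ) ρ) := by
    refine ContinuousOn.if ?_ hpc.continuousOn ?_
    · intro a ha
      have h0 : a.im = 0 := by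
        have := ha.2
        rw [show {a : ℂ | 0 ≤ a.im} = Complex.im ⁻¹' (Ici 0) from rfl,
          Complex.frontier_preimage_im, frontier_Ici] at this
        exact this
      rw [hcr a h0, hpr a ha.1 h0]
    · exact (Complex.continuous_conj.comp (hpc.comp Complex.continuous_conj)).continuousOn
  have hpd : ∀ w ∈ Hs, HasDerivAt p (U w) w := by
    intro w hw
    have := ((hg w hw).hasDerivAt (hop.mem_nhds hw)).sub_const (c * Complex.I)
    refine this.congr_of_eventuallyEq ?_
    filter_upwards [hop.mem_nhds hw] with v hv using hpg v hv
  have hqp : ∀ w ∈ Hs, HasDerivAt q (U w) w := by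
    intro w hw
    refine (hpd w hw).congr_of_eventuallyEq ?_
    filter_upwards [hop.mem_nhds hw] with v hv
    simp only [hq]
    rw [if_pos (le_of_lt hv.2)]
  have hqsym : ∀ w ∈ ball (x₀ : ℂ) ρ, q w = (conj ∘ q ∘ conj) w := by
    intro w hw
    simp only [hq, Function.comp, Complex.conj_im]
    rcases lt_trichotomy w.im 0 with h | h | h
    · rw [if_neg (not_le.2 h), if_pos (by linarith)]
    · simp [h, hcr w h, hpr w hw h]
    · rw [if_pos h.le, if_neg (by linarith)]; simp
  have hqd : DifferentiableOn ℂ q (ball (x₀ : ℂ) ρ) := by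
    apply holo_of_off_real hqc
    intro z hz hz0
    rcases lt_or_gt_of_ne hz0 with h | h
    · have hz' : conj z ∈ Hs := ⟨conjball z hz, by simpa using h⟩
      have := (hqp _ hz').conj_conj.differentiableAt
      rw [Complex.conj_conj] at this
      refine this.congr_of_eventuallyEq ?_
      filter_upwards [isOpen_ball.mem_nhds hz] with v hv using hqsym v hv
    · exact (hqp z ⟨hz, h⟩).differentiableAt
  refine ⟨deriv q, hqd.deriv isOpen_ball, fun w hw => (hqp w hw).deriv, ?_⟩
  intro w hw
  have h1 := (hqd.differentiableAt (isOpen_ball.mem_nhds hw)).hasDerivAt.conj_conj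
  have h2 : HasDerivAt q (conj (deriv q w)) (conj w) := by
    refine h1.congr_of_eventuallyEq ?_
    filter_upwards [isOpen_ball.mem_nhds (conjball w hw)] with v hv using hqsym v hv
  exact h2.deriv
end

section
open MeasureTheory in
theorem area_bound {Ω : Set ℂ} (hΩ : IsOpen Ω) {f : ℂ → ℂ} (hf : DifferentiableOn ℂ f Ω)
    (hi : InjOn f Ω) (hb : ∀ u ∈ Ω, ‖f u‖ ≤ 1) :
    ∫⁻ u in Ω, ENNReal.ofReal (‖deriv f u‖ ^ 2) < ⊤ := by
  have h1 := lintegral_image_eq_lintegral_abs_det_fderiv_mul (μ := (volume : Measure ℂ))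
    hΩ.measurableSet (f := f)
    (f' := fun z => (ContinuousLinearMap.toSpanSingleton ℂ (deriv f z)).restrictScalars ℝ)
    (fun z hz => by
      have := (hf.differentiableAt (hΩ.mem_nhds hz)).hasDerivAt.hasFDerivAt
      exact (this.restrictScalars ℝ).hasFDerivWithinAt)
    hi (fun _ => 1)
  have h2 : ∀ z, |((ContinuousLinearMap.toSpanSingleton ℂ (deriv f z)).restrictScalars ℝ).det|
      = ‖deriv f z‖ ^ 2 := by
    intro z
    simp [ContinuousLinearMap.det, LinearMap.det_restrictScalars,
      Algebra.norm_complex_apply, Complex.normSq_eq_norm_sq]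
  simp only [h2, mul_one, lintegral_const, one_mul, Measure.restrict_apply, MeasurableSet.univ,
    univ_inter] at h1
  rw [← h1]
  refine (measure_mono (t := closedBall 0 1) ?_).trans_lt measure_closedBall_lt_top
  rintro _ ⟨u, hu, rfl⟩
  simpa using hb u hu

open MeasureTheory in
theorem length_area {Ω : Set ℂ} (hΩ : IsOpen Ω)
    (hcv : ∀ x : ℝ, OrdConnected {y : ℝ | (x + y * Complex.I : ℂ) ∈ Ω}) {B : ℝ} (hB0 : 0 ≤ B)
    (hB : ∀ u ∈ Ω, |u.im| ≤ B) {f : ℂ → ℂ} (hf : DifferentiableOn ℂ f Ω)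
    (hi : InjOn f Ω) (hb : ∀ u ∈ Ω, ‖f u‖ ≤ 1) {ε : ℝ} (hε : 0 < ε) (X : ℝ) :
    ∃ x < X, ∀ u ∈ Ω, ∀ v ∈ Ω, u.re = x → v.re = x → ‖f v - f u‖ ≤ ε := by
  set η : ℝ := ε / (2 * B + 2) with hη
  have hη0 : 0 < η := by positivity
  have hηB : η * (2 * B) ≤ ε := by
    rw [hη, div_mul_eq_mul_div, div_le_iff₀ (by positivity)]
    nlinarith
  clear_value η
  set F : ℂ → ENNReal := Ω.indicator (fun u => ENNReal.ofReal (‖deriv f u‖ ^ 2)) with hF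
  have hFm : Measurable F := by
    refine Measurable.indicator ?_ hΩ.measurableSet
    exact (((measurable_deriv f).norm).pow_const 2).ennreal_ofReal
  have hfin : ∫⁻ u, F u < ⊤ := by
    rw [hF, lintegral_indicator hΩ.measurableSet]
    exact area_bound hΩ hf hi hb
  have hfub : ∫⁻ u, F u = ∫⁻ x : ℝ, ∫⁻ y : ℝ, F (x + y * Complex.I) := by
    rw [← (Complex.volume_preserving_equiv_real_prod.symm).lintegral_comp hFm,
      Measure.volume_eq_prod, lintegral_prod]
    · congr! with x y
      apply Complex.ext <;> simp
    · exact (hFm.comp Complex.measurableEquivRealProd.symm.measurable).aemeasurable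
  have hex : ∃ x < X, ∫⁻ y : ℝ, F (x + y * Complex.I) < ENNReal.ofReal (η * ε) := by
    by_contra! hcon
    have : ∫⁻ _ in Iio X, ENNReal.ofReal (η * ε) ≤ ∫⁻ x : ℝ, ∫⁻ y : ℝ, F (x + y * Complex.I) := by
      refine le_trans ?_ (setLIntegral_le_lintegral (Iio X) _)
      exact setLIntegral_mono' measurableSet_Iio (fun x hx => hcon x hx)
    rw [← hfub] at this
    have h3 := this.trans_lt hfin
    simp at h3
    rw [ENNReal.mul_top] at h3
    · exact lt_irrefl _ h3
    · simp; positivity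
  obtain ⟨x, hxX, hx⟩ := hex
  refine ⟨x, hxX, ?_⟩
  have key : ∀ a b : ℝ, a ≤ b → (x + a * Complex.I : ℂ) ∈ Ω → (x + b * Complex.I : ℂ) ∈ Ω →
      ‖f (x + b * Complex.I) - f (x + a * Complex.I)‖ ≤ ε := by
    intro a b hab ha hb'
    have hin : ∀ y ∈ Icc a b, (x + y * Complex.I : ℂ) ∈ Ω := fun y hy => (hcv x).out ha hb' hy
    have hdc : ContinuousOn (fun y : ℝ => deriv f (x + y * Complex.I)) (Icc a b) :=
      (hf.deriv hΩ).continuousOn.comp (by fun_prop) hin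
    have hdc' : ContinuousOn (fun y : ℝ => deriv f (x + y * Complex.I)) (uIcc a b) := by
      rwa [uIcc_of_le hab]
    have hder : ∀ y ∈ uIcc a b, HasDerivAt (fun y : ℝ => f (x + y * Complex.I))
        (deriv f (x + y * Complex.I) * Complex.I) y := by
      intro y hy
      rw [uIcc_of_le hab] at hy
      have h1 := (hf.differentiableAt (hΩ.mem_nhds (hin y hy))).hasDerivAt
      have h2 : HasDerivAt (fun y : ℂ => x + y * Complex.I) Complex.I (y : ℂ) := by
        simpa using ((hasDerivAt_id (y : ℂ)).mul_const Complex.I).const_add (x : ℂ)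
      exact (h1.comp (y : ℂ) h2).comp_ofReal
    have hintg := intervalIntegral.integral_eq_sub_of_hasDerivAt hder
      (ContinuousOn.intervalIntegrable (hdc'.mul continuousOn_const))
    rw [← hintg]
    have i1 : IntervalIntegrable (fun y : ℝ => ‖deriv f (x + y * Complex.I)‖ ^ 2) volume a b :=
      ContinuousOn.intervalIntegrable (hdc'.norm.pow 2)
    have i0 : IntervalIntegrable (fun y : ℝ => (η + ‖deriv f (x + y * Complex.I)‖ ^ 2 / η) / 2) volume a b :=
      ContinuousOn.intervalIntegrable ((continuousOn_const.add ((hdc'.norm.pow 2).div_const _)).div_const _)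
    refine (intervalIntegral.norm_integral_le_of_norm_le hab
      (g := fun y : ℝ => (η + ‖deriv f (x + y * Complex.I)‖ ^ 2 / η) / 2) ?_ i0).trans ?_
    · refine Eventually.of_forall fun y hy => ?_
      rw [norm_mul, Complex.norm_I, mul_one]
      set t := ‖deriv f (x + y * Complex.I)‖
      have : 0 ≤ (t - η) ^ 2 / η := by positivity
      have e : (t - η) ^ 2 / η = t ^ 2 / η - 2 * t + η := by field_simp; ring
      linarith
    · rw [intervalIntegral.integral_div, intervalIntegral.integral_add (by simp) (i1.div_const _),
        intervalIntegral.integral_div, intervalIntegral.integral_const]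
      have hA : ∫ y in a..b, ‖deriv f (x + y * Complex.I)‖ ^ 2 ≤ η * ε := by
        rw [← ENNReal.ofReal_le_ofReal_iff (by positivity),
          intervalIntegral.integral_of_le hab]
        rw [ofReal_integral_eq_lintegral_ofReal i1.1 (Eventually.of_forall fun y => by positivity)]
        refine le_trans ?_ hx.le
        rw [← lintegral_indicator measurableSet_Ioc]
        refine lintegral_mono fun y => ?_
        by_cases hy : y ∈ Ioc a b
        · rw [indicator_of_mem hy, hF, indicator_of_mem (hin y (Ioc_subset_Icc_self hy))]
        · simp [indicator_of_notMem hy]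
      have hab2 : b - a ≤ 2 * B := by
        have h1 := hB _ ha
        have h2 := hB _ hb'
        simp at h1 h2
        linarith [(abs_le.1 h1).1, (abs_le.1 h2).2]
      have h4 : (∫ y in a..b, ‖deriv f (x + y * Complex.I)‖ ^ 2) / η ≤ ε := by
        rw [div_le_iff₀ hη0]; linarith
      have h5 : (b - a) * η ≤ ε := by nlinarith
      simp only [smul_eq_mul]
      linarith
  intro u hu v hv hux hvx
  have eu : u = (x + u.im * Complex.I : ℂ) := by rw [← hux]; simp
  have ev : v = (x + v.im * Complex.I : ℂ) := by rw [← hvx]; simp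
  rw [eu] at hu ⊢
  rw [ev] at hv ⊢
  rcases le_total u.im v.im with h | h
  · simpa using key _ _ h hu hv
  · rw [norm_sub_rev]
    simpa using key _ _ h hv hu
end

section
open ComplexConjugate

theorem conj_mem_ball0 {r : ℝ} {z : ℂ} (hz : z ∈ ball (0 : ℂ) r) : conj z ∈ ball (0 : ℂ) r := by
  simpa using hz

theorem local_inverse {f : ℂ → ℂ} (hf : AnalyticAt ℂ f 0) (h0 : f 0 = 0) (hd : deriv f 0 ≠ 0)
    {N : Set ℂ} (hN : N ∈ 𝓝 (0 : ℂ)) :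
    ∃ ε > 0, ball (0 : ℂ) ε ⊆ N ∧ DifferentiableOn ℂ f (ball 0 ε) ∧ InjOn f (ball 0 ε) ∧
      ∃ δ > 0, ∃ g : ℂ → ℂ, DifferentiableOn ℂ g (ball 0 δ) ∧
        (∀ w ∈ ball (0 : ℂ) δ, g w ∈ ball (0 : ℂ) ε ∧ f (g w) = w) ∧
        ∀ z ∈ ball (0 : ℂ) ε, g (f z) = z := by
  have hs : HasStrictDerivAt f (deriv f 0) 0 := hf.hasStrictDerivAt
  have hinj : ∃ V ∈ 𝓝 (0 : ℂ), InjOn f V := by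
    have := hs.eventually_left_inverse hd
    refine ⟨_, this, ?_⟩
    intro x hx y hy hxy
    have hx' : hs.localInverse f (deriv f 0) 0 hd (f x) = x := hx
    have hy' : hs.localInverse f (deriv f 0) 0 hd (f y) = y := hy
    rw [← hx', ← hy', hxy]
  obtain ⟨V, hV, hVi⟩ := hinj
  obtain ⟨ε, hε, hsub⟩ := Metric.mem_nhds_iff.1 (inter_mem (inter_mem hN hV)
    hf.eventually_analyticAt)
  have hfd : DifferentiableOn ℂ f (ball 0 ε) := fun z hz =>
    (hsub hz).2.differentiableAt.differentiableWithinAt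
  have hfi : InjOn f (ball 0 ε) := hVi.mono fun z hz => (hsub hz).1.2
  have hleft : ∀ z ∈ ball (0 : ℂ) ε, Function.invFunOn f (ball 0 ε) (f z) = z := fun z hz =>
    hfi.leftInvOn_invFunOn hz
  have hop := inj_isOpen_image isOpen_ball hfd hfi isOpen_ball le_rfl
  obtain ⟨δ, hδ, hδs⟩ := Metric.isOpen_iff.1 hop 0 ⟨0, mem_ball_self hε, h0⟩
  refine ⟨ε, hε, fun z hz => (hsub hz).1.1, hfd, hfi, δ, hδ, Function.invFunOn f (ball 0 ε),
    (inj_inv_differentiable isOpen_ball hfd hfi hleft).mono hδs, ?_, hleft⟩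
  intro w hw
  obtain ⟨z, hz, rfl⟩ := hδs hw
  rw [hleft z hz]
  exact ⟨hz, rfl⟩

theorem local_inverse_symm {f g : ℂ → ℂ} {ε δ : ℝ} (hi : InjOn f (ball 0 ε))
    (hg : ∀ w ∈ ball (0 : ℂ) δ, g w ∈ ball (0 : ℂ) ε ∧ f (g w) = w)
    (hsym : ∀ z ∈ ball (0 : ℂ) ε, f (conj z) = conj (f z)) :
    ∀ w ∈ ball (0 : ℂ) δ, g (conj w) = conj (g w) := by
  intro w hw
  have h1 := hg w hw
  have h2 := hg (conj w) (conj_mem_ball0 hw)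
  apply hi h2.1 (conj_mem_ball0 h1.1)
  rw [h2.2, hsym _ h1.1, h1.2]

theorem analyticAt_conj_conj {f : ℂ → ℂ} (hf : AnalyticAt ℂ f 0) :
    AnalyticAt ℂ (fun z => conj (f (conj z))) 0 := by
  obtain ⟨ε, hε, h⟩ := Metric.eventually_nhds_iff_ball.1 hf.eventually_analyticAt
  apply DifferentiableOn.analyticAt (s := ball 0 ε) _ (ball_mem_nhds 0 hε)
  intro z hz
  have := (h (conj z) (conj_mem_ball0 hz)).differentiableAt.conj_conj
  rw [Complex.conj_conj] at this
  exact this.differentiableWithinAt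

/-- boundary arcs in polar form, first version -/
theorem polar_raw {B : Set ℂ} {φ₁ φ₂ : ℂ → ℂ} {ρ : ℝ} (hρ : 0 < ρ)
    (h1d : DifferentiableOn ℂ φ₁ (ball 0 1)) (h1i : InjOn φ₁ (ball 0 1)) (h10 : φ₁ 0 = 0)
    (h2d : DifferentiableOn ℂ φ₂ (ball 0 1)) (h2i : InjOn φ₂ (ball 0 1)) (h20 : φ₂ 0 = 0)
    (h2n : deriv φ₂ 0 ≠ 0)
    (hB : B ∩ ball (0 : ℂ) ρ =
    (φ₁ '' (Complex.ofReal '' Ico (0 : ℝ) 1) ∪ φ₂ '' (Complex.ofReal '' Ico (0 : ℝ) 1)) ∩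
      ball (0 : ℂ) ρ) :
    ∃ r > 0, r ≤ 1 ∧ ∃ a : ℂ → ℂ, DifferentiableOn ℂ a (ball 0 r) ∧
      (∀ z ∈ ball (0 : ℂ) r, a (conj z) = conj (a z)) ∧
      ∀ z ∈ ball (0 : ℂ) r, z ≠ 0 → (φ₁ z ∈ B ↔
        (z = (‖z‖ : ℂ) ∨ z = (‖z‖ : ℂ) * Complex.exp (Complex.I * a (‖z‖ : ℂ)))) := by
  have one : ball (0 : ℂ) 1 ∈ 𝓝 (0 : ℂ) := ball_mem_nhds 0 one_pos
  have m1 : (0 : ℂ) ∈ ball (0 : ℂ) 1 := mem_ball_self one_pos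
  set χ := Function.invFunOn φ₁ (ball 0 1) with hχ
  have hχl : ∀ z ∈ ball (0 : ℂ) 1, χ (φ₁ z) = z := fun z hz => h1i.leftInvOn_invFunOn hz
  have hχd := inj_inv_differentiable isOpen_ball h1d h1i hχl
  have hO1 := inj_isOpen_image isOpen_ball h1d h1i isOpen_ball le_rfl
  have h01 : (0 : ℂ) ∈ φ₁ '' ball 0 1 := ⟨0, m1, h10⟩
  have hχ0 : χ 0 = 0 := by simpa [h10] using hχl 0 m1
  have hχa : AnalyticAt ℂ χ 0 := hχd.analyticAt (hO1.mem_nhds h01)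
  have h1a : AnalyticAt ℂ φ₁ 0 := h1d.analyticAt one
  have h2a : AnalyticAt ℂ φ₂ 0 := h2d.analyticAt one
  have hχ' : deriv χ 0 ≠ 0 := by
    intro h
    have c1 : HasDerivAt (χ ∘ φ₁) (deriv χ (φ₁ 0) * deriv φ₁ 0) 0 :=
      HasDerivAt.comp 0 (by rw [h10]; exact hχa.differentiableAt.hasDerivAt)
        h1a.differentiableAt.hasDerivAt
    have c2 : HasDerivAt (χ ∘ φ₁) 1 0 := by
      refine (hasDerivAt_id (0 : ℂ)).congr_of_eventuallyEq ?_
      filter_upwards [one] with z hz using hχl z hz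
    have := c1.unique c2
    rw [h10, h] at this
    simp at this
  set ψ := χ ∘ φ₂ with hψ
  have hψa : AnalyticAt ℂ ψ 0 := by
    apply AnalyticAt.comp _ h2a
    rwa [h20]
  have hψ0 : ψ 0 = 0 := by simp [hψ, h20, hχ0]
  have hψ' : deriv ψ 0 ≠ 0 := by
    have : HasDerivAt ψ (deriv χ (φ₂ 0) * deriv φ₂ 0) 0 :=
      HasDerivAt.comp 0 (by rw [h20]; exact hχa.differentiableAt.hasDerivAt)
        h2a.differentiableAt.hasDerivAt
    rw [this.deriv, h20]
    exact mul_ne_zero hχ' h2n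
  set k := dslope ψ 0 with hk
  have hka : AnalyticAt ℂ k 0 := by
    obtain ⟨U, hU, hUo⟩ := hψa.exists_mem_nhds_analyticOnNhd
    have : DifferentiableOn ℂ k U := by
      rw [hk, Complex.differentiableOn_dslope hU]
      exact hUo.differentiableOn
    exact this.analyticAt hU
  have hk0 : k 0 = deriv ψ 0 := dslope_same _ _
  have hψk : ∀ t, ψ t = t * k t := by
    intro t
    have := sub_smul_dslope ψ 0 t
    simp [hψ0] at this
    exact this.symm
  set κ : ℂ → ℂ := fun t => Complex.log (k 0) + Complex.log (k t / k 0) with hκ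
  have hk00 : k 0 ≠ 0 := by rwa [hk0]
  have hκa : AnalyticAt ℂ κ 0 := by
    refine analyticAt_const.add (AnalyticAt.clog (hka.div_const) ?_)
    rw [div_self hk00]; simp
  have hκe : ∀ᶠ t in 𝓝 (0 : ℂ), Complex.exp (κ t) = k t := by
    filter_upwards [hka.continuousAt.eventually_ne hk00] with t ht
    rw [hκ]
    simp only
    rw [Complex.exp_add, Complex.exp_log hk00, Complex.exp_log (div_ne_zero ht hk00)]
    field_simp
  have hκs := analyticAt_conj_conj hκa
  set p : ℂ → ℂ := fun t => (κ t + conj (κ (conj t))) / 2 with hp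
  set m : ℂ → ℂ := fun t => (κ t - conj (κ (conj t))) / (2 * Complex.I) with hm
  have hpa : AnalyticAt ℂ p 0 := (hκa.add hκs).div_const
  have hma : AnalyticAt ℂ m 0 := (hκa.sub hκs).div_const
  have hpm : ∀ t, κ t = p t + Complex.I * m t := by
    intro t; simp only [hp, hm]; field_simp; ring
  have c2 : conj (2 : ℂ) = 2 := map_ofNat _ 2
  have hpsym : ∀ t, p (conj t) = conj (p t) := by
    intro t; simp [hp, c2]; ring
  have hmsym : ∀ t, m (conj t) = conj (m t) := by
    intro t; simp [hm, c2]; ring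
  set S : ℂ → ℂ := fun t => t * Complex.exp (p t) with hS
  have hSa : AnalyticAt ℂ S 0 := analyticAt_id.mul hpa.cexp
  have hS' : deriv S 0 ≠ 0 := by
    have : HasDerivAt S (1 * Complex.exp (p 0) + 0 * deriv (fun t => Complex.exp (p t)) 0) 0 :=
      (hasDerivAt_id (0 : ℂ)).mul hpa.cexp.differentiableAt.hasDerivAt
    rw [this.deriv]; simp
  obtain ⟨ε, hε, hεN, hSd, hSi, δ, hδ, τ, hτd, hτ, hτl⟩ := local_inverse hSa (by simp [hS]) hS'
    (inter_mem (inter_mem one hκe) (inter_mem hma.eventually_analyticAt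
      (h2a.continuousAt.preimage_mem_nhds (by rw [h20]; exact hO1.mem_nhds h01))))
  have hτsym := local_inverse_symm hSi hτ (by
    intro z _; simp only [hS, hpsym, map_mul, Complex.exp_conj])
  -- representation of the second arc
  have hrep : ∀ t ∈ ball (0 : ℂ) ε, ψ t = S t * Complex.exp (Complex.I * m t) := by
    intro t ht
    have : Complex.exp (κ t) = k t := (hεN ht).1.2
    rw [hψk, ← this, hpm, Complex.exp_add, hS, mul_assoc]
  have hSreal : ∀ t : ℝ, ∃ e : ℝ, 0 < e ∧ S t = ((t * e : ℝ) : ℂ) := by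
    intro t
    refine ⟨Real.exp (p t).re, Real.exp_pos _, ?_⟩
    have : p t = ((p t).re : ℂ) := by
      have := hpsym t
      rw [Complex.conj_ofReal] at this
      exact (Complex.conj_eq_iff_re.1 this.symm).symm
    simp only [hS]
    conv_lhs => rw [this]
    push_cast
    rfl
  have hmreal : ∀ t : ℝ, m t = ((m t).re : ℂ) := by
    intro t
    have := hmsym t
    rw [Complex.conj_ofReal] at this
    exact (Complex.conj_eq_iff_re.1 this.symm).symm
  have hO2 := inj_isOpen_image isOpen_ball h2d h2i (V := ball 0 ε) isOpen_ball
    (fun z hz => (hεN hz).1.1)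
  have h02 : (0 : ℂ) ∈ φ₂ '' ball 0 ε := ⟨0, mem_ball_self hε, h20⟩
  have hcont : ∀ᶠ z in 𝓝 (0 : ℂ), φ₁ z ∈ φ₂ '' ball 0 ε ∩ ball 0 ρ := by
    apply h1a.continuousAt.preimage_mem_nhds
    rw [h10]
    exact inter_mem (hO2.mem_nhds h02) (ball_mem_nhds 0 hρ)
  obtain ⟨r₁, hr₁, hr₁s⟩ := Metric.eventually_nhds_iff_ball.1 hcont
  set r := min (min r₁ δ) 1 with hr
  have hr1 : ball (0 : ℂ) r ⊆ ball 0 r₁ := ball_subset_ball ((min_le_left _ _).trans (min_le_left _ _))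
  have hrδ : ball (0 : ℂ) r ⊆ ball 0 δ := ball_subset_ball ((min_le_left _ _).trans (min_le_right _ _))
  have hr11 : ball (0 : ℂ) r ⊆ ball 0 1 := ball_subset_ball (min_le_right _ _)
  refine ⟨r, by positivity, min_le_right _ _, m ∘ τ, ?_, ?_, ?_⟩
  · intro z hz
    have h := (hτ z (hrδ hz)).1
    have hmA : AnalyticAt ℂ m (τ z) := (hεN h).2.1
    exact (hmA.differentiableAt.comp z (hτd.differentiableAt
      (isOpen_ball.mem_nhds (hrδ hz)))).differentiableWithinAt
  · intro z hz
    simp only [Function.comp, hτsym z (hrδ hz), hmsym]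
  intro z hz hz0
  have hznorm : ((‖z‖ : ℝ) : ℂ) ∈ ball (0 : ℂ) δ := by
    have := hrδ hz
    simpa using this
  have hzB : φ₁ z ∈ B ↔ (φ₁ z ∈ φ₁ '' (Complex.ofReal '' Ico (0 : ℝ) 1) ∨
      φ₁ z ∈ φ₂ '' (Complex.ofReal '' Ico (0 : ℝ) 1)) := by
    have hb : φ₁ z ∈ ball 0 ρ := (hr₁s z (hr1 hz)).2
    have := Set.ext_iff.1 hB (φ₁ z)
    simpa only [mem_inter_iff, hb, and_true, mem_union] using this
  have hzp : 0 < ‖z‖ := norm_pos_iff.2 hz0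
  rw [hzB]
  refine or_congr ?_ ?_
  · constructor
    · rintro ⟨_, ⟨t, ht, rfl⟩, h⟩
      have htb : (t : ℂ) ∈ ball (0 : ℂ) 1 := by
        simp [abs_of_nonneg ht.1, ht.2]
      have := h1i htb (hr11 hz) h
      rw [← this]; simp [abs_of_nonneg ht.1]
    · intro h
      refine ⟨z, ⟨‖z‖, ⟨norm_nonneg _, ?_⟩, h.symm⟩, rfl⟩
      simpa using hr11 hz
  · constructor
    · rintro ⟨_, ⟨t, ht, rfl⟩, h⟩
      have htb : (t : ℂ) ∈ ball (0 : ℂ) 1 := by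
        simp [abs_of_nonneg ht.1, ht.2]
      obtain ⟨t', ht', h'⟩ := (hr₁s z (hr1 hz)).1
      have htt : t' = t := h2i (hεN ht').1.1 htb (h'.trans h.symm)
      rw [htt] at ht'
      have hψt : ψ t = z := by
        simp only [hψ, Function.comp, h, hχl z (hr11 hz)]
      obtain ⟨e, he, hSe⟩ := hSreal t
      have hn : ‖z‖ = t * e := by
        rw [← hψt, hrep _ ht', hSe, hmreal, norm_mul, Complex.norm_exp]
        simp [abs_of_nonneg ht.1, abs_of_pos he]
      have hSn : S t = (‖z‖ : ℂ) := by rw [hSe, hn]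
      have : τ (‖z‖ : ℂ) = t := by rw [← hSn]; exact hτl _ ht'
      simp only [Function.comp, this]
      rw [← hSn, ← hrep _ ht', hψt]
    · intro h
      obtain ⟨hτ1, hτ2⟩ := hτ _ hznorm
      have hτr := hτsym _ hznorm
      rw [Complex.conj_ofReal] at hτr
      have hτr' := Complex.conj_eq_iff_re.1 hτr.symm
      set t := (τ (‖z‖ : ℂ)).re with ht
      rw [← hτr'] at hτ1 hτ2
      obtain ⟨e, he, hSe⟩ := hSreal t
      have hn : t * e = ‖z‖ := by
        rw [hSe] at hτ2; exact_mod_cast hτ2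
      have htp : 0 < t := by
        by_contra hc
        push Not at hc
        nlinarith
      have ht1 : t < 1 := by
        have := (hεN hτ1).1.1
        simp at this
        linarith [le_abs_self t]
      have hψt : ψ t = z := by
        rw [hrep _ hτ1, hτ2, hτr']
        exact h.symm
      refine ⟨t, ⟨t, ⟨htp.le, ht1⟩, rfl⟩, ?_⟩
      obtain ⟨v, hv, hv'⟩ := (hεN hτ1).2.2
      rw [← hψt, hψ]
      simp only [Function.comp]
      rw [← hv', hχl v hv]
end

section
open ComplexConjugate

theorem sign_const {α : Type*} [TopologicalSpace α] {s : Set α} (hs : IsPreconnected s) {f : α → ℝ}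
    (hf : ContinuousOn f s) (hne : ∀ x ∈ s, f x ≠ 0) : (∀ x ∈ s, 0 < f x) ∨ ∀ x ∈ s, f x < 0 := by
  by_contra! h
  obtain ⟨⟨x, hx, hx0⟩, y, hy, hy0⟩ := h
  obtain ⟨z, hz, hz0⟩ := hs.intermediate_value hx hy hf ⟨hx0, hy0⟩
  exact hne z hz hz0

theorem real_of_symm {a : ℂ → ℂ} {r : ℝ} (h : ∀ z ∈ ball (0 : ℂ) r, a (conj z) = conj (a z))
    {s : ℝ} (hs : |s| < r) : a s = ((a s).re : ℂ) := by
  have := h s (by simpa using hs)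
  rw [Complex.conj_ofReal] at this
  exact (Complex.conj_eq_iff_re.1 this.symm).symm

theorem polar_norm {r : ℝ} (hr : 0 < r) {a : ℂ → ℂ} (ha : DifferentiableOn ℂ a (ball 0 r))
    (hsym : ∀ z ∈ ball (0 : ℂ) r, a (conj z) = conj (a z)) :
    ∃ r' > 0, r' ≤ r ∧ ∃ a' : ℂ → ℂ, DifferentiableOn ℂ a' (ball 0 r') ∧
      (∀ z ∈ ball (0 : ℂ) r', a' (conj z) = conj (a' z)) ∧
      (∀ z ∈ ball (0 : ℂ) r', Complex.exp (Complex.I * a' z) = Complex.exp (Complex.I * a z)) ∧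
      ((∀ s : ℝ, 0 < s → s < r' → 0 < (a' s).re ∧ (a' s).re < 2 * Real.pi) ∨
        (∀ s : ℝ, 0 < s → s < r' → a' s = (2 * Real.pi : ℝ))) := by
  set n : ℤ := ⌊(a 0).re / (2 * Real.pi)⌋ with hn
  have hpi := Real.pi_pos
  set b : ℂ → ℂ := fun z => a z - (n * (2 * Real.pi) : ℝ) with hb
  have hbd : DifferentiableOn ℂ b (ball 0 r) := ha.sub_const _
  have hbs : ∀ z ∈ ball (0 : ℂ) r, b (conj z) = conj (b z) := by
    intro z hz
    simp only [hb, hsym z hz, map_sub, Complex.conj_ofReal]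
  have hbe : ∀ z, Complex.exp (Complex.I * b z) = Complex.exp (Complex.I * a z) := by
    intro z
    rw [Complex.exp_eq_exp_iff_exists_int]
    refine ⟨-n, ?_⟩
    simp only [hb]; push_cast; ring
  have hbr : ∀ s : ℝ, |s| < r → b s = ((b s).re : ℂ) := fun s hs => real_of_symm hbs hs
  have hbc : ContinuousAt b 0 := (hbd.differentiableAt (ball_mem_nhds 0 hr)).continuousAt
  have hb0 : 0 ≤ (b 0).re ∧ (b 0).re < 2 * Real.pi := by
    simp only [hb, Complex.sub_re, Complex.ofReal_re]
    have h1 := Int.floor_le ((a 0).re / (2 * Real.pi))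
    have h2 := Int.lt_floor_add_one ((a 0).re / (2 * Real.pi))
    rw [le_div_iff₀ (by positivity)] at h1
    rw [div_lt_iff₀ (by positivity)] at h2
    constructor
    · linarith
    · linarith
  have hlt : ∀ᶠ z in 𝓝 (0 : ℂ), (b z).re < 2 * Real.pi :=
    (Complex.continuous_re.continuousAt.comp hbc).eventually_lt continuousAt_const hb0.2
  rcases hb0.1.lt_or_eq with hpos | hzero
  · have hgt : ∀ᶠ z in 𝓝 (0 : ℂ), 0 < (b z).re :=
      continuousAt_const.eventually_lt (Complex.continuous_re.continuousAt.comp hbc) hpos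
    obtain ⟨ε, hε, h⟩ := Metric.eventually_nhds_iff_ball.1 (hlt.and hgt)
    have hss : ball (0 : ℂ) (min ε r) ⊆ ball 0 r := ball_subset_ball (min_le_right _ _)
    refine ⟨min ε r, by positivity, min_le_right _ _, b, hbd.mono hss, fun z hz => hbs z (hss hz),
      fun z _ => hbe z, Or.inl fun s hs hs' => ?_⟩
    have := h s (by
      rw [mem_ball_zero_iff, Complex.norm_real, Real.norm_eq_abs, abs_of_pos hs]
      exact hs'.trans_le (min_le_left _ _))
    exact ⟨this.2, this.1⟩
  · have hbA : AnalyticAt ℂ b 0 := hbd.analyticAt (ball_mem_nhds 0 hr)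
    have hb00 : b 0 = 0 := by
      have := hbr 0 (by simpa using hr)
      simp only [Complex.ofReal_zero] at this
      rw [this, ← hzero]; simp
    have hshift : ∀ z, Complex.exp (Complex.I * (b z + (2 * Real.pi : ℝ))) = Complex.exp (Complex.I * a z) := by
      intro z
      rw [← hbe, Complex.exp_eq_exp_iff_exists_int]
      exact ⟨1, by push_cast; ring⟩
    have hshs : ∀ z ∈ ball (0 : ℂ) r, b (conj z) + (2 * Real.pi : ℝ) = conj (b z + (2 * Real.pi : ℝ)) := by
      intro z hz
      rw [map_add, Complex.conj_ofReal, hbs z hz]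
    rcases hbA.eventually_eq_zero_or_eventually_ne_zero with h | h
    · obtain ⟨ε, hε, h⟩ := Metric.eventually_nhds_iff_ball.1 h
      have hss : ball (0 : ℂ) (min ε r) ⊆ ball 0 r := ball_subset_ball (min_le_right _ _)
      refine ⟨min ε r, by positivity, min_le_right _ _, fun z => b z + (2 * Real.pi : ℝ),
        (hbd.mono hss).add_const _, fun z hz => hshs z (hss hz), fun z _ => hshift z,
        Or.inr fun s hs hs' => ?_⟩
      simp only
      rw [h s (by
        rw [mem_ball_zero_iff, Complex.norm_real, Real.norm_eq_abs, abs_of_pos hs]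
        exact hs'.trans_le (min_le_left _ _)), zero_add]
    · rw [eventually_nhdsWithin_iff] at h
      have hgt : ∀ᶠ z in 𝓝 (0 : ℂ), -(2 * Real.pi) < (b z).re := by
        apply continuousAt_const.eventually_lt (Complex.continuous_re.continuousAt.comp hbc)
        simp [hb00, hpi]
      obtain ⟨ε, hε, h⟩ := Metric.eventually_nhds_iff_ball.1 ((hlt.and hgt).and h)
      set r' := min ε r with hr'
      have hss : ball (0 : ℂ) r' ⊆ ball 0 r := ball_subset_ball (min_le_right _ _)
      have hm : ∀ s : ℝ, 0 < s → s < r' → (s : ℂ) ∈ ball (0 : ℂ) r' := by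
        intro s h1 h2
        rw [mem_ball_zero_iff, Complex.norm_real, Real.norm_eq_abs, abs_of_pos h1]
        exact h2
      have hsε : ball (0 : ℂ) r' ⊆ ball 0 ε := ball_subset_ball (min_le_left _ _)
      have hsg := sign_const (isPreconnected_Ioo (a := (0 : ℝ)) (b := r'))
        (f := fun s : ℝ => (b s).re)
        (Complex.continuous_re.comp_continuousOn (hbd.continuousOn.comp
          Complex.continuous_ofReal.continuousOn (fun s hs => hss (hm s hs.1 hs.2))))
        (fun s hs h0 => by
          have hs' := hm s hs.1 hs.2
          have hsr : |s| < r := by simpa using hss hs'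
          have := (h s (hsε hs')).2 (by simpa using hs.1.ne')
          apply this
          rw [hbr s hsr, h0]; simp)
      rcases hsg with hsg | hsg
      · refine ⟨r', by positivity, min_le_right _ _, b, hbd.mono hss, fun z hz => hbs z (hss hz),
          fun z _ => hbe z, Or.inl fun s hs hs' => ⟨hsg s ⟨hs, hs'⟩, (h s (hsε (hm s hs hs'))).1.1⟩⟩
      · refine ⟨r', by positivity, min_le_right _ _, fun z => b z + (2 * Real.pi : ℝ),
          (hbd.mono hss).add_const _, fun z hz => hshs z (hss hz), fun z _ => hshift z,
          Or.inl fun s hs hs' => ?_⟩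
        have h1 := hsg s ⟨hs, hs'⟩
        have h2 := (h s (hsε (hm s hs hs'))).1.2
        simp only [Complex.add_re, Complex.ofReal_re]
        constructor <;> linarith
end

section
open ComplexConjugate

theorem preconn_frontier {α : Type*} [TopologicalSpace α] {s t : Set α} (hs : IsPreconnected s)
    (h1 : (s ∩ t).Nonempty) (h2 : (s ∩ tᶜ).Nonempty) : (s ∩ frontier t).Nonempty := by
  by_contra hcon
  rw [not_nonempty_iff_eq_empty] at hcon
  have hn : ∀ x ∈ s, x ∉ frontier t := fun x hx hf => by
    have : x ∈ s ∩ frontier t := ⟨hx, hf⟩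
    rw [hcon] at this; exact this
  have hin : ∀ x ∈ s, x ∈ t → x ∈ interior t := by
    intro x hx ht
    by_contra h
    exact hn x hx ⟨subset_closure ht, h⟩
  have hout : ∀ x ∈ s, x ∉ t → x ∈ (closure t)ᶜ := by
    intro x hx ht h
    exact hn x hx ⟨h, fun h' => ht (interior_subset h')⟩
  obtain ⟨x, hx, hxs⟩ := h1
  obtain ⟨y, hy, hys⟩ := h2
  obtain ⟨z, hz, hz1, hz2⟩ := hs _ _ isOpen_interior isClosed_closure.isOpen_compl
    (fun x hx => by
      by_cases h : x ∈ t
      · exact Or.inl (hin x hx h)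
      · exact Or.inr (hout x hx h)) ⟨x, hx, hin x hx hxs⟩ ⟨y, hy, hout y hy hys⟩
  exact hz2 (subset_closure (interior_subset hz1))

/-- height of the region above abscissa `x` in the logarithmic chart -/
noncomputable def hh (d : ℂ → ℂ) (x : ℝ) : ℝ := (d ((Real.exp x : ℝ) : ℂ)).re

/-- the region in the logarithmic chart -/
def Om (d : ℂ → ℂ) (L : ℝ) : Set ℂ :=
  {u | u.re < L ∧ ∃ t ∈ Ioo (0 : ℝ) 1, u.im = t * hh d u.re}

/-- basic properties of the height function -/
structure DData (d : ℂ → ℂ) (r L : ℝ) : Prop where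
  rpos : 0 < r
  L_le : Real.exp L ≤ r
  diff : DifferentiableOn ℂ d (ball 0 r)
  symm : ∀ z ∈ ball (0 : ℂ) r, d (conj z) = conj (d z)
  ne : ∀ x < L, hh d x ≠ 0
  le : ∀ x < L, |hh d x| ≤ 2 * Real.pi

namespace DData
variable {d : ℂ → ℂ} {r L : ℝ}

theorem exp_mem (H : DData d r L) {x : ℝ} (hx : x < L) : ((Real.exp x : ℝ) : ℂ) ∈ ball (0 : ℂ) r := by
  rw [mem_ball_zero_iff, Complex.norm_real, Real.norm_eq_abs, abs_of_pos (Real.exp_pos _)]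
  exact (Real.exp_lt_exp.2 hx).trans_le H.L_le

theorem cexp_mem (H : DData d r L) {u : ℂ} (hx : u.re < L) : Complex.exp u ∈ ball (0 : ℂ) r := by
  rw [mem_ball_zero_iff, Complex.norm_exp]
  exact (Real.exp_lt_exp.2 hx).trans_le H.L_le

theorem mono (H : DData d r L) {L' : ℝ} (h : L' ≤ L) : DData d r L' :=
  ⟨H.rpos, (Real.exp_le_exp.2 h).trans H.L_le, H.diff, H.symm, fun x hx => H.ne x (hx.trans_le h),
    fun x hx => H.le x (hx.trans_le h)⟩

theorem real (H : DData d r L) {x : ℝ} (hx : x < L) :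
    d ((Real.exp x : ℝ) : ℂ) = (hh d x : ℂ) := by
  have := H.exp_mem hx
  exact real_of_symm H.symm (by simpa using this)

theorem cont (H : DData d r L) : ContinuousOn (hh d) (Iio L) :=
  Complex.continuous_re.comp_continuousOn (H.diff.continuousOn.comp
    (Complex.continuous_ofReal.comp Real.continuous_exp).continuousOn (fun _ hx => H.exp_mem hx))

theorem mem_Om (H : DData d r L) {u : ℂ} :
    u ∈ Om d L ↔ u.re < L ∧ u.im / hh d u.re ∈ Ioo (0 : ℝ) 1 := by
  constructor
  · rintro ⟨h, t, ht, e⟩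
    refine ⟨h, ?_⟩
    rw [e, mul_div_cancel_right₀ _ (H.ne _ h)]
    exact ht
  · rintro ⟨h, ht⟩
    exact ⟨h, _, ht, by rw [div_mul_cancel₀ _ (H.ne _ h)]⟩

theorem isOpen (H : DData d r L) : IsOpen (Om d L) := by
  have hU : IsOpen {u : ℂ | u.re < L} := isOpen_lt Complex.continuous_re continuous_const
  have hc : ContinuousOn (fun u : ℂ => u.im / hh d u.re) {u : ℂ | u.re < L} := by
    refine Complex.continuous_im.continuousOn.div ?_ (fun u hu => H.ne _ hu)
    exact H.cont.comp Complex.continuous_re.continuousOn (fun u hu => hu)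
  have := hc.isOpen_inter_preimage hU (isOpen_Ioo (a := (0 : ℝ)) (b := 1))
  convert this using 1
  ext u
  rw [H.mem_Om]; rfl

theorem ordConn (H : DData d r L) (x : ℝ) :
    OrdConnected {y : ℝ | (x + y * Complex.I : ℂ) ∈ Om d L} := by
  refine ⟨fun a ha b hb y hy => ?_⟩
  simp only [mem_ofPred_eq, H.mem_Om] at *
  simp at *
  refine ⟨ha.1, ?_, ?_⟩
  · rcases lt_or_gt_of_ne (H.ne _ ha.1) with h | h
    · exact hb.2.1.trans_le (div_le_div_of_nonpos_of_le h.le hy.2)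
    · exact ha.2.1.trans_le (div_le_div_of_nonneg_right hy.1 h.le)
  · rcases lt_or_gt_of_ne (H.ne _ ha.1) with h | h
    · exact (div_le_div_of_nonpos_of_le h.le hy.1).trans_lt ha.2.2
    · exact (div_le_div_of_nonneg_right hy.2 h.le).trans_lt hb.2.2

theorem im_le (H : DData d r L) {u : ℂ} (hu : u ∈ Om d L) : |u.im| ≤ 2 * Real.pi := by
  obtain ⟨h, t, ht, e⟩ := hu
  rw [e, abs_mul, abs_of_pos ht.1]
  have := H.le _ h
  nlinarith [ht.2, abs_nonneg (hh d u.re)]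

theorem preconn (H : DData d r L) : IsPreconnected (Om d L) := by
  have h1 : IsPreconnected (Iio L ×ˢ Ioo (0 : ℝ) 1) :=
    isPreconnected_Iio.prod isPreconnected_Ioo
  have h2 : ContinuousOn (fun p : ℝ × ℝ => (p.1 + (p.2 * hh d p.1 : ℝ) * Complex.I : ℂ))
      (Iio L ×ˢ Ioo (0 : ℝ) 1) := by
    refine (Complex.continuous_ofReal.comp continuous_fst).continuousOn.add (ContinuousOn.mul ?_
      continuousOn_const)
    refine Complex.continuous_ofReal.comp_continuousOn ?_
    exact continuous_snd.continuousOn.mul (H.cont.comp continuous_fst.continuousOn (fun p hp => hp.1))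
  convert h1.image _ h2 using 1
  ext u
  constructor
  · rintro ⟨h, t, ht, e⟩
    refine ⟨(u.re, t), ⟨h, ht⟩, ?_⟩
    apply Complex.ext <;> simp [e]
  · rintro ⟨⟨x, t⟩, ⟨h, ht⟩, rfl⟩
    exact ⟨by simpa using h, t, ht, by simp⟩

end DData

/-- half disc -/
def HD (r : ℝ) : Set ℂ := {z | 0 < z.im ∧ ‖z‖ < r}

theorem HD_isOpen (r : ℝ) : IsOpen (HD r) :=
  (isOpen_lt continuous_const Complex.continuous_im).inter (isOpen_lt continuous_norm continuous_const)

theorem HD_convex (r : ℝ) : Convex ℝ (HD r) := by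
  have : HD r = {z | 0 < z.im} ∩ ball 0 r := by ext; simp [HD]
  rw [this]
  exact (convex_halfSpace_im_gt 0).inter (convex_ball _ _)

/-- local coordinates for the Riemann map near the corner -/
structure Iface (D : Set ℂ) (Φ φ : ℂ → ℂ) (d : ℂ → ℂ) (r L r₁ : ℝ) (ℓ : ℂ → ℂ) : Prop where
  dd : DData d r L
  r_le : r ≤ 1
  φd : DifferentiableOn ℂ φ (ball 0 1)
  r₁pos : 0 < r₁
  ld : DifferentiableOn ℂ ℓ (HD r₁)
  lm : ∀ z ∈ HD r₁, ℓ z ∈ Om d L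
  lg : ∀ z ∈ HD r₁, φ (Complex.exp (ℓ z)) = Φ z
  gi : InjOn (fun u => φ (Complex.exp u)) (Om d L)
  gD : ∀ u ∈ Om d L, φ (Complex.exp u) ∈ D
  gn : ∀ u : ℂ, u.re < L → (u.im = 0 ∨ u.im = hh d u.re) → φ (Complex.exp u) ∉ D
  lt : ∀ X : ℝ, ∃ ε > 0, ∀ z ∈ HD ε, z ∈ HD r₁ ∧ (ℓ z).re < X

theorem cexp_polar (u : ℂ) : Complex.exp u = (‖Complex.exp u‖ : ℂ) * Complex.exp (Complex.I * u.im) := by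
  rw [Complex.norm_exp]
  push_cast
  rw [← Complex.exp_add, mul_comm Complex.I, Complex.re_add_im]

theorem exp_I_eq {x y : ℝ} (h : Complex.exp (Complex.I * x) = Complex.exp (Complex.I * y))
    (hxy : |x - y| < 2 * Real.pi) : x = y := by
  rw [Complex.exp_eq_exp_iff_exists_int] at h
  obtain ⟨n, hn⟩ := h
  have h1 : x = y + n * (2 * Real.pi) := by
    have : Complex.I * (x : ℂ) = Complex.I * ((y + n * (2 * Real.pi) : ℝ) : ℂ) := by
      rw [hn]; push_cast; ring
    exact_mod_cast mul_left_cancel₀ Complex.I_ne_zero this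
  have hpi := Real.pi_pos
  have h2 : |(n : ℝ)| < 1 := by
    rw [h1] at hxy
    rw [show y + n * (2 * Real.pi) - y = n * (2 * Real.pi) by ring, abs_mul,
      abs_of_pos (show 0 < 2 * Real.pi by positivity)] at hxy
    nlinarith
  have h3 : n = 0 := by
    rw [← Int.cast_abs] at h2
    have : |n| < 1 := by exact_mod_cast h2
    exact Int.abs_lt_one_iff.1 this
  rw [h1, h3]; simp

/-- final assembly of the interface from a compatible choice of `d` and `ℓ` -/
theorem iface_mk {D : Set ℂ} (hD : IsOpen D) {Φ φ : ℂ → ℂ} {r r₁ : ℝ} (hr : 0 < r) (hr1 : r ≤ 1)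
    (φd : DifferentiableOn ℂ φ (ball 0 1)) (φi : InjOn φ (ball 0 1))
    {a d : ℂ → ℂ} (dd : DData d r (Real.log r))
    (hda : ∀ z ∈ ball (0 : ℂ) r, Complex.exp (Complex.I * d z) = Complex.exp (Complex.I * a z))
    (hB : ∀ z ∈ ball (0 : ℂ) r, z ≠ 0 → (φ z ∈ frontier D ↔
        (z = (‖z‖ : ℂ) ∨ z = (‖z‖ : ℂ) * Complex.exp (Complex.I * a (‖z‖ : ℂ)))))
    (hr₁ : 0 < r₁) {ℓ : ℂ → ℂ} (ld : DifferentiableOn ℂ ℓ (HD r₁))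
    (lm : ∀ z ∈ HD r₁, ℓ z ∈ Om d (Real.log r))
    (lg : ∀ z ∈ HD r₁, φ (Complex.exp (ℓ z)) = Φ z) (hΦ : ∀ z ∈ HD r₁, Φ z ∈ D)
    (lt : ∀ X : ℝ, ∃ ε > 0, ∀ z ∈ HD ε, z ∈ HD r₁ ∧ (ℓ z).re < X) :
    Iface D Φ φ d r (Real.log r) r₁ ℓ := by
  have hball : ball (0 : ℂ) r ⊆ ball 0 1 := ball_subset_ball hr1
  have hfr : ∀ u : ℂ, u.re < Real.log r → (φ (Complex.exp u) ∈ frontier D ↔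
      (Complex.exp (Complex.I * u.im) = 1 ∨
        Complex.exp (Complex.I * u.im) = Complex.exp (Complex.I * hh d u.re))) := by
    intro u hu
    rw [hB _ (dd.cexp_mem hu) (Complex.exp_ne_zero _)]
    have hne : (‖Complex.exp u‖ : ℂ) ≠ 0 := by
      simp
    have e1 := cexp_polar u
    have e2 : Complex.exp (Complex.I * a (‖Complex.exp u‖ : ℂ)) =
        Complex.exp (Complex.I * hh d u.re) := by
      rw [Complex.norm_exp, ← hda _ (dd.exp_mem hu), dd.real hu]
    rw [e2]
    have e3 : ∀ w : ℂ, Complex.exp u = (‖Complex.exp u‖ : ℂ) * w ↔ Complex.exp (Complex.I * u.im) = w := by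
      intro w
      constructor
      · intro h
        rw [e1] at h
        have : (‖Complex.exp u‖ : ℂ) * Complex.exp (Complex.I * u.im) = (‖Complex.exp u‖ : ℂ) * w := by
          rw [← e1]; rw [← e1] at h; exact h
        exact mul_left_cancel₀ hne this
      · intro h
        rw [← h]; exact e1
    rw [← e3 1, mul_one, e3]
  have habs : ∀ u ∈ Om d (Real.log r), u.im ≠ 0 ∧ |u.im| < 2 * Real.pi ∧ u.im ≠ hh d u.re ∧
      |u.im - hh d u.re| < 2 * Real.pi := by
    rintro u ⟨h, t, ht, e⟩
    have h1 := dd.ne _ h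
    have h2 := dd.le _ h
    have h3 := abs_pos.2 h1
    have e2 : t * hh d u.re - hh d u.re = (t - 1) * hh d u.re := by ring
    rw [e]
    refine ⟨mul_ne_zero ht.1.ne' h1, ?_, ?_, ?_⟩
    · rw [abs_mul, abs_of_pos ht.1]; nlinarith [ht.2]
    · rw [← sub_ne_zero, e2]
      exact mul_ne_zero (by linarith [ht.2]) h1
    · rw [e2, abs_mul, abs_of_neg (by linarith [ht.2])]; nlinarith [ht.1]
  have hgfr : ∀ u ∈ Om d (Real.log r), φ (Complex.exp u) ∉ frontier D := by
    intro u hu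
    obtain ⟨h1, h2, h3, h4⟩ := habs u hu
    rw [hfr u hu.1]
    rintro (h | h)
    · exact h1 (exp_I_eq (y := 0) (by simpa using h) (by simpa using h2))
    · exact h3 (exp_I_eq h h4)
  refine ⟨dd, hr1, φd, hr₁, ld, lm, lg, ?_, ?_, ?_, lt⟩
  · intro u hu v hv huv
    have e := φi (hball (dd.cexp_mem hu.1)) (hball (dd.cexp_mem hv.1)) huv
    have hre : u.re = v.re := by
      have := congrArg norm e
      rw [Complex.norm_exp, Complex.norm_exp] at this
      exact Real.exp_injective this
    have him : u.im = v.im := by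
      apply exp_I_eq
      · have e1 := cexp_polar u
        rw [e] at e1
        have e2 := cexp_polar v
        rw [e1] at e2
        have hne : (‖Complex.exp v‖ : ℂ) ≠ 0 := by simp
        have e3 : (‖Complex.exp v‖ : ℂ) * Complex.exp (Complex.I * u.im) =
          (‖Complex.exp v‖ : ℂ) * Complex.exp (Complex.I * v.im) := by
          rw [← cexp_polar v]; exact e1.symm
        exact mul_left_cancel₀ hne e3
      · obtain ⟨h, t, ht, e⟩ := hu
        obtain ⟨h', t', ht', e'⟩ := hv
        rw [e, e', ← hre, ← sub_mul, abs_mul]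
        have h2 := dd.le _ h
        have h3 := abs_pos.2 (dd.ne _ h)
        have : |t - t'| < 1 := by
          rw [abs_lt]; constructor <;> linarith [ht.1, ht.2, ht'.1, ht'.2]
        nlinarith [abs_nonneg (t - t')]
    exact Complex.ext hre him
  · intro u hu
    by_contra hcon
    have hpre : IsPreconnected ((fun u => φ (Complex.exp u)) '' Om d (Real.log r)) := by
      apply dd.preconn.image
      exact φd.continuousOn.comp Complex.continuous_exp.continuousOn
        (fun v hv => hball (dd.cexp_mem hv.1))
    have hz : ((r₁ / 2 : ℝ) : ℂ) * Complex.I ∈ HD r₁ := by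
      constructor
      · simp [hr₁]
      · simp [abs_of_pos hr₁]; linarith
    obtain ⟨y, ⟨v, hv, rfl⟩, hy⟩ := preconn_frontier hpre (t := D)
      ⟨_, ⟨_, lm _ hz, lg _ hz⟩, hΦ _ hz⟩ ⟨_, ⟨u, hu, rfl⟩, hcon⟩
    exact hgfr v hv hy
  · intro u hu h
    have : φ (Complex.exp u) ∈ frontier D := by
      rw [hfr u hu]
      rcases h with h | h
      · left; simp [h]
      · right; rw [h]
    exact fun h' => (hD.frontier_eq ▸ this).2 h'
end

section
open ComplexConjugate

theorem iface_exists {D : Set ℂ} (hD : IsOpen D) (h0 : (0 : ℂ) ∈ frontier D) {Φ φ₁ φ₂ : ℂ → ℂ}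
    {ρ : ℝ} (hρ : 0 < ρ)
    (h1d : DifferentiableOn ℂ φ₁ (ball 0 1)) (h1i : InjOn φ₁ (ball 0 1)) (h10 : φ₁ 0 = 0)
    (h2d : DifferentiableOn ℂ φ₂ (ball 0 1)) (h2i : InjOn φ₂ (ball 0 1)) (h20 : φ₂ 0 = 0)
    (h2n : deriv φ₂ 0 ≠ 0)
    (hB : frontier D ∩ ball (0 : ℂ) ρ =
    (φ₁ '' (Complex.ofReal '' Ico (0 : ℝ) 1) ∪ φ₂ '' (Complex.ofReal '' Ico (0 : ℝ) 1)) ∩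
      ball (0 : ℂ) ρ)
    (hΦd : DifferentiableOn ℂ Φ {z | 0 < z.im})
    (hΦm : MapsTo Φ {z | 0 < z.im} D)
    (hΦ0 : Tendsto Φ (𝓝[{z | 0 < z.im}] 0) (𝓝 0)) :
    ∃ φ d r L r₁ ℓ, Iface D Φ φ d r L r₁ ℓ := by
  obtain ⟨r0, hr0, hr01, a0, ha0, ha0s, hpol⟩ := polar_raw hρ h1d h1i h10 h2d h2i h20 h2n hB
  obtain ⟨r, hr, hrr0, a, had, has, hexp, hcase⟩ := polar_norm hr0 ha0 ha0s
  have hr1 : r ≤ 1 := hrr0.trans hr01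
  have hpi := Real.pi_pos
  have hball : ball (0 : ℂ) r ⊆ ball 0 1 := ball_subset_ball hr1
  have hpol' : ∀ z ∈ ball (0 : ℂ) r, z ≠ 0 → (φ₁ z ∈ frontier D ↔
        (z = (‖z‖ : ℂ) ∨ z = (‖z‖ : ℂ) * Complex.exp (Complex.I * a (‖z‖ : ℂ)))) := by
    intro z hz hz0
    rw [hpol z (ball_subset_ball hrr0 hz) hz0, hexp]
    simpa using hz
  have hnf : ∀ w ∈ D, w ∉ frontier D := fun w hw h => (hD.frontier_eq ▸ h).2 hw
  set χ := Function.invFunOn φ₁ (ball 0 1) with hχ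
  have hχl : ∀ z ∈ ball (0 : ℂ) 1, χ (φ₁ z) = z := fun z hz => h1i.leftInvOn_invFunOn hz
  have hχd := inj_inv_differentiable isOpen_ball h1d h1i hχl
  have hO1 := inj_isOpen_image isOpen_ball h1d h1i isOpen_ball le_rfl
  have hOr := inj_isOpen_image isOpen_ball h1d h1i (isOpen_ball (x := (0:ℂ)) (ε := r)) hball
  have m1 : (0 : ℂ) ∈ ball (0 : ℂ) 1 := mem_ball_self one_pos
  have hχ0 : χ 0 = 0 := by simpa [h10] using hχl 0 m1
  have hχc : ContinuousAt χ 0 :=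
    (hχd.differentiableAt (hO1.mem_nhds ⟨0, m1, h10⟩)).continuousAt
  have hHDnhds : ∀ s ∈ 𝓝[{z : ℂ | 0 < z.im}] (0:ℂ), ∃ ε > 0, HD ε ⊆ s := by
    intro s hs
    obtain ⟨ε, hε, h⟩ := Metric.mem_nhdsWithin_iff.1 hs
    exact ⟨ε, hε, fun z hz => h ⟨by simpa using hz.2, hz.1⟩⟩
  obtain ⟨r₁, hr₁, hsub⟩ := hHDnhds _ (hΦ0 (hOr.mem_nhds ⟨0, mem_ball_self hr, h10⟩))
  set P : ℂ → ℂ := fun z => χ (Φ z) with hP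
  have hPm : ∀ z ∈ HD r₁, P z ∈ ball (0 : ℂ) r ∧ φ₁ (P z) = Φ z := by
    intro z hz
    obtain ⟨p, hp, e⟩ := hsub hz
    have : P z = p := by rw [hP]; simp only; rw [← e, hχl p (hball hp)]
    rw [this]; exact ⟨hp, e⟩
  have hPd : DifferentiableOn ℂ P (HD r₁) := by
    refine hχd.comp (hΦd.mono (fun z hz => hz.1)) (fun z hz => ?_)
    exact ⟨P z, hball (hPm z hz).1, (hPm z hz).2⟩
  have hP0 : ∀ z ∈ HD r₁, P z ≠ 0 := by
    intro z hz h
    have e := (hPm z hz).2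
    rw [h, h10] at e
    exact hnf (Φ z) (hΦm hz.1) (e ▸ h0)
  have hPb : ∀ z ∈ HD r₁, P z ≠ (‖P z‖ : ℂ) ∧
      P z ≠ (‖P z‖ : ℂ) * Complex.exp (Complex.I * a (‖P z‖ : ℂ)) := by
    intro z hz
    have h := (hpol' (P z) (hPm z hz).1 (hP0 z hz)).not.1 (by
      rw [(hPm z hz).2]; exact hnf _ (hΦm hz.1))
    push Not at h; exact h
  have hslit : ∀ z ∈ HD r₁, - P z ∈ Complex.slitPlane := by
    intro z hz
    rw [Complex.mem_slitPlane_iff]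
    by_contra hcon
    push Not at hcon
    simp at hcon
    apply (hPb z hz).1
    have : P z = ((P z).re : ℂ) := Complex.ext (by simp) (by simp [hcon.2])
    rw [this, Complex.norm_real, Real.norm_of_nonneg hcon.1]
  set u : ℂ → ℂ := fun z => Complex.log (- P z) + Real.pi * Complex.I with hu
  have hud : DifferentiableOn ℂ u (HD r₁) :=
    (hPd.neg.clog hslit).add_const _
  have huim : ∀ z ∈ HD r₁, 0 < (u z).im ∧ (u z).im < 2 * Real.pi := by
    intro z hz
    have h1 := Complex.neg_pi_lt_arg (-P z)
    have h2 := Complex.arg_le_pi (-P z)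
    have h3 : (-P z).arg ≠ Real.pi := (Complex.mem_slitPlane_iff_arg.1 (hslit z hz)).1
    have h4 := lt_of_le_of_ne h2 h3
    have : (u z).im = (-P z).arg + Real.pi := by simp [hu, Complex.log_im]
    rw [this]; constructor <;> linarith
  have hure : ∀ z ∈ HD r₁, (u z).re = Real.log ‖P z‖ := by
    intro z hz
    simp [hu, Complex.log_re]
  have huexp : ∀ z ∈ HD r₁, Complex.exp (u z) = P z := by
    intro z hz
    rw [hu]; simp only
    rw [Complex.exp_add, Complex.exp_log (neg_ne_zero.2 (hP0 z hz)), Complex.exp_pi_mul_I]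
    ring
  have hulog : ∀ z ∈ HD r₁, (u z).re < Real.log r := by
    intro z hz
    rw [hure z hz]
    exact Real.log_lt_log (norm_pos_iff.2 (hP0 z hz)) (by simpa using (hPm z hz).1)
  have hlt : ∀ X : ℝ, ∃ ε > 0, ∀ z ∈ HD ε, z ∈ HD r₁ ∧ (u z).re < X := by
    intro X
    have h1 : Tendsto P (𝓝[{z : ℂ | 0 < z.im}] 0) (𝓝 0) := by
      have := hχc.tendsto.comp hΦ0
      rwa [hχ0] at this
    obtain ⟨ε, hε, h⟩ := hHDnhds _ (h1 (ball_mem_nhds 0 (Real.exp_pos X)))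
    refine ⟨min ε r₁, lt_min hε hr₁, fun z hz => ?_⟩
    have hz1 : z ∈ HD r₁ := ⟨hz.1, hz.2.trans_le (min_le_right _ _)⟩
    refine ⟨hz1, ?_⟩
    have hz2 : z ∈ HD ε := ⟨hz.1, hz.2.trans_le (min_le_left _ _)⟩
    have h3 : ‖P z‖ < Real.exp X := by simpa using h hz2
    rw [hure z hz1]
    rw [Real.log_lt_iff_lt_exp (norm_pos_iff.2 (hP0 z hz1))]
    exact h3
  have hsr : ∀ x < Real.log r, Real.exp x < r := fun x hx => by
    rw [← Real.lt_log_iff_exp_lt hr]; exact hx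
  have hhle : ∀ x < Real.log r, 0 < hh a x ∧ hh a x ≤ 2 * Real.pi := by
    intro x hx
    rcases hcase with h | h
    · have := h _ (Real.exp_pos x) (hsr x hx)
      exact ⟨this.1, this.2.le⟩
    · have := h _ (Real.exp_pos x) (hsr x hx)
      rw [hh, this]; simp [hpi]
  have dd : DData a r (Real.log r) :=
    ⟨hr, (Real.exp_log hr).le, had, has, fun x hx => (hhle x hx).1.ne',
      fun x hx => by rw [abs_of_pos (hhle x hx).1]; exact (hhle x hx).2⟩
  -- first alternative
  have key1 : (∀ z ∈ HD r₁, (u z).im < hh a (u z).re) →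
      ∃ φ d r L r₁ ℓ, Iface D Φ φ d r L r₁ ℓ := by
    intro hlt1
    refine ⟨φ₁, a, r, Real.log r, r₁, u, iface_mk hD hr hr1 h1d h1i dd (fun _ _ => rfl) hpol' hr₁
      hud ?_ ?_ (fun z hz => hΦm hz.1) hlt⟩
    · intro z hz
      rw [dd.mem_Om]
      have h1 := (hhle _ (hulog z hz)).1
      refine ⟨hulog z hz, div_pos (huim z hz).1 h1, ?_⟩
      rw [div_lt_one h1]; exact hlt1 z hz
    · intro z hz; rw [huexp z hz, (hPm z hz).2]
  rcases hcase with hc | hc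
  · have hs := sign_const (HD_convex r₁).isPreconnected (f := fun z => hh a (u z).re - (u z).im)
      (by
        refine ContinuousOn.sub ?_ (Complex.continuous_im.comp_continuousOn hud.continuousOn)
        exact dd.cont.comp (Complex.continuous_re.comp_continuousOn hud.continuousOn)
          (fun z hz => hulog z hz))
      (by
        intro z hz h
        apply (hPb z hz).2
        have e : hh a (u z).re = (u z).im := sub_eq_zero.1 h
        have e2 := cexp_polar (u z)
        rw [huexp z hz, ← e, ← dd.real (hulog z hz), hure z hz,
          Real.exp_log (norm_pos_iff.2 (hP0 z hz))] at e2
        exact e2)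
    rcases hs with h | h
    · exact key1 (fun z hz => sub_pos.1 (h z hz))
    · have hhd : ∀ x, hh (fun z => a z - (2 * Real.pi : ℝ)) x = hh a x - 2 * Real.pi := by
        intro x; simp [hh]
      have hneg : ∀ x < Real.log r, hh a x - 2 * Real.pi < 0 := by
        intro x hx
        have := (hc _ (Real.exp_pos x) (hsr x hx)).2
        rw [hh]; linarith
      have dd2 : DData (fun z => a z - (2 * Real.pi : ℝ)) r (Real.log r) := by
        refine ⟨hr, (Real.exp_log hr).le, had.sub_const _, fun z hz => ?_, fun x hx => ?_, fun x hx => ?_⟩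
        · rw [has z hz, map_sub, Complex.conj_ofReal]
        · rw [hhd]; exact (hneg x hx).ne
        · rw [hhd, abs_of_neg (hneg x hx)]
          linarith [(hhle x hx).1]
      refine ⟨φ₁, _, r, Real.log r, r₁, fun z => u z - (2 * Real.pi : ℝ) * Complex.I,
        iface_mk (a := a) hD hr hr1 h1d h1i dd2 ?_ hpol' hr₁ (hud.sub_const _) ?_ ?_
          (fun z hz => hΦm hz.1) ?_⟩
      · intro z hz
        rw [mul_sub, Complex.exp_sub, show Complex.I * ((2 * Real.pi : ℝ) : ℂ) = 2 * Real.pi * Complex.I by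
          push_cast; ring, Complex.exp_two_pi_mul_I, div_one]
      · intro z hz
        rw [dd2.mem_Om]
        have e1 : (u z - (2 * Real.pi : ℝ) * Complex.I).re = (u z).re := by simp
        have e2 : (u z - (2 * Real.pi : ℝ) * Complex.I).im = (u z).im - 2 * Real.pi := by simp
        rw [e1, e2, hhd]
        have h3 := hneg _ (hulog z hz)
        have h4 := h z hz
        refine ⟨hulog z hz, div_pos_of_neg_of_neg (by linarith [(huim z hz).2]) h3, ?_⟩
        rw [div_lt_one_of_neg h3]; linarith
      · intro z hz
        rw [Complex.exp_sub, show ((2 * Real.pi : ℝ) : ℂ) * Complex.I = 2 * Real.pi * Complex.I by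
          push_cast; ring, Complex.exp_two_pi_mul_I, div_one, huexp z hz, (hPm z hz).2]
      · simpa using hlt
  · apply key1
    intro z hz
    have := hc _ (Real.exp_pos _) (hsr _ (hulog z hz))
    rw [hh, this]
    simpa using (huim z hz).2
end

section
open ComplexConjugate

theorem phi0_notin {D : Set ℂ} (hD : IsOpen D) {φ d : ℂ → ℂ} {L : ℝ}
    (φd : DifferentiableOn ℂ φ (ball 0 1))
    (gn : ∀ u : ℂ, u.re < L → (u.im = 0 ∨ u.im = hh d u.re) → φ (Complex.exp u) ∉ D) :
    φ 0 ∉ D := by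
  intro h
  have hc : ContinuousAt φ 0 :=
    (φd.differentiableAt (ball_mem_nhds 0 one_pos)).continuousAt
  have h1 : ∀ᶠ z in 𝓝 (0 : ℂ), φ z ∈ D := hc (hD.mem_nhds h)
  have h2 : Tendsto (fun x : ℝ => Complex.exp (x : ℂ)) atBot (𝓝 0) := by
    rw [tendsto_zero_iff_norm_tendsto_zero]
    simpa [Complex.norm_exp] using Real.tendsto_exp_atBot
  obtain ⟨x, hx1, hx2⟩ := ((h2.eventually h1).and (eventually_lt_atBot L)).exists
  exact gn x (by simpa using hx2) (Or.inl (by simp)) hx1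

theorem diam_small {D : Set ℂ} (hD : IsOpen D) {Q : ℂ → ℂ} (hQd : DifferentiableOn ℂ Q (ball 0 1))
    (hQ : BijOn Q (ball 0 1) D) {φ d : ℂ → ℂ} {r L : ℝ} (dd : DData d r L) (hr1 : r ≤ 1)
    (φd : DifferentiableOn ℂ φ (ball 0 1))
    (gi : InjOn (fun u => φ (Complex.exp u)) (Om d L))
    (gD : ∀ u ∈ Om d L, φ (Complex.exp u) ∈ D)
    (gn : ∀ u : ℂ, u.re < L → (u.im = 0 ∨ u.im = hh d u.re) → φ (Complex.exp u) ∉ D)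
    {F : ℂ → ℂ} (hF : ∀ z ∈ ball (0 : ℂ) 1, F (Q z) = z) {δ : ℝ} (hδ : 0 < δ) :
    ∃ x < L, ∀ u ∈ Om d L, ∀ v ∈ Om d L, u.re < x → v.re < x →
      ‖F (φ (Complex.exp u)) - F (φ (Complex.exp v))‖ ≤ δ := by
  have hball : ball (0 : ℂ) r ⊆ ball 0 1 := ball_subset_ball hr1
  have hφ0 := phi0_notin hD φd gn
  set ε := min (δ / 3) (1 / 2) with hε
  have hε0 : 0 < ε := lt_min (by linarith) (by norm_num)
  have hε1 : ε ≤ 1 / 2 := min_le_right _ _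
  have hε2 : ε ≤ δ / 3 := min_le_left _ _
  set g : ℂ → ℂ := fun u => φ (Complex.exp u) with hg
  have hFd : DifferentiableOn ℂ F D := by
    have := inj_inv_differentiable isOpen_ball hQd hQ.injOn hF
    rwa [hQ.image_eq] at this
  have hQF : ∀ y ∈ D, F y ∈ ball (0 : ℂ) 1 ∧ Q (F y) = y := by
    intro y hy
    obtain ⟨z, hz, rfl⟩ := hQ.surjOn hy
    rw [hF z hz]; exact ⟨hz, rfl⟩
  have hgd : DifferentiableOn ℂ g (Om d L) :=
    φd.comp Complex.differentiable_exp.differentiableOn (fun v hv => hball (dd.cexp_mem hv.1))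
  have hfd : DifferentiableOn ℂ (fun u => F (g u)) (Om d L) := hFd.comp hgd gD
  have hfi : InjOn (fun u => F (g u)) (Om d L) := by
    intro u hu v hv h
    apply gi hu hv
    have := congrArg Q h
    simp only at this
    rwa [(hQF _ (gD u hu)).2, (hQF _ (gD v hv)).2] at this
  -- F (g u) near the unit circle
  obtain ⟨X, hXL, hX⟩ : ∃ X ≤ L, ∀ u ∈ Om d L, u.re < X → 1 - ε < ‖F (g u)‖ := by
    have hK : IsCompact (Q '' closedBall 0 (1 - ε)) :=
      (isCompact_closedBall _ _).image_of_continuousOn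
        (hQd.continuousOn.mono (closedBall_subset_ball (by linarith)))
    have hKD : φ 0 ∈ (Q '' closedBall 0 (1 - ε))ᶜ := by
      rintro ⟨z, hz, e⟩
      exact hφ0 (e ▸ hQ.mapsTo (closedBall_subset_ball (by linarith) hz))
    have hc : ContinuousAt φ 0 :=
      (φd.differentiableAt (ball_mem_nhds 0 one_pos)).continuousAt
    obtain ⟨s, hs, hs'⟩ := Metric.mem_nhds_iff.1 (hc (hK.isClosed.isOpen_compl.mem_nhds hKD))
    refine ⟨min L (Real.log s), min_le_left _ _, fun u hu hux => ?_⟩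
    by_contra hcon
    have h1 : Complex.exp u ∈ ball (0 : ℂ) s := by
      rw [mem_ball_zero_iff, Complex.norm_exp, ← Real.lt_log_iff_exp_lt hs]
      exact hux.trans_le (min_le_right _ _)
    apply hs' h1
    exact ⟨F (g u), by simpa using not_lt.1 hcon, (hQF _ (gD u hu)).2⟩
  obtain ⟨x, hxX, hx⟩ := length_area dd.isOpen dd.ordConn (by positivity) (fun u hu => dd.im_le hu)
    hfd hfi (fun u hu => by
      have := (hQF _ (gD u hu)).1
      exact (by simpa using this : ‖F (g u)‖ < 1).le) hε0 X
  have hxL := hxX.trans_le hXL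
  refine ⟨x, hxL, ?_⟩
  set V := g '' (Om d L ∩ {u | u.re < x}) with hV
  have hVo : IsOpen V := inj_isOpen_image dd.isOpen hgd gi
    (dd.isOpen.inter (isOpen_lt Complex.continuous_re continuous_const)) inter_subset_left
  -- frontier of V inside D
  have hfront : ∀ y ∈ D, y ∈ frontier V → ∃ v ∈ Om d L, v.re = x ∧ g v = y := by
    intro y hyD hy
    rw [hVo.frontier_eq] at hy
    set m : ℝ × ℝ → ℂ := fun p => φ (p.1 * Complex.exp (Complex.I * ((p.2 * (d p.1).re : ℝ) : ℂ))) with hm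
    have hKc : IsCompact (Icc 0 (Real.exp x) ×ˢ Icc (0 : ℝ) 1) := isCompact_Icc.prod isCompact_Icc
    have hsr : ∀ s ∈ Icc 0 (Real.exp x), (s : ℂ) ∈ ball (0 : ℂ) r := by
      intro s hs
      rw [mem_ball_zero_iff, Complex.norm_real, Real.norm_of_nonneg hs.1]
      exact hs.2.trans_lt ((Real.exp_lt_exp.2 hxL).trans_le dd.L_le)
    have hmc : ContinuousOn m (Icc 0 (Real.exp x) ×ˢ Icc (0 : ℝ) 1) := by
      refine φd.continuousOn.comp ?_ ?_
      · refine (Complex.continuous_ofReal.comp continuous_fst).continuousOn.mul ?_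
        refine Complex.continuous_exp.comp_continuousOn (continuousOn_const.mul ?_)
        refine Complex.continuous_ofReal.comp_continuousOn (continuous_snd.continuousOn.mul ?_)
        refine Complex.continuous_re.comp_continuousOn (dd.diff.continuousOn.comp
          (Complex.continuous_ofReal.comp continuous_fst).continuousOn (fun p hp => hsr _ hp.1))
      · intro p hp
        apply hball
        have := hsr _ hp.1
        rw [mem_ball_zero_iff] at this ⊢
        rw [norm_mul, mul_comm Complex.I, Complex.norm_exp_ofReal_mul_I, mul_one]
        exact this
    have hcl : IsClosed (m '' (Icc 0 (Real.exp x) ×ˢ Icc (0 : ℝ) 1)) :=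
      (hKc.image_of_continuousOn hmc).isClosed
    have hgm : ∀ u : ℂ, ∀ t : ℝ, u.im = t * hh d u.re → g u = m (Real.exp u.re, t) := by
      intro u t e
      rw [hg, hm]
      simp only
      rw [cexp_polar u, Complex.norm_exp, e]
      rfl
    have hVm : V ⊆ m '' (Icc 0 (Real.exp x) ×ˢ Icc (0 : ℝ) 1) := by
      rintro _ ⟨u, ⟨⟨hu, t, ht, e⟩, hux⟩, rfl⟩
      exact ⟨(Real.exp u.re, t), ⟨⟨(Real.exp_pos _).le, Real.exp_le_exp.2 (le_of_lt hux)⟩,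
        ht.1.le, ht.2.le⟩, (hgm u t e).symm⟩
    obtain ⟨⟨s, t⟩, ⟨hs, ht⟩, e⟩ := hcl.closure_subset_iff.2 hVm hy.1
    simp only at hs ht
    have hs0 : 0 < s := by
      rcases hs.1.lt_or_eq with h | h
      · exact h
      · exfalso
        rw [← h] at e
        apply hφ0
        have : m (0, t) = φ 0 := by simp [hm]
        rw [← this, e]; exact hyD
    set v : ℂ := (Real.log s : ℂ) + ((t * hh d (Real.log s) : ℝ) : ℂ) * Complex.I with hv
    have hvre : v.re = Real.log s := by simp [hv]
    have hvim : v.im = t * hh d v.re := by rw [hvre]; simp [hv]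
    have hlog : Real.log s ≤ x := (Real.log_le_iff_le_exp hs0).2 hs.2
    have hvL : v.re < L := by rw [hvre]; exact hlog.trans_lt hxL
    have hgv : g v = y := by rw [hgm v t hvim, hvre, Real.exp_log hs0, e]
    have ht0 : 0 < t := by
      rcases ht.1.lt_or_eq with h | h
      · exact h
      · exfalso
        exact gn v hvL (Or.inl (by rw [hvim, ← h, zero_mul])) (by rw [← hgv] at hyD; exact hyD)
    have ht1 : t < 1 := by
      rcases ht.2.lt_or_eq with h | h
      · exact h
      · exfalso
        exact gn v hvL (Or.inr (by rw [hvim, h, one_mul])) (by rw [← hgv] at hyD; exact hyD)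
    have hvO : v ∈ Om d L := ⟨hvL, t, ⟨ht0, ht1⟩, hvim⟩
    refine ⟨v, hvO, ?_, hgv⟩
    rw [hvre]
    rcases hlog.lt_or_eq with h | h
    · exact absurd ⟨v, ⟨hvO, by rw [mem_ofPred_eq, hvre]; exact h⟩, hgv⟩ hy.2
    · exact h
  have key : ∀ u ∈ Om d L, u.re < x → ∃ v ∈ Om d L, v.re = x ∧ ‖F (g u) - F (g v)‖ ≤ ε := by
    intro u hu hux
    set q := F (g u) with hq
    have hq1 : ‖q‖ < 1 := by simpa using (hQF _ (gD u hu)).1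
    have htq : ∀ t ∈ Icc (0 : ℝ) 1, (t : ℂ) * q ∈ ball (0 : ℂ) 1 := by
      intro t ht
      rw [mem_ball_zero_iff, norm_mul, Complex.norm_real, Real.norm_of_nonneg ht.1]
      nlinarith [ht.1, ht.2, norm_nonneg q]
    have hp : IsPreconnected ((fun t : ℝ => Q (t * q)) '' Icc (0 : ℝ) 1) := by
      apply isPreconnected_Icc.image
      exact hQd.continuousOn.comp (by fun_prop) htq
    obtain ⟨y, ⟨t, ht, rfl⟩, hy⟩ := preconn_frontier hp (t := V)
      ⟨g u, ⟨1, by simp, by simp only [Complex.ofReal_one, one_mul]; exact (hQF _ (gD u hu)).2⟩, ⟨u, ⟨hu, hux⟩, rfl⟩⟩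
      ⟨Q 0, ⟨0, by simp, by simp⟩, by
        rintro ⟨v, ⟨hv, hvx⟩, e⟩
        have h1 := hX v hv (lt_trans hvx hxX)
        rw [e, hF 0 (mem_ball_self one_pos), norm_zero] at h1
        linarith⟩
    obtain ⟨v, hv, hvx, e⟩ := hfront _ (hQ.mapsTo (htq t ht)) hy
    refine ⟨v, hv, hvx, ?_⟩
    have h1 := hX v hv (hvx ▸ hxX)
    rw [e] at h1 ⊢
    rw [hF _ (htq t ht)] at h1 ⊢
    rw [norm_mul, Complex.norm_real, Real.norm_of_nonneg ht.1] at h1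
    have : q - t * q = ((1 - t : ℝ) : ℂ) * q := by push_cast; ring
    rw [this, norm_mul, Complex.norm_real, Real.norm_of_nonneg (by linarith [ht.2])]
    linarith
  intro u hu v hv hux hvx
  obtain ⟨u', hu', hu'x, h1⟩ := key u hu hux
  obtain ⟨v', hv', hv'x, h2⟩ := key v hv hvx
  have h3 := hx v' hv' u' hu' hv'x hu'x
  have : F (g u) - F (g v) = (F (g u) - F (g u')) + (F (g u') - F (g v')) - (F (g v) - F (g v')) := by ring
  show ‖F (g u) - F (g v)‖ ≤ δ
  rw [this]
  calc _ ≤ ‖(F (g u) - F (g u')) + (F (g u') - F (g v'))‖ + ‖F (g v) - F (g v')‖ := norm_sub_le _ _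
    _ ≤ ‖F (g u) - F (g u')‖ + ‖F (g u') - F (g v')‖ + ‖F (g v) - F (g v')‖ := by
        gcongr; exact norm_add_le _ _
    _ ≤ ε + ε + ε := by gcongr
    _ ≤ δ := by linarith
end

section
open ComplexConjugate

/-- the Cayley transform -/
noncomputable def cay (z : ℂ) : ℂ := (z - Complex.I) / (z + Complex.I)

/-- the inverse Cayley transform -/
noncomputable def cayi (q : ℂ) : ℂ := Complex.I * (1 + q) / (1 - q)

theorem cay_ne {z : ℂ} (hz : 0 ≤ z.im) : z + Complex.I ≠ 0 := by
  intro h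
  have := congrArg Complex.im h
  simp at this; linarith

theorem cay_mem {z : ℂ} (hz : 0 < z.im) : cay z ∈ ball (0 : ℂ) 1 := by
  rw [mem_ball_zero_iff, cay, norm_div, div_lt_one (norm_pos_iff.2 (cay_ne hz.le))]
  rw [← abs_of_nonneg (norm_nonneg (z - Complex.I)), ← abs_of_nonneg (norm_nonneg (z + Complex.I)),
    ← sq_lt_sq, ← Complex.normSq_eq_norm_sq, ← Complex.normSq_eq_norm_sq, Complex.normSq_apply,
    Complex.normSq_apply]
  simp; nlinarith

theorem one_sub_ne {q : ℂ} (hq : q ∈ ball (0 : ℂ) 1) : 1 - q ≠ 0 := by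
  intro h
  rw [sub_eq_zero] at h
  rw [← h] at hq; simp at hq

theorem cayi_mem {q : ℂ} (hq : q ∈ ball (0 : ℂ) 1) : 0 < (cayi q).im := by
  have h1 := one_sub_ne hq
  rw [mem_ball_zero_iff] at hq
  have h2 : 0 < Complex.normSq (1 - q) := Complex.normSq_pos.2 h1
  have h3 : Complex.normSq q < 1 := by
    rw [Complex.normSq_eq_norm_sq]; nlinarith [norm_nonneg q]
  rw [Complex.normSq_apply] at h3
  rw [cayi, Complex.div_im]
  simp
  apply div_lt_div_of_pos_right _ h2
  nlinarith

theorem cayi_cay {z : ℂ} (hz : 0 < z.im) : cayi (cay z) = z := by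
  have h1 := cay_ne hz.le
  have h2 := one_sub_ne (cay_mem hz)
  rw [cayi, div_eq_iff h2, cay]
  field_simp
  ring

theorem cay_cayi {q : ℂ} (hq : q ∈ ball (0 : ℂ) 1) : cay (cayi q) = q := by
  have h1 := one_sub_ne hq
  have h2 := cay_ne (cayi_mem hq).le
  rw [cay, div_eq_iff h2, cayi]
  field_simp
  ring

theorem cayi_diff : DifferentiableOn ℂ cayi (ball 0 1) := by
  intro q hq
  apply DifferentiableAt.differentiableWithinAt
  unfold cayi
  exact DifferentiableAt.div (by fun_prop) (by fun_prop) (one_sub_ne hq)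

theorem cay_cont (x : ℝ) : ContinuousAt cay (x : ℂ) := by
  unfold cay
  exact ContinuousAt.div (by fun_prop) (by fun_prop) (cay_ne (by simp))

section
variable {D : Set ℂ} {Φ φ d : ℂ → ℂ} {r L r₁ : ℝ} {ℓ : ℂ → ℂ}

theorem Iface.re_bdd (I : Iface D Φ φ d r L r₁ ℓ) (hD : IsOpen D)
    (hΦd : DifferentiableOn ℂ Φ {z | 0 < z.im}) (hΦ : BijOn Φ {z | 0 < z.im} D)
    {x₀ : ℝ} (hx₀ : x₀ ≠ 0) :
    ∃ X, ∃ ε > 0, ∀ z ∈ HD r₁, ‖z - x₀‖ < ε → X ≤ (ℓ z).re := by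
  have hQ : BijOn (fun q => Φ (cayi q)) (ball 0 1) D := by
    refine hΦ.comp ⟨fun q hq => cayi_mem hq, fun p hp q hq h => ?_, fun z hz => ⟨cay z, cay_mem hz, cayi_cay hz⟩⟩
    rw [← cay_cayi hp, ← cay_cayi hq, h]
  have hQd : DifferentiableOn ℂ (fun q => Φ (cayi q)) (ball 0 1) :=
    hΦd.comp cayi_diff (fun q hq => cayi_mem hq)
  set F := Function.invFunOn (fun q => Φ (cayi q)) (ball 0 1) with hFdef
  have hF : ∀ z ∈ ball (0 : ℂ) 1, F ((fun q => Φ (cayi q)) z) = z :=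
    fun z hz => hQ.injOn.leftInvOn_invFunOn hz
  have hFΦ : ∀ z ∈ HD r₁, F (φ (Complex.exp (ℓ z))) = cay z := by
    intro z hz
    have := hF _ (cay_mem hz.1)
    simp only at this
    rw [cayi_cay hz.1] at this
    rw [I.lg z hz, this]
  have hne : cay x₀ ≠ cay ((0 : ℝ) : ℂ) := by
    intro h
    unfold cay at h
    rw [div_eq_div_iff (cay_ne (by simp)) (cay_ne (by simp))] at h
    apply hx₀
    have h2 : (2 : ℂ) * Complex.I * x₀ = 0 := by
      push_cast at h
      linear_combination h
    have h3 : (x₀ : ℂ) = 0 := by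
      rcases mul_eq_zero.1 h2 with h | h
      · exact absurd h (by simp)
      · exact h
    exact_mod_cast h3
  set δ := ‖cay x₀ - cay ((0 : ℝ) : ℂ)‖ / 3 with hδ
  have hδ0 : 0 < δ := by
    have := norm_pos_iff.2 (sub_ne_zero.2 hne)
    positivity
  obtain ⟨x, hxL, hx⟩ := diam_small hD hQd hQ I.dd I.r_le I.φd I.gi I.gD I.gn hF hδ0
  obtain ⟨ε₁, hε₁, h1⟩ := Metric.continuousAt_iff.1 (cay_cont x₀) δ hδ0
  obtain ⟨ε₂, hε₂, h2⟩ := Metric.continuousAt_iff.1 (cay_cont 0) δ hδ0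
  obtain ⟨ε₃, hε₃, h3⟩ := I.lt x
  set z' : ℂ := ((min ε₂ ε₃ / 2 : ℝ) : ℂ) * Complex.I with hz'
  have hm : 0 < min ε₂ ε₃ := lt_min hε₂ hε₃
  have hz'n : ‖z'‖ < min ε₂ ε₃ := by
    rw [hz', norm_mul, Complex.norm_I, mul_one, Complex.norm_real, Real.norm_of_nonneg (by positivity)]
    linarith
  have hz'm : z' ∈ HD ε₃ := ⟨by simpa [hz'] using ⟨hε₂, hε₃⟩, hz'n.trans_le (min_le_right _ _)⟩
  have h4 := h2 (x := z') (by
    rw [dist_eq_norm, Complex.ofReal_zero, sub_zero]; exact hz'n.trans_le (min_le_left _ _))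
  refine ⟨x, ε₁, hε₁, fun z hz hzε => ?_⟩
  by_contra hcon
  rw [not_le] at hcon
  have h5 := hx _ (I.lm z hz) _ (I.lm z' (h3 z' hz'm).1) hcon (h3 z' hz'm).2
  rw [hFΦ z hz, hFΦ z' (h3 z' hz'm).1] at h5
  have h6 := h1 (x := z) (by rw [dist_eq_norm]; exact hzε)
  rw [dist_eq_norm] at h4 h6
  have h7 : cay x₀ - cay ((0 : ℝ) : ℂ) = (cay z - cay z') + (cay z' - cay ((0:ℝ):ℂ)) - (cay z - cay x₀) := by
    ring
  have h8 : ‖cay x₀ - cay ((0 : ℝ) : ℂ)‖ < δ + δ + δ := by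
    rw [h7]
    calc _ ≤ ‖(cay z - cay z') + (cay z' - cay ((0:ℝ):ℂ))‖ + ‖cay z - cay x₀‖ := norm_sub_le _ _
      _ ≤ ‖cay z - cay z'‖ + ‖cay z' - cay ((0:ℝ):ℂ)‖ + ‖cay z - cay x₀‖ := by
        gcongr; exact norm_add_le _ _
      _ < δ + δ + δ := by linarith
  rw [hδ] at h8; linarith

/-- relative height of the image point -/
noncomputable def lam (d ℓ : ℂ → ℂ) (z : ℂ) : ℝ := (ℓ z).im / hh d (ℓ z).re

theorem Iface.lam_cont (I : Iface D Φ φ d r L r₁ ℓ) : ContinuousOn (lam d ℓ) (HD r₁) := by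
  unfold lam
  refine ContinuousOn.div (Complex.continuous_im.comp_continuousOn I.ld.continuousOn) ?_
    (fun z hz => I.dd.ne _ (I.lm z hz).1)
  exact I.dd.cont.comp (Complex.continuous_re.comp_continuousOn I.ld.continuousOn)
    (fun z hz => (I.lm z hz).1)

theorem Iface.lam_mem (I : Iface D Φ φ d r L r₁ ℓ) {z : ℂ} (hz : z ∈ HD r₁) : lam d ℓ z ∈ Ioo (0:ℝ) 1 :=
  (I.dd.mem_Om.1 (I.lm z hz)).2

theorem Iface.lam_cluster (I : Iface D Φ φ d r L r₁ ℓ) (hD : IsOpen D)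
    (hΦd : DifferentiableOn ℂ Φ {z | 0 < z.im}) (hΦ : BijOn Φ {z | 0 < z.im} D)
    {x₀ : ℝ} (hx₀ : x₀ ≠ 0) {η : ℝ} (hη : 0 < η) :
    ∃ ε > 0, ∀ z ∈ HD r₁, (ℓ z).re < L - 1 → ‖z - x₀‖ < ε → lam d ℓ z < η ∨ 1 - η < lam d ℓ z := by
  obtain ⟨X, ε₀, hε₀, hX⟩ := I.re_bdd hD hΦd hΦ hx₀
  set Ψ := Function.invFunOn Φ {z | 0 < z.im} with hΨ
  have hΨl : ∀ z ∈ {z : ℂ | 0 < z.im}, Ψ (Φ z) = z := fun z hz => hΦ.injOn.leftInvOn_invFunOn hz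
  have hH : IsOpen {z : ℂ | 0 < z.im} := isOpen_lt continuous_const Complex.continuous_im
  have hΨd : DifferentiableOn ℂ Ψ D := by
    have := inj_inv_differentiable hH hΦd hΦ.injOn hΨl
    rwa [hΦ.image_eq] at this
  set m : ℝ × ℝ → ℂ := fun p => Ψ (φ (Complex.exp (p.1 + (p.2 * hh d p.1 : ℝ) * Complex.I))) with hm
  set K := Icc X (L - 1) ×ˢ Icc η (1 - η) with hK
  have hKO : ∀ p ∈ K, (p.1 + (p.2 * hh d p.1 : ℝ) * Complex.I : ℂ) ∈ Om d L := by
    rintro ⟨x, t⟩ ⟨hx, ht⟩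
    simp only at hx ht
    refine ⟨by simp; linarith [hx.2], t, ⟨by linarith [ht.1], by linarith [ht.2]⟩, by simp⟩
  have hmc : ContinuousOn m K := by
    refine hΨd.continuousOn.comp (I.φd.continuousOn.comp (Complex.continuous_exp.comp_continuousOn
      ?_) ?_) (fun p hp => I.gD _ (hKO p hp))
    · refine (Complex.continuous_ofReal.comp continuous_fst).continuousOn.add (ContinuousOn.mul ?_
        continuousOn_const)
      refine Complex.continuous_ofReal.comp_continuousOn ?_
      exact continuous_snd.continuousOn.mul (I.dd.cont.comp continuous_fst.continuousOn
        (fun p hp => by have := hp.1.2; simp only [mem_Iio]; linarith))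
    · intro p hp
      exact ball_subset_ball I.r_le (I.dd.cexp_mem (hKO p hp).1)
  have hpos : ∀ p ∈ K, 0 < (m p).im := by
    intro p hp
    obtain ⟨z, hz, e⟩ := hΦ.surjOn (I.gD _ (hKO p hp))
    rw [hm]; simp only
    rw [← e, hΨl z hz]; exact hz
  have hKc : IsCompact K := isCompact_Icc.prod isCompact_Icc
  obtain ⟨ε₁, hε₁, hmin⟩ : ∃ ε > 0, ∀ p ∈ K, ε ≤ (m p).im := by
    rcases K.eq_empty_or_nonempty with h | h
    · exact ⟨1, one_pos, by simp [h]⟩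
    · obtain ⟨p, hp, h⟩ := hKc.exists_isMinOn h (Complex.continuous_im.comp_continuousOn hmc)
      exact ⟨_, hpos p hp, fun q hq => h hq⟩
  refine ⟨min ε₀ ε₁, lt_min hε₀ hε₁, fun z hz hzL hzε => ?_⟩
  by_contra hcon
  push Not at hcon
  have hp : ((ℓ z).re, lam d ℓ z) ∈ K :=
    ⟨⟨hX z hz (hzε.trans_le (min_le_left _ _)), hzL.le⟩, hcon⟩
  have h1 := hmin _ hp
  have h2 : m ((ℓ z).re, lam d ℓ z) = z := by
    rw [hm]; simp only
    have : (((ℓ z).re : ℂ) + ((lam d ℓ z * hh d (ℓ z).re : ℝ) : ℂ) * Complex.I) = ℓ z := by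
      rw [lam, div_mul_cancel₀ _ (I.dd.ne _ (I.lm z hz).1), Complex.re_add_im]
    rw [this, I.lg z hz, hΨl z hz.1]
  rw [h2] at h1
  have h3 : z.im ≤ ‖z - x₀‖ := by
    have := Complex.abs_im_le_norm (z - x₀)
    simp at this
    exact (le_abs_self _).trans this
  have := hzε.trans_le (min_le_right ε₀ ε₁)
  linarith

theorem nebot_H (x : ℝ) : (𝓝[{z : ℂ | 0 < z.im}] (x : ℂ)).NeBot := by
  rw [← mem_closure_iff_nhdsWithin_neBot]
  rw [Complex.closure_preimage_im (Ioi 0) |> fun h => (h : closure {z : ℂ | 0 < z.im} = _)]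
  simp

theorem Iface.type_exists (I : Iface D Φ φ d r L r₁ ℓ) (hD : IsOpen D)
    (hΦd : DifferentiableOn ℂ Φ {z | 0 < z.im}) (hΦ : BijOn Φ {z | 0 < z.im} D)
    {r₂ : ℝ} (h2 : ∀ z ∈ HD r₂, z ∈ HD r₁ ∧ (ℓ z).re < L - 1) {J : Set ℝ} (hJ : IsPreconnected J)
    (hJ0 : ∀ x ∈ J, x ≠ 0) (hJr : ∀ x ∈ J, |x| < r₂) :
    ∃ b : ℝ, (b = 0 ∨ b = 1) ∧ ∀ x ∈ J, Tendsto (lam d ℓ) (𝓝[{z | 0 < z.im}] (x : ℂ)) (𝓝 b) := by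
  have hloc : ∀ x ∈ J, ∀ η > 0, ∃ ε > 0, ∀ z : ℂ, 0 < z.im → ‖z - x‖ < ε → z ∈ HD r₁ ∧
      (lam d ℓ z < η ∨ 1 - η < lam d ℓ z) := by
    intro x hx η hη
    obtain ⟨ε, hε, h⟩ := I.lam_cluster hD hΦd hΦ (hJ0 x hx) hη
    refine ⟨min ε (r₂ - |x|), lt_min hε (by linarith [hJr x hx]), fun z hz hzε => ?_⟩
    have hz2 : z ∈ HD r₂ := by
      refine ⟨hz, ?_⟩
      have h1 := hzε.trans_le (min_le_right _ _)
      have h2 : ‖z‖ ≤ ‖z - x‖ + ‖(x:ℂ)‖ := by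
        simpa using norm_add_le (z - x) (x : ℂ)
      rw [Complex.norm_real, Real.norm_eq_abs] at h2
      linarith
    exact ⟨(h2 z hz2).1, h z (h2 z hz2).1 (h2 z hz2).2 (hzε.trans_le (min_le_left _ _))⟩
  set A : Set ℝ := {x | ∃ ε > 0, ∀ z : ℂ, 0 < z.im → ‖z - x‖ < ε → lam d ℓ z < 1 / 3} with hA
  set B : Set ℝ := {x | ∃ ε > 0, ∀ z : ℂ, 0 < z.im → ‖z - x‖ < ε → 1 - 1 / 3 < lam d ℓ z} with hB
  have hopen : ∀ p : ℝ → Prop, IsOpen {x : ℝ | ∃ ε > 0, ∀ z : ℂ, 0 < z.im → ‖z - x‖ < ε → p (lam d ℓ z)} := by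
    intro p
    rw [Metric.isOpen_iff]
    rintro x ⟨ε, hε, h⟩
    refine ⟨ε / 2, by linarith, fun y hy => ⟨ε / 2, by linarith, fun z hz hzy => h z hz ?_⟩⟩
    rw [mem_ball, Real.dist_eq] at hy
    have : z - (x:ℂ) = (z - y) + ((y - x : ℝ) : ℂ) := by push_cast; ring
    rw [this]
    refine (norm_add_le _ _).trans_lt ?_
    rw [Complex.norm_real, Real.norm_eq_abs]; linarith
  have hAo : IsOpen A := hopen (fun y => y < 1 / 3)
  have hBo : IsOpen B := hopen (fun y => 1 - 1 / 3 < y)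
  have hcov : J ⊆ A ∪ B := by
    intro x hx
    obtain ⟨ε, hε, h⟩ := hloc x hx (1 / 3) (by norm_num)
    set N : Set ℂ := {z | 0 < z.im} ∩ ball (x : ℂ) ε with hN
    have hNp : IsPreconnected N := ((convex_halfSpace_im_gt 0).inter (convex_ball _ _)).isPreconnected
    have hNm : ∀ z ∈ N, 0 < z.im ∧ ‖z - x‖ < ε := fun z hz => ⟨hz.1, by
      have := hz.2; rwa [mem_ball, dist_eq_norm] at this⟩
    have hs := sign_const hNp (f := fun z => lam d ℓ z - 1 / 2)
      ((I.lam_cont.mono (fun z hz => (h z (hNm z hz).1 (hNm z hz).2).1)).sub continuousOn_const)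
      (fun z hz hc => by
        rcases (h z (hNm z hz).1 (hNm z hz).2).2 with h | h <;> linarith)
    rcases hs with hs | hs
    · right
      refine ⟨ε, hε, fun z hz hzε => ?_⟩
      have := hs z ⟨hz, by rwa [mem_ball, dist_eq_norm]⟩
      rcases (h z hz hzε).2 with h | h
      · linarith
      · exact h
    · left
      refine ⟨ε, hε, fun z hz hzε => ?_⟩
      have := hs z ⟨hz, by rwa [mem_ball, dist_eq_norm]⟩
      rcases (h z hz hzε).2 with h | h
      · exact h
      · linarith
  have hev : ∀ (x : ℝ) (p : ℂ → Prop), (∃ ε > 0, ∀ z : ℂ, 0 < z.im → ‖z - x‖ < ε → p z) →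
      ∀ᶠ z in 𝓝[{z : ℂ | 0 < z.im}] (x : ℂ), p z := by
    rintro x p ⟨ε, hε, h⟩
    rw [Filter.Eventually, Metric.mem_nhdsWithin_iff]
    exact ⟨ε, hε, fun z hz => h z hz.2 (by have := hz.1; rwa [mem_ball, dist_eq_norm] at this)⟩
  have hdis : ∀ x, x ∈ A → x ∈ B → False := by
    intro x h1 h2
    haveI := nebot_H x
    obtain ⟨z, h3, h4⟩ := ((hev x _ h1).and (hev x _ h2)).exists
    linarith
  have hsplit : J ⊆ A ∨ J ⊆ B := by
    by_contra hcon
    push Not at hcon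
    obtain ⟨⟨x, hx, hxA⟩, ⟨y, hy, hyB⟩⟩ := (And.imp Set.not_subset.1 Set.not_subset.1) hcon
    obtain ⟨z, _, hz1, hz2⟩ := hJ A B hAo hBo hcov ⟨y, hy, (hcov hy).resolve_right hyB⟩
      ⟨x, hx, (hcov hx).resolve_left hxA⟩
    exact hdis z hz1 hz2
  rcases hsplit with hs | hs
  · refine ⟨0, Or.inl rfl, fun x hx => ?_⟩
    rw [Metric.tendsto_nhds]
    intro η hη
    filter_upwards [hev x _ (hloc x hx (min η (1/3)) (lt_min hη (by norm_num))), hev x _ (hs hx)] with z h1 h2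
    have h3 := I.lam_mem h1.1
    rw [Real.dist_eq, sub_zero, abs_of_pos h3.1]
    rcases h1.2 with h | h
    · exact h.trans_le (min_le_left _ _)
    · linarith [min_le_right η (1/3 : ℝ)]
  · refine ⟨1, Or.inr rfl, fun x hx => ?_⟩
    rw [Metric.tendsto_nhds]
    intro η hη
    filter_upwards [hev x _ (hloc x hx (min η (1/3)) (lt_min hη (by norm_num))), hev x _ (hs hx)] with z h1 h2
    have h3 := I.lam_mem h1.1
    rw [Real.dist_eq, abs_sub_comm, abs_of_pos (by linarith [h3.2])]
    rcases h1.2 with h | h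
    · linarith [min_le_right η (1/3 : ℝ)]
    · linarith [min_le_left η (1/3 : ℝ)]

end
end

section
open ComplexConjugate

/-- half strip -/
def SS (R : ℝ) : Set ℂ := {w | w.re < R ∧ 0 < w.im ∧ w.im < Real.pi}

/-- symmetric half strip -/
def S2 (R : ℝ) : Set ℂ := {w | w.re < R ∧ -Real.pi < w.im ∧ w.im < Real.pi}

theorem SS_isOpen (R : ℝ) : IsOpen (SS R) :=
  (isOpen_lt Complex.continuous_re continuous_const).inter
    ((isOpen_lt continuous_const Complex.continuous_im).inter
      (isOpen_lt Complex.continuous_im continuous_const))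

theorem S2_isOpen (R : ℝ) : IsOpen (S2 R) :=
  (isOpen_lt Complex.continuous_re continuous_const).inter
    ((isOpen_lt continuous_const Complex.continuous_im).inter
      (isOpen_lt Complex.continuous_im continuous_const))

theorem glue_reflect {R : ℝ} {U : ℂ → ℂ} (hU : DifferentiableOn ℂ U (SS R))
    (hbd : ∀ x : ℝ, x < R → ∃ M, ∃ ε > 0, ∀ w ∈ SS R, ‖w - x‖ < ε → ‖U w‖ ≤ M)
    (hlim : ∀ x : ℝ, x < R → Tendsto (fun w => (U w).im) (𝓝[{z : ℂ | 0 < z.im}] (x : ℂ)) (𝓝 0)) :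
    ∃ V : ℂ → ℂ, DifferentiableOn ℂ V (S2 R) ∧ EqOn V U (SS R) ∧
      ∀ w ∈ S2 R, V (conj w) = conj (V w) := by
  have hpi := Real.pi_pos
  have hloc : ∀ x : ℝ, ∃ (ρ : ℝ) (V : ℂ → ℂ), x < R → 0 < ρ ∧ ball (x : ℂ) ρ ⊆ S2 R ∧
      DifferentiableOn ℂ V (ball (x : ℂ) ρ) ∧
      EqOn V U (ball (x : ℂ) ρ ∩ {z | 0 < z.im}) ∧ ∀ w ∈ ball (x : ℂ) ρ, V (conj w) = conj (V w) := by
    intro x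
    by_cases hx : x < R
    · obtain ⟨M, ε, hε, hM⟩ := hbd x hx
      set ρ := min ε (min (R - x) Real.pi) with hρ
      have hρ0 : 0 < ρ := lt_min hε (lt_min (by linarith) hpi)
      have hρ1 : ρ ≤ ε := min_le_left _ _
      have hρ2 : ρ ≤ R - x := (min_le_right _ _).trans (min_le_left _ _)
      have hρ3 : ρ ≤ Real.pi := (min_le_right _ _).trans (min_le_right _ _)
      have hsub : ball (x : ℂ) ρ ⊆ S2 R := by
        intro w hw
        rw [mem_ball, dist_eq_norm] at hw
        have h1 := (abs_le.1 (Complex.abs_re_le_norm (w - x))).2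
        have h2 := abs_le.1 (Complex.abs_im_le_norm (w - x))
        simp at h1 h2
        exact ⟨by linarith, by linarith [h2.1], by linarith [h2.2]⟩
      have hsub2 : ball (x : ℂ) ρ ∩ {z | 0 < z.im} ⊆ SS R := fun w hw =>
        ⟨(hsub hw.1).1, hw.2, (hsub hw.1).2.2⟩
      obtain ⟨V, h1, h2, h3⟩ := reflect_local (hU.mono hsub2) (M := M) (fun w hw => hM w (hsub2 hw) (by
        have := hw.1; rw [mem_ball, dist_eq_norm] at this; linarith)) (fun y hy => hlim y (by
          have := (hsub hy).1; simpa using this))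
      exact ⟨ρ, V, fun _ => ⟨hρ0, hsub, h1, h2, h3⟩⟩
    · exact ⟨0, U, fun h => absurd h hx⟩
  choose ρ V hV using hloc
  have hreal : ∀ w : ℂ, w.im = 0 → w = (w.re : ℂ) := fun w hw => Complex.ext (by simp) (by simp [hw])
  set W : ℂ → ℂ := fun w => if 0 < w.im then U w else if w.im < 0 then conj (U (conj w)) else
    V w.re w with hW
  have hWp : ∀ w : ℂ, 0 < w.im → W w = U w := fun w hw => by simp [hW, hw]
  have hWn : ∀ w : ℂ, w.im < 0 → W w = conj (U (conj w)) := fun w hw => by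
    simp only [hW]; rw [if_neg (by linarith), if_pos hw]
  have hWr : ∀ x : ℝ, W x = V x x := fun x => by simp [hW]
  have hWV : ∀ x : ℝ, x < R → ∀ w ∈ ball (x : ℂ) (ρ x), W w = V x w := by
    intro x hx w hw
    obtain ⟨h0, h1, h2, h3, h4⟩ := hV x hx
    rcases lt_trichotomy w.im 0 with h | h | h
    · rw [hWn w h]
      have hw' : conj w ∈ ball (x : ℂ) (ρ x) := by
        rw [mem_ball, dist_eq_norm] at hw ⊢
        rw [← Complex.norm_conj]
        simpa using hw
      rw [← h3 ⟨hw', by simpa using h⟩, h4 w hw, Complex.conj_conj]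
    · rw [hreal w h, hWr]
      have hy : w.re < R := (h1 hw).1
      obtain ⟨h0', h1', h2', h3', h4'⟩ := hV w.re hy
      rw [hreal w h] at hw
      have t1 : Tendsto (V x) (𝓝[{z : ℂ | 0 < z.im}] (w.re : ℂ)) (𝓝 (V x w.re)) :=
        ((h2.differentiableAt (isOpen_ball.mem_nhds hw)).continuousAt).mono_left nhdsWithin_le_nhds
      have t2 : Tendsto (V w.re) (𝓝[{z : ℂ | 0 < z.im}] (w.re : ℂ)) (𝓝 (V w.re w.re)) :=
        ((h2'.differentiableAt (isOpen_ball.mem_nhds (mem_ball_self h0'))).continuousAt).mono_left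
          nhdsWithin_le_nhds
      have := nebot_H w.re
      refine tendsto_nhds_unique t2 (t1.congr' ?_)
      filter_upwards [self_mem_nhdsWithin, mem_nhdsWithin_of_mem_nhds (isOpen_ball.mem_nhds hw),
        mem_nhdsWithin_of_mem_nhds (isOpen_ball.mem_nhds (mem_ball_self h0'))] with z hz hz1 hz2
      rw [h3 ⟨hz1, hz⟩, h3' ⟨hz2, hz⟩]
    · rw [hWp w h, h3 ⟨hw, h⟩]
  refine ⟨W, ?_, fun w hw => hWp w hw.2.1, ?_⟩
  · intro w hw
    apply DifferentiableAt.differentiableWithinAt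
    rcases lt_trichotomy w.im 0 with h | h | h
    · have h1 : conj w ∈ SS R := ⟨by simpa using hw.1, by simpa using h, by
        have := hw.2.1; simp; linarith⟩
      have h2 : DifferentiableAt ℂ (conj ∘ U ∘ conj) w :=
        differentiableAt_conj_conj_iff.2 (hU.differentiableAt ((SS_isOpen R).mem_nhds h1))
      refine h2.congr_of_eventuallyEq ?_
      filter_upwards [(isOpen_lt Complex.continuous_im continuous_const).mem_nhds h] with z hz
      exact hWn z hz
    · have hx : w.re < R := hw.1
      obtain ⟨h0, h1, h2, h3, h4⟩ := hV w.re hx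
      have hwb : w ∈ ball ((w.re : ℝ) : ℂ) (ρ w.re) := by
        rw [← hreal w h]; exact mem_ball_self h0
      refine (h2.differentiableAt (isOpen_ball.mem_nhds hwb)).congr_of_eventuallyEq ?_
      filter_upwards [isOpen_ball.mem_nhds hwb] with z hz
      exact hWV _ hx z hz
    · refine (hU.differentiableAt ((SS_isOpen R).mem_nhds ⟨hw.1, h, hw.2.2⟩)).congr_of_eventuallyEq ?_
      filter_upwards [(isOpen_lt continuous_const Complex.continuous_im).mem_nhds h] with z hz
      exact hWp z hz
  · intro w hw
    rcases lt_trichotomy w.im 0 with h | h | h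
    · rw [hWn w h, hWp _ (by simpa using h), Complex.conj_conj]
    · have hx : w.re < R := hw.1
      obtain ⟨h0, h1, h2, h3, h4⟩ := hV w.re hx
      rw [hreal w h, Complex.conj_ofReal]
      have := h4 _ (mem_ball_self h0)
      rw [Complex.conj_ofReal] at this
      rw [hWr]; exact this
    · rw [hWp w h, hWn _ (by simpa using h), Complex.conj_conj]
end

section
open ComplexConjugate

/-- long half strip -/
def S3 (R : ℝ) : Set ℂ := {w | w.re < R ∧ -Real.pi < w.im ∧ w.im < 2 * Real.pi}

theorem S3_isOpen (R : ℝ) : IsOpen (S3 R) :=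
  (isOpen_lt Complex.continuous_re continuous_const).inter
    ((isOpen_lt continuous_const Complex.continuous_im).inter
      (isOpen_lt Complex.continuous_im continuous_const))

/-- left half plane -/
def LH (R : ℝ) : Set ℂ := {u | u.re < R}

theorem LH_isOpen (R : ℝ) : IsOpen (LH R) := isOpen_lt Complex.continuous_re continuous_const

/-- a boundary straightening pair -/
structure Pair (A B : ℂ → ℂ) (R₁ M : ℝ) : Prop where
  M0 : 0 ≤ M
  Ad : DifferentiableOn ℂ A (LH R₁)
  AM : ∀ u ∈ LH R₁, ‖A u - u‖ ≤ M
  Bd : DifferentiableOn ℂ B (LH R₁)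
  BM : ∀ u ∈ LH R₁, ‖B u - u‖ ≤ M
  BA : ∀ u ∈ LH R₁, B (A u) = u
  AB : ∀ u ∈ LH R₁, A (B u) = u

theorem re_le_of_norm {a u : ℂ} {M : ℝ} (h : ‖a - u‖ ≤ M) : a.re ≤ u.re + M := by
  have := (abs_le.1 (Complex.abs_re_le_norm (a - u))).2
  simp at this; linarith

theorem LH_conj {u : ℂ} {R : ℝ} (h : u ∈ LH R) : conj u ∈ LH R := by simpa [LH] using h

theorem diffOn_conj {f : ℂ → ℂ} {s : Set ℂ} (hs : IsOpen s) (hf : DifferentiableOn ℂ f s) :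
    DifferentiableOn ℂ (fun u => conj (f (conj u))) {u | conj u ∈ s} := by
  intro u hu
  apply DifferentiableAt.differentiableWithinAt
  exact differentiableAt_conj_conj_iff.2 (hf.differentiableAt (hs.mem_nhds hu))

theorem Pair.conj {A B : ℂ → ℂ} {R₁ M : ℝ} (P : Pair A B R₁ M) :
    Pair (fun u => conj (A (conj u))) (fun u => conj (B (conj u))) R₁ M := by
  have hn : ∀ (f : ℂ → ℂ) (u : ℂ), ‖conj (f (conj u)) - u‖ = ‖f (conj u) - conj u‖ := by
    intro f u
    rw [← Complex.norm_conj]; simp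
  refine ⟨P.M0, (diffOn_conj (LH_isOpen _) P.Ad).mono (fun u hu => LH_conj hu), fun u hu => ?_,
    (diffOn_conj (LH_isOpen _) P.Bd).mono (fun u hu => LH_conj hu), fun u hu => ?_, fun u hu => ?_, fun u hu => ?_⟩
  · rw [hn]; exact P.AM _ (LH_conj hu)
  · rw [hn]; exact P.BM _ (LH_conj hu)
  · simp only [Complex.conj_conj]; rw [P.BA _ (LH_conj hu), Complex.conj_conj]
  · simp only [Complex.conj_conj]; rw [P.AB _ (LH_conj hu), Complex.conj_conj]

theorem Pair.id (R₁ M : ℝ) (hM : 0 ≤ M) : Pair (fun u => u) (fun u => u) R₁ M :=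
  ⟨hM, differentiableOn_id, fun u _ => by simpa using hM, differentiableOn_id,
    fun u _ => by simpa using hM, fun _ _ => rfl, fun _ _ => rfl⟩

theorem bottom_ext {A B : ℂ → ℂ} {R R₁ M : ℝ} (P : Pair A B R₁ M) {ℓ : ℂ → ℂ}
    (hℓ : DifferentiableOn ℂ ℓ (SS R)) (hre : ∀ w ∈ SS R, (ℓ w).re < R₁ - M - 1)
    (hbd : ∀ x : ℝ, x < R → ∃ K, ∃ ε > 0, ∀ w ∈ SS R, ‖w - x‖ < ε → ‖ℓ w‖ ≤ K)
    (hlim : ∀ x : ℝ, x < R → Tendsto (fun w => (A (ℓ w)).im) (𝓝[{z : ℂ | 0 < z.im}] (x : ℂ)) (𝓝 0)) :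
    ∃ H : ℂ → ℂ, DifferentiableOn ℂ H (S2 R) ∧ EqOn H ℓ (SS R) ∧
      ∀ w ∈ S2 R, w.im < 0 → H w = B (conj (A (ℓ (conj w)))) := by
  have hM := P.M0
  have hin : ∀ w ∈ SS R, ℓ w ∈ LH R₁ := fun w hw => by
    have := hre w hw; simp only [LH, mem_ofPred_eq]; linarith
  obtain ⟨V, hVd, hVU, hVs⟩ := glue_reflect (R := R) (U := fun w => A (ℓ w))
    (P.Ad.comp hℓ hin) (fun x hx => by
      obtain ⟨K, ε, hε, h⟩ := hbd x hx
      refine ⟨M + K, ε, hε, fun w hw hwε => ?_⟩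
      have h1 := P.AM _ (hin w hw)
      have h2 := h w hw hwε
      have h3 : ‖A (ℓ w)‖ ≤ ‖A (ℓ w) - ℓ w‖ + ‖ℓ w‖ := by
        simpa using norm_add_le (A (ℓ w) - ℓ w) (ℓ w)
      linarith) hlim
  have hp : ∀ w ∈ SS R, (V w).re ≤ R₁ - 1 := by
    intro w hw
    rw [hVU hw]
    have := re_le_of_norm (P.AM _ (hin w hw))
    have := hre w hw
    simp only; linarith
  have hVre : ∀ w ∈ S2 R, V w ∈ LH R₁ := by
    intro w hw
    have : (V w).re ≤ R₁ - 1 := by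
      rcases lt_trichotomy w.im 0 with h | h | h
      · have h1 : conj w ∈ SS R := ⟨by simpa using hw.1, by simpa using h, by
          have := hw.2.1; simp; linarith⟩
        have h2 := hp _ h1
        rw [hVs w hw] at h2
        simpa using h2
      · have hwr : w = ((w.re : ℝ) : ℂ) := Complex.ext (by simp) (by simp [h])
        have t1 : Tendsto (fun z => (V z).re) (𝓝[{z : ℂ | 0 < z.im}] ((w.re : ℝ) : ℂ)) (𝓝 (V w).re) := by
          rw [← hwr]
          exact (Complex.continuous_re.tendsto _).comp
            ((hVd.differentiableAt ((S2_isOpen R).mem_nhds hw)).continuousAt.tendsto.mono_left nhdsWithin_le_nhds)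
        have := nebot_H w.re
        refine le_of_tendsto t1 ?_
        have hm : S2 R ∈ 𝓝 ((w.re : ℝ) : ℂ) := by rw [← hwr]; exact (S2_isOpen R).mem_nhds hw
        filter_upwards [self_mem_nhdsWithin, mem_nhdsWithin_of_mem_nhds hm] with z hz hz2
        exact hp z ⟨hz2.1, hz, hz2.2.2⟩
      · exact hp w ⟨hw.1, h, hw.2.2⟩
    simp only [LH, mem_ofPred_eq]; linarith
  refine ⟨fun w => B (V w), P.Bd.comp hVd hVre, fun w hw => ?_, fun w hw h => ?_⟩
  · simp only; rw [hVU hw]; exact P.BA _ (hin w hw)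
  · have h1 : conj w ∈ SS R := ⟨by simpa using hw.1, by simpa using h, by
      have := hw.2.1; simp; linarith⟩
    have h2 := hVs w hw
    rw [hVU h1] at h2
    simp only at h2 ⊢
    rw [h2, Complex.conj_conj]

theorem full_ext {A B A' B' : ℂ → ℂ} {R R₁ M : ℝ} (P : Pair A B R₁ M) (P' : Pair A' B' R₁ M) {ℓ : ℂ → ℂ}
    (hℓ : DifferentiableOn ℂ ℓ (SS R)) (hre : ∀ w ∈ SS R, (ℓ w).re < R₁ - M - 1)
    (hbd : ∀ x : ℝ, x < R → ∃ K, ∃ ε > 0, ∀ w ∈ SS R, ‖w - x‖ < ε → ‖ℓ w‖ ≤ K)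
    (hbd' : ∀ x : ℝ, x < R → ∃ K, ∃ ε > 0, ∀ w ∈ SS R, ‖w - (x + Real.pi * Complex.I)‖ < ε → ‖ℓ w‖ ≤ K)
    (hlim : ∀ x : ℝ, x < R → Tendsto (fun w => (A (ℓ w)).im) (𝓝[{z : ℂ | 0 < z.im}] (x : ℂ)) (𝓝 0))
    (hlim' : ∀ x : ℝ, x < R → Tendsto (fun w => (A' (ℓ w)).im)
      (𝓝[{z : ℂ | z.im < Real.pi}] (x + Real.pi * Complex.I : ℂ)) (𝓝 0)) :
    ∃ H : ℂ → ℂ, DifferentiableOn ℂ H (S3 R) ∧ EqOn H ℓ (SS R) ∧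
      (∀ w ∈ S3 R, w.im < 0 → H w = B (conj (A (ℓ (conj w))))) ∧
      (∀ w ∈ S3 R, Real.pi < w.im →
        H w = B' (conj (A' (ℓ (conj w + 2 * Real.pi * Complex.I))))) := by
  have hpi := Real.pi_pos
  obtain ⟨H₁, h1d, h1e, h1r⟩ := bottom_ext P hℓ hre hbd hlim
  set σ : ℂ → ℂ := fun w => conj w + Real.pi * Complex.I with hσ
  have σre : ∀ w, (σ w).re = w.re := fun w => by simp [hσ]
  have σim : ∀ w, (σ w).im = Real.pi - w.im := fun w => by simp [hσ]; ring
  have σσ : ∀ w, σ (σ w) = w := fun w => by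
    apply Complex.ext
    · rw [σre, σre]
    · rw [σim, σim]; ring
  have σSS : ∀ w ∈ SS R, σ w ∈ SS R := fun w hw => by
    refine ⟨by rw [σre]; exact hw.1, ?_, ?_⟩ <;> rw [σim] <;> linarith [hw.2.1, hw.2.2]
  have σc : Continuous σ := by
    exact Complex.continuous_conj.add continuous_const
  have σx : ∀ x : ℝ, σ x = x + Real.pi * Complex.I := fun x => by simp [hσ]
  have hdσ : ∀ (f : ℂ → ℂ) (s : Set ℂ), IsOpen s → DifferentiableOn ℂ f s →
      DifferentiableOn ℂ (fun w => conj (f (σ w))) {w | σ w ∈ s} := by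
    intro f s hs hf
    have h1 : DifferentiableOn ℂ (fun w => f (w + Real.pi * Complex.I)) {w | w + Real.pi * Complex.I ∈ s} :=
      hf.comp (differentiableOn_id.add_const _) (fun w hw => hw)
    have h2 : IsOpen {w : ℂ | w + Real.pi * Complex.I ∈ s} := hs.preimage (by fun_prop)
    exact diffOn_conj h2 h1
  obtain ⟨H₂, h2d, h2e, h2r⟩ := bottom_ext (R := R) P'.conj (ℓ := fun w => conj (ℓ (σ w)))
    ((hdσ ℓ _ (SS_isOpen R) hℓ).mono σSS)
    (fun w hw => by simpa using hre _ (σSS w hw))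
    (fun x hx => by
      obtain ⟨K, ε, hε, h⟩ := hbd' x hx
      refine ⟨K, ε, hε, fun w hw hwε => ?_⟩
      rw [Complex.norm_conj]
      apply h _ (σSS w hw)
      rw [← σx x, hσ]
      simp only [add_sub_add_right_eq_sub]
      rw [← map_sub, Complex.norm_conj]; exact hwε)
    (fun x hx => by
      have t1 : Tendsto σ (𝓝[{z : ℂ | 0 < z.im}] (x : ℂ)) (𝓝[{z : ℂ | z.im < Real.pi}] (x + Real.pi * Complex.I : ℂ)) := by
        rw [← σx x]
        refine tendsto_nhdsWithin_iff.2 ⟨(σc.tendsto _).mono_left nhdsWithin_le_nhds, ?_⟩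
        filter_upwards [self_mem_nhdsWithin] with z hz
        rw [σim]; linarith
      have := ((hlim' x hx).comp t1).neg
      simp only [neg_zero] at this
      refine this.congr (fun w => ?_)
      simp)
  set H : ℂ → ℂ := fun w => if w.im < Real.pi then H₁ w else conj (H₂ (σ w)) with hH
  have hHb : ∀ w : ℂ, w.im < Real.pi → H w = H₁ w := fun w hw => by simp [hH, hw]
  have hHt : ∀ w ∈ S3 R, 0 < w.im → H w = conj (H₂ (σ w)) := by
    intro w hw hw0
    by_cases h : w.im < Real.pi
    · have hS : w ∈ SS R := ⟨hw.1, hw0, h⟩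
      rw [hHb w h, h1e hS, h2e (σSS w hS)]
      simp only
      rw [σσ, Complex.conj_conj]
    · simp [hH, h]
  have hS2 : ∀ w ∈ S3 R, 0 < w.im → σ w ∈ S2 R := by
    intro w hw hw0
    refine ⟨by rw [σre]; exact hw.1, ?_, ?_⟩ <;> rw [σim] <;> linarith [hw.2.1, hw.2.2]
  refine ⟨H, ?_, ?_, ?_, ?_⟩
  · intro w hw
    apply DifferentiableAt.differentiableWithinAt
    by_cases h : w.im < Real.pi
    · refine (h1d.differentiableAt ((S2_isOpen R).mem_nhds ⟨hw.1, hw.2.1, h⟩)).congr_of_eventuallyEq ?_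
      filter_upwards [(isOpen_lt Complex.continuous_im continuous_const).mem_nhds h] with z hz
      exact hHb z hz
    · have h0 : 0 < w.im := by linarith
      have := (hdσ H₂ _ (S2_isOpen R) h2d).differentiableAt
        (((S2_isOpen R).preimage σc).mem_nhds (hS2 w hw h0))
      refine this.congr_of_eventuallyEq ?_
      filter_upwards [(isOpen_lt continuous_const Complex.continuous_im).mem_nhds h0,
        (S3_isOpen R).mem_nhds hw] with z hz hz2
      exact hHt z hz2 hz
  · intro w hw
    rw [hHb w hw.2.2, h1e hw]
  · intro w hw h
    rw [hHb w (by linarith)]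
    exact h1r w ⟨hw.1, hw.2.1, by linarith⟩ h
  · intro w hw h
    rw [hHt w hw (by linarith), h2r _ (hS2 w hw (by linarith)) (by rw [σim]; linarith)]
    simp only [Complex.conj_conj]
    have : σ (conj (σ w)) = conj w + 2 * Real.pi * Complex.I := by
      simp [hσ]; ring
    rw [this]
end

section
open ComplexConjugate

theorem lip_of_bdd {f : ℂ → ℂ} {R M : ℝ} (hf : DifferentiableOn ℂ f (LH (R + 1)))
    (hM : ∀ u ∈ LH (R + 1), ‖f u‖ ≤ M) : ∀ u ∈ LH R, ∀ v ∈ LH R, ‖f v - f u‖ ≤ (2 * M) * ‖v - u‖ := by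
  have hconv : Convex ℝ (LH R) := convex_halfSpace_re_lt R
  intro u hu v hv
  have hsub : ∀ z ∈ LH R, closedBall z (1 / 2) ⊆ LH (R + 1) := by
    intro z hz w hw
    rw [mem_closedBall, dist_eq_norm] at hw
    have := re_le_of_norm hw
    simp only [LH, mem_ofPred_eq] at hz ⊢
    linarith
  refine hconv.norm_image_sub_le_of_norm_deriv_le (𝕜 := ℂ) (fun z hz => ?_) (fun z hz => ?_) hu hv
  · exact hf.differentiableAt ((LH_isOpen _).mem_nhds (hsub z hz (mem_closedBall_self (by norm_num))))
  · have := Complex.norm_deriv_le_of_forall_mem_sphere_norm_le (c := z) (R := 1 / 2) (C := M) (f := f) (by norm_num)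
      (by
        apply DifferentiableOn.diffContOnCl
        rw [closure_ball _ (by norm_num)]
        exact hf.mono (hsub z hz))
      (fun w hw => hM w (hsub z hz (sphere_subset_closedBall hw)))
    linarith

/-- the displacement functions of the deck maps -/
structure Disp (d E : ℂ → ℂ) : Prop where
  ex : ∃ (s : ℝ) (j : ℂ → ℂ), (s = 1 ∨ s = -1) ∧ AnalyticAt ℂ j 0 ∧ j 0 = 0 ∧ (d 0 = 0 → deriv j 0 = 1) ∧
    ∀ z, E z = s * 2 * Complex.I * d (j z)

theorem pair_exists {d : ℂ → ℂ} {r L : ℝ} (dd : DData d r L) :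
    ∃ R₁ ≤ L, ∃ M K : ℝ, ∃ A B E E' : ℂ → ℂ, Pair A B R₁ M ∧
      (∀ x : ℝ, x < R₁ → (A (x + (hh d x : ℝ) * Complex.I)).im = 0) ∧ 0 ≤ K ∧
      (∀ u ∈ LH R₁, ∀ v ∈ LH R₁, ‖A v - A u‖ ≤ K * ‖v - u‖) ∧ Disp d E ∧ Disp d E' ∧
      (∀ u ∈ LH R₁, B (conj (A (conj u))) = u + E (Complex.exp u)) ∧
      (∀ u ∈ LH R₁, conj (B (conj (A u))) = u + E' (Complex.exp u)) := by
  set f : ℂ → ℂ := fun z => z * Complex.exp (Complex.I * d z) with hf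
  have hda : AnalyticAt ℂ d 0 := dd.diff.analyticAt (ball_mem_nhds 0 dd.rpos)
  have hfa : AnalyticAt ℂ f 0 := by
    rw [hf]
    exact analyticAt_id.mul (analyticAt_cexp.comp (f := fun z => Complex.I * d z) (analyticAt_const.mul hda))
  have hf0 : f 0 = 0 := by simp [hf]
  have hf' : HasDerivAt f (Complex.exp (Complex.I * d 0)) 0 := by
    have h1 := (hasDerivAt_id (0:ℂ)).mul ((hda.differentiableAt.hasDerivAt.const_mul Complex.I).cexp)
    have e : (1 * Complex.exp (Complex.I * d 0) + id (0:ℂ) * (Complex.exp (Complex.I * d 0) * (Complex.I * deriv d 0))) = Complex.exp (Complex.I * d 0) := by simp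
    rw [← e]; exact h1
  set N := ball (0 : ℂ) r ∩ {z | ‖d z‖ < ‖d 0‖ + 1} with hN
  have hNn : N ∈ 𝓝 (0 : ℂ) := by
    refine inter_mem (ball_mem_nhds 0 dd.rpos) ?_
    exact hda.continuousAt.norm.eventually_lt continuousAt_const (by simp)
  obtain ⟨ε, hε, hεN, hfd, hfi, δ, hδ, J, hJd, hJ, hJf⟩ := local_inverse hfa hf0
    (by rw [hf'.deriv]; exact Complex.exp_ne_zero _) hNn
  set R₂ := min L (min (Real.log ε) (Real.log δ)) with hR₂
  set M := ‖d 0‖ + 1 with hM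
  have hLH : ∀ u ∈ LH R₂, Complex.exp u ∈ ball (0 : ℂ) ε ∧ Complex.exp u ∈ ball (0 : ℂ) δ := by
    intro u hu
    have h1 : u.re < Real.log ε := lt_of_lt_of_le hu ((min_le_right _ _).trans (min_le_left _ _))
    have h2 : u.re < Real.log δ := lt_of_lt_of_le hu ((min_le_right _ _).trans (min_le_right _ _))
    rw [mem_ball_zero_iff, mem_ball_zero_iff, Complex.norm_exp]
    exact ⟨(Real.lt_log_iff_exp_lt hε).1 h1, (Real.lt_log_iff_exp_lt hδ).1 h2⟩
  set A : ℂ → ℂ := fun u => u - Complex.I * d (J (Complex.exp u)) with hA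
  set B : ℂ → ℂ := fun v => v + Complex.I * d (Complex.exp v) with hB
  have hdJd : DifferentiableOn ℂ (fun u => Complex.I * d (J (Complex.exp u))) (LH R₂) := by
    refine DifferentiableOn.const_mul ?_ _
    refine dd.diff.comp (hJd.comp Complex.differentiable_exp.differentiableOn (fun u hu => (hLH u hu).2)) ?_
    exact fun u hu => (hεN (hJ _ (hLH u hu).2).1).1
  have hdJM : ∀ u ∈ LH R₂, ‖Complex.I * d (J (Complex.exp u))‖ ≤ M := by
    intro u hu
    rw [norm_mul, Complex.norm_I, one_mul]
    exact (hεN (hJ _ (hLH u hu).2).1).2.le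
  have hexpA : ∀ u ∈ LH R₂, Complex.exp (A u) = J (Complex.exp u) := by
    intro u hu
    have h1 := (hJ _ (hLH u hu).2).2
    rw [hA]; simp only
    rw [Complex.exp_sub, div_eq_iff (Complex.exp_ne_zero _)]
    exact h1.symm
  have hJ0 : J 0 = 0 := by
    have := hJf 0 (mem_ball_self hε)
    rwa [hf0] at this
  have hJa : AnalyticAt ℂ J 0 := hJd.analyticAt (ball_mem_nhds 0 hδ)
  have hJ1 : d 0 = 0 → deriv J 0 = 1 := by
    intro h0
    have hd1 : HasDerivAt J (deriv J 0) (f 0) := by rw [hf0]; exact hJa.differentiableAt.hasDerivAt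
    have h1 := hd1.comp (0:ℂ) hf'
    have h2 : HasDerivAt (J ∘ f) 1 0 := by
      refine (hasDerivAt_id (0:ℂ)).congr_of_eventuallyEq ?_
      filter_upwards [ball_mem_nhds 0 hε] with z hz
      exact hJf z hz
    have := h1.unique h2
    simpa [h0] using this
  have hBA : ∀ u ∈ LH R₂, B (A u) = u := by
    intro u hu
    rw [hB]; simp only
    rw [hexpA u hu, hA]; ring
  have hAB : ∀ u ∈ LH R₂, A (B u) = u := by
    intro u hu
    have h1 : Complex.exp (B u) = f (Complex.exp u) := by
      rw [hB, hf]; simp only; rw [Complex.exp_add]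
    rw [hA]; simp only
    rw [h1, hJf _ (hLH u hu).1, hB]; ring
  have hP : Pair A B R₂ M := by
    refine ⟨by positivity, differentiableOn_id.sub hdJd, fun u hu => ?_, ?_, fun u hu => ?_, hBA, hAB⟩
    · have : A u - u = -(Complex.I * d (J (Complex.exp u))) := by rw [hA]; ring
      rw [this, norm_neg]; exact hdJM u hu
    · refine differentiableOn_id.add (DifferentiableOn.const_mul ?_ _)
      exact dd.diff.comp Complex.differentiable_exp.differentiableOn (fun u hu => (hεN (hLH u hu).1).1)
    · have : B u - u = Complex.I * d (Complex.exp u) := by rw [hB]; ring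
      rw [this, norm_mul, Complex.norm_I, one_mul]
      exact (hεN (hLH u hu).1).2.le
  have hmono : LH (R₂ - 1) ⊆ LH R₂ := fun u hu => by
    simp only [LH, mem_ofPred_eq] at hu ⊢; linarith
  have hR₂L : R₂ ≤ L := min_le_left _ _
  have hexpc : ∀ u : ℂ, Complex.exp (conj u) = conj (Complex.exp u) := fun u => Complex.exp_conj u
  have hJr : ∀ u ∈ LH R₂, J (Complex.exp u) ∈ ball (0 : ℂ) r := fun u hu => (hεN (hJ _ (hLH u hu).2).1).1
  refine ⟨R₂ - 1, by linarith, M, 1 + 2 * M, A, B,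
    fun z => (1 : ℝ) * 2 * Complex.I * d (conj (J (conj z))),
    fun z => (-1 : ℝ) * 2 * Complex.I * d (J z), ?_, ?_, by positivity, ?_, ?_, ?_, ?_, ?_⟩
  · exact ⟨hP.M0, hP.Ad.mono hmono, fun u hu => hP.AM u (hmono hu), hP.Bd.mono hmono,
      fun u hu => hP.BM u (hmono hu), fun u hu => hP.BA u (hmono hu), fun u hu => hP.AB u (hmono hu)⟩
  · intro x hx
    have hxL : x < L := by linarith
    have h1 : (x + (hh d x : ℝ) * Complex.I : ℂ) = B x := by
      rw [hB]; simp only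
      rw [← Complex.ofReal_exp, dd.real hxL, mul_comm]
    rw [h1, hAB _ (by simp only [LH, mem_ofPred_eq, Complex.ofReal_re]; linarith), Complex.ofReal_im]
  · intro u hu v hv
    have h1 := lip_of_bdd (R := R₂ - 1) (M := M) (f := fun u => Complex.I * d (J (Complex.exp u)))
      (by rw [sub_add_cancel]; exact hdJd) (by rw [sub_add_cancel]; exact hdJM) u hu v hv
    have h2 : A v - A u = (v - u) - (Complex.I * d (J (Complex.exp v)) - Complex.I * d (J (Complex.exp u))) := by
      rw [hA]; ring
    rw [h2]
    refine (norm_sub_le _ _).trans ?_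
    linarith
  · refine ⟨1, fun z => conj (J (conj z)), Or.inl rfl, ?_, by simp [hJ0], fun h0 => ?_, fun z => rfl⟩
    · exact analyticAt_conj_conj (by simpa using hJa)
    · have hd1 : HasDerivAt J 1 0 := by rw [← hJ1 h0]; exact hJa.differentiableAt.hasDerivAt
      have h2 := hd1.conj_conj
      simp only [map_zero, map_one] at h2
      exact h2.deriv
  · exact ⟨-1, J, Or.inr rfl, hJa, hJ0, hJ1, fun z => rfl⟩
  · intro u hu
    have hu' := LH_conj (hmono hu)
    have h1 : Complex.exp (conj (A (conj u))) = conj (J (conj (Complex.exp u))) := by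
      rw [hexpc, hexpA _ hu', hexpc]
    have h2 : B (conj (A (conj u))) = conj (A (conj u)) + Complex.I * d (Complex.exp (conj (A (conj u)))) := rfl
    have h3 : A (conj u) = conj u - Complex.I * d (J (conj (Complex.exp u))) := by
      rw [← hexpc]
    have h4 := dd.symm _ (hJr _ hu')
    rw [hexpc] at h4
    rw [h2, h1, h3, map_sub, Complex.conj_conj, map_mul, Complex.conj_I, ← h4]
    push_cast; ring
  · intro u hu
    have hu' := hmono hu
    have h1 : Complex.exp (conj (A u)) = conj (J (Complex.exp u)) := by
      rw [hexpc, hexpA _ hu']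
    have h2 : B (conj (A u)) = conj (A u) + Complex.I * d (Complex.exp (conj (A u))) := rfl
    have h4 := dd.symm _ (hJr _ hu')
    rw [h2, h1, h4]
    simp only [map_add, map_mul, Complex.conj_conj, Complex.conj_I]
    rw [hA]
    push_cast; ring
end

section
open ComplexConjugate

/-- reflection across a side of type `b` -/
noncomputable def rho (A B : ℂ → ℂ) (b : Bool) (u : ℂ) : ℂ := if b then B (conj (A u)) else conj u

/-- numerical value of a type -/
def bv (b : Bool) : ℝ := if b then 1 else 0

/-- the extended map on the long strip -/
structure StripExt (d A B : ℂ → ℂ) (R R₁ M : ℝ) (b t : Bool) (H : ℂ → ℂ) : Prop where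
  diff : DifferentiableOn ℂ H (S3 R)
  mem : ∀ w ∈ SS R, H w ∈ Om d R₁
  re : ∀ w ∈ SS R, (H w).re < R₁ - M - 1
  lt : ∀ X : ℝ, ∃ R', ∀ w ∈ SS R, w.re < R' → (H w).re < X
  rb : ∀ w ∈ S3 R, w.im < 0 → H w = rho A B b (H (conj w))
  rt : ∀ w ∈ S3 R, Real.pi < w.im → H w = rho A B t (H (conj w + 2 * Real.pi * Complex.I))
  bb : ∀ x : ℝ, x < R → (H x).re ≤ R₁ - M - 1 ∧ (H x).im = bv b * hh d (H x).re
  bt : ∀ x : ℝ, x < R → (H (x + Real.pi * Complex.I)).re ≤ R₁ - M - 1 ∧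
    (H (x + Real.pi * Complex.I)).im = bv t * hh d (H (x + Real.pi * Complex.I)).re

theorem exp_SS {R r₂ : ℝ} (hr : 0 < r₂) (hR : R = Real.log r₂) {w : ℂ} (hw : w ∈ SS R) :
    Complex.exp w ∈ HD r₂ := by
  refine ⟨?_, ?_⟩
  · rw [Complex.exp_im]
    exact mul_pos (Real.exp_pos _) (Real.sin_pos_of_pos_of_lt_pi hw.2.1 hw.2.2)
  · rw [Complex.norm_exp, ← Real.lt_log_iff_exp_lt hr, ← hR]; exact hw.1

theorem bool_of_val {b : ℝ} (h : b = 0 ∨ b = 1) : ∃ c : Bool, b = bv c := by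
  rcases h with h | h
  · exact ⟨false, by simp [bv, h]⟩
  · exact ⟨true, by simp [bv, h]⟩

section
variable {D : Set ℂ} {Φ φ d : ℂ → ℂ} {r L r₁ : ℝ} {ℓ : ℂ → ℂ}

theorem strip_exists (I : Iface D Φ φ d r L r₁ ℓ) (hD : IsOpen D)
    (hΦd : DifferentiableOn ℂ Φ {z | 0 < z.im}) (hΦ : BijOn Φ {z | 0 < z.im} D)
    {R₁ M K : ℝ} {A B : ℂ → ℂ} (hR₁ : R₁ ≤ L) (P : Pair A B R₁ M)
    (hA0 : ∀ x : ℝ, x < R₁ → (A (x + (hh d x : ℝ) * Complex.I)).im = 0) (hK : 0 ≤ K)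
    (hAK : ∀ u ∈ LH R₁, ∀ v ∈ LH R₁, ‖A v - A u‖ ≤ K * ‖v - u‖) :
    ∃ R, ∃ b t : Bool, ∃ H, StripExt d A B R R₁ M b t H ∧
      ∀ w ∈ SS R, φ (Complex.exp (H w)) = Φ (Complex.exp w) := by
  have hpi := Real.pi_pos
  have hM := P.M0
  obtain ⟨r₂, hr₂, h2⟩ := I.lt (min (R₁ - M - 1) (L - 1))
  have h2a : ∀ z ∈ HD r₂, z ∈ HD r₁ ∧ (ℓ z).re < L - 1 := fun z hz =>
    ⟨(h2 z hz).1, (h2 z hz).2.trans_le (min_le_right _ _)⟩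
  have h2b : ∀ z ∈ HD r₂, (ℓ z).re < R₁ - M - 1 := fun z hz => (h2 z hz).2.trans_le (min_le_left _ _)
  obtain ⟨b', hb', htb⟩ := I.type_exists hD hΦd hΦ h2a (J := Ioo 0 r₂) isPreconnected_Ioo
    (fun x hx => hx.1.ne') (fun x hx => by rw [abs_of_pos hx.1]; exact hx.2)
  obtain ⟨t', ht', htt⟩ := I.type_exists hD hΦd hΦ h2a (J := Ioo (-r₂) 0) isPreconnected_Ioo
    (fun x hx => hx.2.ne) (fun x hx => by rw [abs_of_neg hx.2]; linarith [hx.1])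
  obtain ⟨b, rfl⟩ := bool_of_val hb'
  obtain ⟨t, rfl⟩ := bool_of_val ht'
  set R := Real.log r₂ with hR
  have hes : ∀ w ∈ SS R, Complex.exp w ∈ HD r₂ := fun w hw => exp_SS hr₂ hR hw
  set l : ℂ → ℂ := fun w => ℓ (Complex.exp w) with hl
  have hld : DifferentiableOn ℂ l (SS R) :=
    I.ld.comp Complex.differentiable_exp.differentiableOn (fun w hw => (h2a _ (hes w hw)).1)
  have hlre : ∀ w ∈ SS R, (l w).re < R₁ - M - 1 := fun w hw => h2b _ (hes w hw)
  have hlO : ∀ w ∈ SS R, l w ∈ Om d L := fun w hw => I.lm _ (h2a _ (hes w hw)).1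
  have hxe : ∀ x : ℝ, x < R → Real.exp x < r₂ := fun x hx => (Real.lt_log_iff_exp_lt hr₂).1 hx
  have hexp2 : ∀ x : ℝ, Complex.exp (x + Real.pi * Complex.I) = ((-Real.exp x : ℝ) : ℂ) := by
    intro x
    rw [Complex.exp_add, Complex.exp_pi_mul_I]; push_cast; ring
  -- local boundedness
  have hbd0 : ∀ (p : ℂ) (y : ℝ), y ≠ 0 → Complex.exp p = (y : ℂ) →
      ∃ K, ∃ ε > 0, ∀ w ∈ SS R, ‖w - p‖ < ε → ‖l w‖ ≤ K := by
    intro p y hy hp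
    obtain ⟨X, ε, hε, hX⟩ := I.re_bdd hD hΦd hΦ hy
    obtain ⟨ε', hε', h⟩ := Metric.continuousAt_iff.1 (Complex.continuous_exp.continuousAt (x := p)) ε hε
    refine ⟨|X| + |L| + 2 * Real.pi, ε', hε', fun w hw hwε => ?_⟩
    have h3 := h (x := w) (by rw [dist_eq_norm]; exact hwε)
    rw [hp, dist_eq_norm] at h3
    have h4 := hX _ (h2a _ (hes w hw)).1 h3
    have h5 := (hlO w hw).1
    have h6 := I.dd.im_le (hlO w hw)
    have h7 := Complex.norm_le_abs_re_add_abs_im (l w)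
    have h8 : |(l w).re| ≤ |X| + |L| := by
      rw [abs_le]
      constructor
      · have := neg_abs_le X; have := abs_nonneg L; linarith
      · have := le_abs_self L; have := abs_nonneg X; linarith
    linarith
  -- limits of the type function
  have hTb : ∀ x : ℝ, x < R → Tendsto (fun w => lam d ℓ (Complex.exp w)) (𝓝[{z : ℂ | 0 < z.im}] (x : ℂ)) (𝓝 (bv b)) := by
    intro x hx
    have t1 : Tendsto Complex.exp (𝓝[{z : ℂ | 0 < z.im}] (x : ℂ)) (𝓝[{z : ℂ | 0 < z.im}] ((Real.exp x : ℝ) : ℂ)) := by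
      rw [Complex.ofReal_exp]
      refine tendsto_nhdsWithin_iff.2 ⟨(Complex.continuous_exp.tendsto _).mono_left nhdsWithin_le_nhds, ?_⟩
      have hm : {z : ℂ | z.im < Real.pi} ∈ 𝓝 (x : ℂ) :=
        (isOpen_lt Complex.continuous_im continuous_const).mem_nhds (by simpa using hpi)
      filter_upwards [self_mem_nhdsWithin, mem_nhdsWithin_of_mem_nhds hm] with z hz hz2
      rw [Complex.exp_im]
      exact mul_pos (Real.exp_pos _) (Real.sin_pos_of_pos_of_lt_pi hz hz2)
    exact (htb _ ⟨Real.exp_pos x, hxe x hx⟩).comp t1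
  have hTt : ∀ x : ℝ, x < R → Tendsto (fun w => lam d ℓ (Complex.exp w))
      (𝓝[{z : ℂ | z.im < Real.pi}] (x + Real.pi * Complex.I : ℂ)) (𝓝 (bv t)) := by
    intro x hx
    have t1 : Tendsto Complex.exp (𝓝[{z : ℂ | z.im < Real.pi}] (x + Real.pi * Complex.I : ℂ))
        (𝓝[{z : ℂ | 0 < z.im}] ((-Real.exp x : ℝ) : ℂ)) := by
      rw [← hexp2]
      refine tendsto_nhdsWithin_iff.2 ⟨(Complex.continuous_exp.tendsto _).mono_left nhdsWithin_le_nhds, ?_⟩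
      have hm : {z : ℂ | 0 < z.im} ∈ 𝓝 (x + Real.pi * Complex.I : ℂ) :=
        (isOpen_lt continuous_const Complex.continuous_im).mem_nhds (by simpa using hpi)
      filter_upwards [self_mem_nhdsWithin, mem_nhdsWithin_of_mem_nhds hm] with z hz hz2
      rw [Complex.exp_im]
      exact mul_pos (Real.exp_pos _) (Real.sin_pos_of_pos_of_lt_pi hz2 hz)
    exact (htt _ ⟨by linarith [hxe x hx], by linarith [Real.exp_pos x]⟩).comp t1
  -- imaginary parts after straightening
  set AA : Bool → ℂ → ℂ := fun c => if c then A else fun u => u with hAA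
  set BB : Bool → ℂ → ℂ := fun c => if c then B else fun u => u with hBB
  have PP : ∀ c, Pair (AA c) (BB c) R₁ M := by
    intro c
    cases c
    · exact Pair.id R₁ M hM
    · exact P
  have hrho : ∀ c u, BB c (conj (AA c u)) = rho A B c u := by
    intro c u; cases c <;> simp [hAA, hBB, rho]
  have him : ∀ c, ∀ w ∈ SS R, |(AA c (l w)).im| ≤ (1 + K) * (2 * Real.pi) * |lam d ℓ (Complex.exp w) - bv c| := by
    intro c w hw
    have h1 : (l w).im = lam d ℓ (Complex.exp w) * hh d (l w).re := by
      rw [lam, div_mul_cancel₀ _ (I.dd.ne _ (hlO w hw).1)]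
    have h3 := I.dd.le _ (hlO w hw).1
    cases c
    · have e : (AA false (l w)).im = (l w).im := by simp [hAA]
      rw [e, h1, abs_mul]
      simp only [bv, Bool.false_eq_true, if_false, sub_zero]
      have := abs_nonneg (lam d ℓ (Complex.exp w))
      have := mul_le_mul_of_nonneg_left h3 this
      nlinarith [mul_nonneg hK (mul_nonneg hpi.le (abs_nonneg (lam d ℓ (Complex.exp w))))]
    · have e : AA true (l w) = A (l w) := by simp [hAA]
      have hlw : (l w).re < R₁ := by linarith [hlre w hw]
      set v : ℂ := (l w).re + (hh d (l w).re : ℝ) * Complex.I with hv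
      have hvre : v.re = (l w).re := by simp [hv]
      have h4 := hA0 _ hlw
      have h5 := hAK v (by simp only [LH, mem_ofPred_eq]; rw [hvre]; exact hlw) (l w) hlw
      have h6 := Complex.abs_im_le_norm (A (l w) - A v)
      rw [Complex.sub_im, h4, sub_zero] at h6
      have h7 : l w - v = (((lam d ℓ (Complex.exp w) - 1) * hh d (l w).re : ℝ) : ℂ) * Complex.I := by
        apply Complex.ext
        · simp [hv]
        · simp [hv]; rw [h1]; ring
      rw [h7, norm_mul, Complex.norm_I, mul_one, Complex.norm_real, Real.norm_eq_abs, abs_mul] at h5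
      rw [e]
      simp only [bv, if_true]
      have h8 := mul_le_mul_of_nonneg_left h3 (abs_nonneg (lam d ℓ (Complex.exp w) - 1))
      have h9 := mul_le_mul_of_nonneg_left h8 hK
      nlinarith [mul_nonneg hpi.le (abs_nonneg (lam d ℓ (Complex.exp w) - 1))]
  have hlimit : ∀ (c : Bool) (F : Filter ℂ), SS R ∈ F →
      Tendsto (fun w => lam d ℓ (Complex.exp w)) F (𝓝 (bv c)) →
      Tendsto (fun w => (AA c (l w)).im) F (𝓝 0) := by
    intro c F hF hT
    have t1 : Tendsto (fun w => (1 + K) * (2 * Real.pi) * |lam d ℓ (Complex.exp w) - bv c|) F (𝓝 0) := by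
      have := ((hT.sub_const (bv c)).abs).const_mul ((1 + K) * (2 * Real.pi))
      simpa using this
    refine squeeze_zero_norm' ?_ t1
    filter_upwards [hF] with w hw
    exact him c w hw
  have hFb : ∀ x : ℝ, x < R → SS R ∈ 𝓝[{z : ℂ | 0 < z.im}] (x : ℂ) := by
    intro x hx
    have hm : {z : ℂ | z.re < R ∧ z.im < Real.pi} ∈ 𝓝 (x : ℂ) :=
      ((isOpen_lt Complex.continuous_re continuous_const).inter
        (isOpen_lt Complex.continuous_im continuous_const)).mem_nhds ⟨by simpa using hx, by simpa using hpi⟩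
    filter_upwards [self_mem_nhdsWithin, mem_nhdsWithin_of_mem_nhds hm] with z hz hz2
    exact ⟨hz2.1, hz, hz2.2⟩
  have hFt : ∀ x : ℝ, x < R → SS R ∈ 𝓝[{z : ℂ | z.im < Real.pi}] (x + Real.pi * Complex.I : ℂ) := by
    intro x hx
    have hm : {z : ℂ | z.re < R ∧ 0 < z.im} ∈ 𝓝 (x + Real.pi * Complex.I : ℂ) :=
      ((isOpen_lt Complex.continuous_re continuous_const).inter
        (isOpen_lt continuous_const Complex.continuous_im)).mem_nhds ⟨by simpa using hx, by simpa using hpi⟩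
    filter_upwards [self_mem_nhdsWithin, mem_nhdsWithin_of_mem_nhds hm] with z hz hz2
    exact ⟨hz2.1, hz2.2, hz⟩
  obtain ⟨H, hHd, hHe, hHb, hHt⟩ := full_ext (PP b) (PP t) hld hlre
    (fun x hx => hbd0 x (Real.exp x) (Real.exp_pos x).ne' (by rw [Complex.ofReal_exp]))
    (fun x hx => hbd0 _ (-Real.exp x) (by linarith [Real.exp_pos x]) (hexp2 x))
    (fun x hx => hlimit b _ (hFb x hx) (hTb x hx))
    (fun x hx => hlimit t _ (hFt x hx) (hTt x hx))
  have hbval : ∀ (c : Bool) (p : ℂ) (F : Filter ℂ), F.NeBot → p ∈ S3 R → F ≤ 𝓝 p → SS R ∈ F →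
      Tendsto (fun w => lam d ℓ (Complex.exp w)) F (𝓝 (bv c)) →
      (H p).re ≤ R₁ - M - 1 ∧ (H p).im = bv c * hh d (H p).re := by
    intro c p F hF hp hFp hFS hT
    have t1 : Tendsto H F (𝓝 (H p)) :=
      (hHd.differentiableAt ((S3_isOpen R).mem_nhds hp)).continuousAt.tendsto.mono_left hFp
    have t2 := (Complex.continuous_re.tendsto _).comp t1
    have hre : (H p).re ≤ R₁ - M - 1 := by
      refine le_of_tendsto t2 ?_
      filter_upwards [hFS] with w hw
      simp only [Function.comp]
      rw [hHe hw]; exact (hlre w hw).le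
    refine ⟨hre, ?_⟩
    have hpL : (H p).re < L := by linarith
    have t3 : Tendsto (fun w => hh d (H w).re) F (𝓝 (hh d (H p).re)) :=
      ((I.dd.cont.continuousAt (Iio_mem_nhds hpL)).tendsto).comp t2
    refine tendsto_nhds_unique ((Complex.continuous_im.tendsto _).comp t1) ((hT.mul t3).congr' ?_)
    filter_upwards [hFS] with w hw
    simp only [Function.comp]
    rw [hHe hw, lam, div_mul_cancel₀ _ (I.dd.ne _ (hlO w hw).1)]
  refine ⟨R, b, t, H, ⟨hHd, fun w hw => ?_, fun w hw => ?_, fun X => ?_, fun w hw h => ?_, fun w hw h => ?_,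
    fun x hx => ?_, fun x hx => ?_⟩, fun w hw => ?_⟩
  · rw [hHe hw]
    obtain ⟨h3, h4⟩ := hlO w hw
    exact ⟨by linarith [hlre w hw], h4⟩
  · rw [hHe hw]; exact hlre w hw
  · obtain ⟨ε, hε, h⟩ := I.lt X
    refine ⟨Real.log ε, fun w hw hwR => ?_⟩
    rw [hHe hw]
    exact (h _ (exp_SS hε rfl ⟨hwR, hw.2.1, hw.2.2⟩)).2
  · rw [hHb w hw h, hrho]
    have : conj w ∈ SS R := ⟨by simpa using hw.1, by simpa using h, by simp; linarith [hw.2.1]⟩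
    rw [hHe this]
  · rw [hHt w hw h, hrho]
    have : conj w + 2 * Real.pi * Complex.I ∈ SS R := ⟨by simpa using hw.1, by simp; linarith [hw.2.2],
      by simp; linarith⟩
    rw [hHe this]
  · exact hbval b _ _ (nebot_H x) ⟨by simpa using hx, by simpa using hpi, by simpa using hpi⟩
      nhdsWithin_le_nhds (hFb x hx) (hTb x hx)
  · refine hbval t _ _ ?_ ⟨by simpa using hx, by simp; linarith, by simp; linarith⟩
      nhdsWithin_le_nhds (hFt x hx) (hTt x hx)
    rw [← mem_closure_iff_nhdsWithin_neBot]
    rw [Complex.closure_preimage_im (Iio Real.pi) |> fun h => (h : closure {z : ℂ | z.im < Real.pi} = _)]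
    simp
  · rw [hHe hw]
    exact I.lg _ (h2a _ (hes w hw)).1

end
end

section
open ComplexConjugate

theorem diffAt_iterate {τ H : ℂ → ℂ} {R' : ℝ} (hτ : DifferentiableOn ℂ τ (LH R')) {w : ℂ}
    (hH : DifferentiableAt ℂ H w) (j : ℕ) (hj : ∀ i < j, τ^[i] (H w) ∈ LH R') :
    DifferentiableAt ℂ (fun z => τ^[j] (H z)) w := by
  induction j with
  | zero => simpa using hH
  | succ n ih =>
    have h1 := ih (fun i hi => hj i (by omega))
    have h2 := hj n (by omega)
    have h3 : DifferentiableAt ℂ τ (τ^[n] (H w)) := (hτ _ h2).differentiableAt ((LH_isOpen R').mem_nhds h2)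
    have h4 : (fun z => τ^[n+1] (H z)) = fun z => τ (τ^[n] (H z)) := by
      funext z; rw [Function.iterate_succ_apply']
    rw [h4]
    exact h3.comp w h1

/-- two sided iteration -/
noncomputable def FI (τ τi : ℂ → ℂ) (m : ℤ) (u : ℂ) : ℂ :=
  if 0 ≤ m then τ^[m.toNat] u else τi^[(-m).toNat] u

theorem FI_step {τ τi : ℂ → ℂ} {a b : ℂ} (h1 : b = τ a) (h2 : a = τi b) (m : ℤ) :
    FI τ τi (m - 1) b = FI τ τi m a := by
  unfold FI
  rcases lt_trichotomy m 0 with h | h | h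
  · rw [if_neg (by omega), if_neg (by omega)]
    have : (-(m-1)).toNat = (-m).toNat + 1 := by omega
    rw [this, Function.iterate_succ_apply, ← h2]
  · subst h
    simp [← h2]
  · rw [if_pos (by omega), if_pos (by omega)]
    have : m.toNat = (m-1).toNat + 1 := by omega
    rw [this, Function.iterate_succ_apply, ← h1]

/-- shift down -/
noncomputable def shf (m : ℤ) (w : ℂ) : ℂ := w - m * (2 * Real.pi * Complex.I)

theorem shf_re (m : ℤ) (w : ℂ) : (shf m w).re = w.re := by simp [shf]
theorem shf_im (m : ℤ) (w : ℂ) : (shf m w).im = w.im - m * (2 * Real.pi) := by simp [shf]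

theorem glue_ext {H τ τi φ Ψ : ℂ → ℂ} {R R' : ℝ} (hR' : R' ≤ 0) (hR0 : R ≤ 0)
    (hφ : DifferentiableOn ℂ φ (ball 0 1))
    (hH : DifferentiableOn ℂ H (S3 R)) (hτ : DifferentiableOn ℂ τ (LH R'))
    (hτi : DifferentiableOn ℂ τi (LH R'))
    (h1 : ∀ w ∈ S3 R, w.im < 0 → H (w + 2 * Real.pi * Complex.I) = τ (H w))
    (h2 : ∀ w ∈ S3 R, w.im < 0 → H w = τi (H (w + 2 * Real.pi * Complex.I)))
    (ho : ∀ w ∈ S3 R, ∀ j : ℕ, (j : ℝ) ≤ w.re ^ 2 + 3 → τ^[j] (H w) ∈ LH R' ∧ τi^[j] (H w) ∈ LH R')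
    (hΨ : ∀ w ∈ SS R, φ (Complex.exp (H w)) = Ψ w) :
    ∃ c C : ℝ, 0 < c ∧ 0 < C ∧ ∃ G : ℂ → ℂ,
      DifferentiableOn ℂ G {w : ℂ | w.re < Real.log c - C * Real.sqrt |w.im|} ∧
      ∀ w ∈ {w : ℂ | w.re < Real.log c - C * Real.sqrt |w.im|}, 0 < w.im → w.im < Real.pi →
        G w = Ψ w := by
  have hpi := Real.pi_pos
  have hpi3 := Real.pi_gt_three
  set fl : ℂ → ℤ := fun w => ⌊w.im / (2 * Real.pi)⌋ with hfl
  have hf1 : ∀ w, (fl w : ℝ) * (2 * Real.pi) ≤ w.im := fun w => by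
    have := Int.floor_le (w.im / (2 * Real.pi))
    rwa [le_div_iff₀ (by positivity)] at this
  have hf2 : ∀ w, w.im < ((fl w : ℝ) + 1) * (2 * Real.pi) := fun w => by
    have := Int.lt_floor_add_one (w.im / (2 * Real.pi))
    rwa [div_lt_iff₀ (by positivity)] at this
  set EE : ℤ → ℂ → ℂ := fun m w => FI τ τi m (H (shf m w)) with hEE
  have hS : ∀ (m : ℤ) (w : ℂ), w.re < R → (m : ℝ) * (2 * Real.pi) - Real.pi < w.im →
      w.im < ((m : ℝ) + 1) * (2 * Real.pi) → shf m w ∈ S3 R := by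
    intro m w ha hb hc
    refine ⟨by rw [shf_re]; exact ha, ?_, ?_⟩
    · rw [shf_im]; linarith
    · rw [shf_im]; linarith
  refine ⟨Real.exp R, 1, Real.exp_pos _, one_pos, fun w => φ (Complex.exp (EE (fl w) w)), ?_, ?_⟩
  · intro w hw
    rw [mem_ofPred_eq, Real.log_exp, one_mul] at hw
    have hsq := Real.sqrt_nonneg |w.im|
    have hwR : w.re < R := by linarith
    have hwI : |w.im| ≤ w.re ^ 2 := by
      rw [← Real.sq_sqrt (abs_nonneg w.im)]
      nlinarith
    set m := fl w with hm
    have hmem : shf m w ∈ S3 R := hS m w hwR (by linarith [hf1 w]) (hf2 w)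
    have hmb : |(m : ℝ)| ≤ w.re ^ 2 + 3 := by
      have a := hf1 w
      have b := hf2 w
      rw [← hm] at a b
      have c1 := neg_abs_le w.im
      have c2 := le_abs_self w.im
      rw [abs_le]
      constructor
      · by_contra hcon
        push Not at hcon
        nlinarith [abs_nonneg w.im]
      · by_contra hcon
        push Not at hcon
        nlinarith [abs_nonneg w.im]
    -- the branch is differentiable
    have hHw : DifferentiableAt ℂ (fun z => H (shf m z)) w := by
      have : DifferentiableAt ℂ H (shf m w) := (hH _ hmem).differentiableAt ((S3_isOpen R).mem_nhds hmem)
      refine this.comp w ?_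
      unfold shf; fun_prop
    have hEd : DifferentiableAt ℂ (EE m) w ∧ EE m w ∈ LH R' := by
      have hrr : (shf m w).re = w.re := shf_re m w
      by_cases h0 : 0 ≤ m
      · have e : EE m = fun z => τ^[m.toNat] (H (shf m z)) := by
          funext z; simp [hEE, FI, h0]
        have hcast : ((m.toNat : ℕ) : ℝ) = (m : ℝ) := by
          have : ((m.toNat : ℕ) : ℤ) = m := Int.toNat_of_nonneg h0
          exact_mod_cast this
        have hle : ((m.toNat : ℕ) : ℝ) ≤ w.re ^ 2 + 3 := by rw [hcast]; exact (le_abs_self _).trans hmb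
        rw [e]
        refine ⟨diffAt_iterate (H := fun z => H (shf m z)) hτ hHw _ (fun i hi => (ho _ hmem i ?_).1), (ho _ hmem _ ?_).1⟩
        · rw [hrr]; exact (Nat.cast_le.2 hi.le).trans hle
        · rw [hrr]; exact hle
      · have e : EE m = fun z => τi^[(-m).toNat] (H (shf m z)) := by
          funext z; simp [hEE, FI, h0]
        have hcast : (((-m).toNat : ℕ) : ℝ) = -(m : ℝ) := by
          have : (((-m).toNat : ℕ) : ℤ) = -m := Int.toNat_of_nonneg (by omega)
          exact_mod_cast this
        have hle : (((-m).toNat : ℕ) : ℝ) ≤ w.re ^ 2 + 3 := by rw [hcast]; exact (neg_le_abs _).trans hmb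
        rw [e]
        refine ⟨diffAt_iterate (H := fun z => H (shf m z)) hτi hHw _ (fun i hi => (ho _ hmem i ?_).2), (ho _ hmem _ ?_).2⟩
        · rw [hrr]; exact (Nat.cast_le.2 hi.le).trans hle
        · rw [hrr]; exact hle
    have hbr : (fun z => EE (fl z) z) =ᶠ[𝓝 w] EE m := by
      have o1 : {z : ℂ | (m : ℝ) * (2 * Real.pi) - Real.pi < z.im} ∈ 𝓝 w :=
        (isOpen_lt continuous_const Complex.continuous_im).mem_nhds (by
          show (m : ℝ) * (2 * Real.pi) - Real.pi < w.im
          linarith [hf1 w])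
      have o2 : {z : ℂ | z.im < ((m : ℝ) + 1) * (2 * Real.pi)} ∈ 𝓝 w :=
        (isOpen_lt Complex.continuous_im continuous_const).mem_nhds (hf2 w)
      have o3 : {z : ℂ | z.re < R} ∈ 𝓝 w :=
        (isOpen_lt Complex.continuous_re continuous_const).mem_nhds hwR
      filter_upwards [o1, o2, o3] with z z1 z2 z3
      have z1' : (m : ℝ) * (2 * Real.pi) - Real.pi < z.im := z1
      have z2' : z.im < ((m : ℝ) + 1) * (2 * Real.pi) := z2
      have hzS := hS m z z3 z1' z2'
      by_cases hz : (m : ℝ) * (2 * Real.pi) ≤ z.im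
      · have : fl z = m := by
          rw [hfl]; refine Int.floor_eq_iff.2 ⟨?_, ?_⟩
          · rwa [le_div_iff₀ (by positivity)]
          · rwa [div_lt_iff₀ (by positivity)]
        rw [this]
      · push Not at hz
        have : fl z = m - 1 := by
          rw [hfl]; refine Int.floor_eq_iff.2 ⟨?_, ?_⟩
          · rw [le_div_iff₀ (by positivity)]; push_cast; linarith
          · rw [div_lt_iff₀ (by positivity)]; push_cast; linarith
        rw [this]
        have him : (shf m z).im < 0 := by rw [shf_im]; linarith
        have hsh : shf (m - 1) z = shf m z + 2 * Real.pi * Complex.I := by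
          unfold shf; push_cast; ring
        show FI τ τi (m - 1) (H (shf (m - 1) z)) = FI τ τi m (H (shf m z))
        rw [hsh]
        exact FI_step (h1 _ hzS him) (h2 _ hzS him) m
    have hfin : DifferentiableAt ℂ (fun z => φ (Complex.exp (EE m z))) w := by
      have hin : Complex.exp (EE m w) ∈ ball (0 : ℂ) 1 := by
        rw [mem_ball_zero_iff, Complex.norm_exp]
        exact Real.exp_lt_one_iff.2 (hEd.2.trans_le hR')
      have : DifferentiableAt ℂ φ (Complex.exp (EE m w)) := (hφ _ hin).differentiableAt (isOpen_ball.mem_nhds hin)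
      exact this.comp w (hEd.1.cexp)
    exact (hfin.congr_of_eventuallyEq (hbr.fun_comp (fun u => φ (Complex.exp u)))).differentiableWithinAt
  · intro w hw hw0 hwp
    rw [mem_ofPred_eq, Real.log_exp, one_mul] at hw
    have hsq := Real.sqrt_nonneg |w.im|
    have hwR : w.re < R := by linarith
    have : fl w = 0 := by
      rw [hfl]; refine Int.floor_eq_iff.2 ⟨?_, ?_⟩
      · simp; positivity
      · rw [div_lt_iff₀ (by positivity)]; push_cast; linarith
    show φ (Complex.exp (EE (fl w) w)) = Ψ w
    rw [this, ← hΨ w ⟨hwR, hw0, hwp⟩]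
    simp [hEE, FI, shf]
end

section
open ComplexConjugate

section
variable {d A B H : ℂ → ℂ} {R R₁ M : ℝ} {b t : Bool}

theorem bv_mem (b : Bool) : bv b ∈ Icc (0 : ℝ) 1 := by cases b <;> simp [bv]

theorem StripExt.closed (S : StripExt d A B R R₁ M b t H) {v : ℂ} (hv : v.re < R) (h0 : 0 ≤ v.im)
    (h1 : v.im ≤ Real.pi) :
    (H v).re ≤ R₁ - M - 1 ∧ ∃ c ∈ Icc (0 : ℝ) 1, (H v).im = c * hh d (H v).re := by
  rcases h0.eq_or_lt with h | h
  · have e : v = (v.re : ℂ) := by apply Complex.ext <;> simp [← h]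
    have := S.bb v.re hv
    rw [← e] at this
    exact ⟨this.1, bv b, bv_mem b, this.2⟩
  · rcases h1.eq_or_lt with h' | h'
    · have e : v = (v.re + Real.pi * Complex.I : ℂ) := by apply Complex.ext <;> simp [← h']
      have := S.bt v.re hv
      rw [← e] at this
      exact ⟨this.1, bv t, bv_mem t, this.2⟩
    · obtain ⟨-, c, hc, e⟩ := S.mem v ⟨hv, h, h'⟩
      exact ⟨(S.re v ⟨hv, h, h'⟩).le, c, ⟨hc.1.le, hc.2.le⟩, e⟩

theorem SS_sub_S3 {v : ℂ} (hv : v.re < R) (h0 : 0 ≤ v.im) (h1 : v.im ≤ Real.pi) : v ∈ S3 R :=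
  ⟨hv, by linarith [Real.pi_pos], by linarith [Real.pi_pos]⟩

theorem StripExt.lt_closed (S : StripExt d A B R R₁ M b t H) (X : ℝ) :
    ∃ R' ≤ R, ∀ v : ℂ, v.re < R' → 0 ≤ v.im → v.im ≤ Real.pi → (H v).re < X := by
  obtain ⟨R', h⟩ := S.lt (X - 1)
  refine ⟨min R' R, min_le_right _ _, fun v hv h0 h1 => ?_⟩
  have hvR : v.re < R := hv.trans_le (min_le_right _ _)
  have hcl : v ∈ closure (SS (min R' R)) := by
    have e : SS (min R' R) = Iio (min R' R) ×ℂ Ioo 0 Real.pi := by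
      ext z; simp [SS, Complex.mem_reProdIm]
    rw [e, Complex.closure_reProdIm, closure_Iio, closure_Ioo Real.pi_pos.ne]
    exact ⟨hv.le, h0, h1⟩
  have := mem_closure_iff_nhdsWithin_neBot.1 hcl
  have hc : ContinuousAt H v :=
    ((S.diff v (SS_sub_S3 hvR h0 h1)).differentiableAt ((S3_isOpen R).mem_nhds (SS_sub_S3 hvR h0 h1))).continuousAt
  have ht : Tendsto (fun z => (H z).re) (𝓝[SS (min R' R)] v) (𝓝 (H v).re) :=
    ((Complex.continuous_re.tendsto _).comp hc.tendsto).mono_left nhdsWithin_le_nhds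
  have : (H v).re ≤ X - 1 := by
    refine le_of_tendsto ht ?_
    filter_upwards [self_mem_nhdsWithin] with z hz
    exact (h z ⟨hz.1.trans_le (min_le_right _ _), hz.2.1, hz.2.2⟩ (hz.1.trans_le (min_le_left _ _))).le
  linarith

theorem rho_near (P : Pair A B R₁ M) (b : Bool) {u : ℂ} (hu : u.re ≤ R₁ - M - 1) :
    ‖rho A B b u - conj u‖ ≤ 2 * M := by
  have hM := P.M0
  cases b with
  | false => simp [rho]; exact hM
  | true =>
    have h1 : u ∈ LH R₁ := by show u.re < R₁; linarith
    have h2 := P.AM u h1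
    have h3 := re_le_of_norm h2
    have h4 : conj (A u) ∈ LH R₁ := by show (conj (A u)).re < R₁; rw [Complex.conj_re]; linarith
    have h5 := P.BM _ h4
    have h6 : ‖conj (A u) - conj u‖ ≤ M := by rw [← map_sub, Complex.norm_conj]; exact h2
    simp only [rho, if_true]
    calc ‖B (conj (A u)) - conj u‖ = ‖(B (conj (A u)) - conj (A u)) + (conj (A u) - conj u)‖ := by ring_nf
      _ ≤ _ := norm_add_le _ _
      _ ≤ 2 * M := by linarith

theorem StripExt.fold (S : StripExt d A B R R₁ M b t H) {w : ℂ} (hw : w ∈ S3 R) :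
    ∃ v : ℂ, v.re = w.re ∧ 0 ≤ v.im ∧ v.im ≤ Real.pi ∧
      (H w = H v ∨ ∃ c : Bool, H w = rho A B c (H v)) := by
  obtain ⟨a1, a2, a3⟩ := hw
  by_cases h : w.im < 0
  · exact ⟨conj w, by simp, by simp; linarith, by simp; linarith, Or.inr ⟨b, S.rb w ⟨a1, a2, a3⟩ h⟩⟩
  by_cases h' : Real.pi < w.im
  · exact ⟨conj w + 2 * Real.pi * Complex.I, by simp, by simp; linarith, by simp; linarith,
      Or.inr ⟨t, S.rt w ⟨a1, a2, a3⟩ h'⟩⟩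
  · push Not at h h'
    exact ⟨w, rfl, h, h', Or.inl rfl⟩

theorem StripExt.fold_near (S : StripExt d A B R R₁ M b t H) (P : Pair A B R₁ M) {w : ℂ} (hw : w ∈ S3 R) :
    ∃ v : ℂ, v.re = w.re ∧ 0 ≤ v.im ∧ v.im ≤ Real.pi ∧
      |(H w).re - (H v).re| ≤ 2 * M ∧ |(H w).im| ≤ |(H v).im| + 2 * M := by
  obtain ⟨v, h1, h2, h3, h4⟩ := S.fold hw
  refine ⟨v, h1, h2, h3, ?_⟩
  have hM := P.M0
  rcases h4 with h4 | ⟨c, h4⟩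
  · rw [h4]; simp; exact hM
  · have hv := (S.closed (by rw [h1]; exact hw.1) h2 h3).1
    have hn := rho_near P c hv
    rw [← h4] at hn
    have n1 := (Complex.abs_re_le_norm _).trans hn
    have n2 := (Complex.abs_im_le_norm _).trans hn
    simp only [Complex.sub_re, Complex.sub_im, Complex.conj_re, Complex.conj_im] at n1 n2
    refine ⟨n1, ?_⟩
    have := abs_sub_abs_le_abs_sub (H w).im (-(H v).im)
    rw [abs_neg] at this
    linarith

theorem StripExt.lt_S3 (S : StripExt d A B R R₁ M b t H) (P : Pair A B R₁ M) (X : ℝ) :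
    ∃ R' ≤ R, ∀ w ∈ S3 R', (H w).re < X := by
  obtain ⟨R', h, h'⟩ := S.lt_closed (X - 2 * M)
  refine ⟨R', h, fun w hw => ?_⟩
  obtain ⟨v, h1, h2, h3, h4, -⟩ := S.fold_near P ⟨hw.1.trans_le h, hw.2.1, hw.2.2⟩
  have := h' v (by rw [h1]; exact hw.1) h2 h3
  have := (abs_le.1 h4).2
  linarith

theorem StripExt.im_bdd (S : StripExt d A B R R₁ M b t H) (P : Pair A B R₁ M) {r L : ℝ} (dd : DData d r L)
    (hL : R₁ ≤ L) {w : ℂ} (hw : w ∈ S3 R) : |(H w).im| ≤ 2 * Real.pi + 2 * M := by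
  obtain ⟨v, h1, h2, h3, -, h5⟩ := S.fold_near P hw
  obtain ⟨h6, c, hc, e⟩ := S.closed (by rw [h1]; exact hw.1) h2 h3
  have := dd.le (H v).re (by linarith [P.M0])
  have h7 : |(H v).im| ≤ 2 * Real.pi := by
    rw [e, abs_mul, abs_of_nonneg hc.1]
    nlinarith [hc.2, abs_nonneg (hh d (H v).re)]
  linarith

end
end

section
open ComplexConjugate

section
variable {d A B H : ℂ → ℂ} {R R₁ M r L : ℝ} {b t : Bool}

theorem deriv_bdd_of_im {H : ℂ → ℂ} {w : ℂ} {B : ℝ} (hd : DifferentiableOn ℂ H (closedBall w 1))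
    (hd' : DifferentiableAt ℂ H w)
    (hB : ∀ z ∈ closedBall w 1, |(H z).im| ≤ B) : ‖deriv H w‖ ≤ Real.exp (2 * B) := by
  set f : ℂ → ℂ := fun z => Complex.exp (-Complex.I * H z) with hf
  have hn : ∀ z, ‖f z‖ = Real.exp (H z).im := by
    intro z; rw [hf, Complex.norm_exp]; simp
  have hfd : DifferentiableOn ℂ f (closedBall w 1) := by
    rw [hf]; exact (hd.const_mul _).cexp
  have h1 : ‖deriv f w‖ ≤ Real.exp B / 1 := by
    refine Complex.norm_deriv_le_of_forall_mem_sphere_norm_le one_pos ?_ ?_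
    · refine DifferentiableOn.diffContOnCl ?_
      rw [closure_ball _ one_ne_zero]; exact hfd
    · intro z hz
      rw [hn]
      exact Real.exp_le_exp.2 ((le_abs_self _).trans (hB z (sphere_subset_closedBall hz)))
  have h2 : deriv f w = f w * (-Complex.I * deriv H w) :=
    (hd'.hasDerivAt.const_mul (-Complex.I)).cexp.deriv
  rw [h2, norm_mul, hn, norm_mul, norm_neg, Complex.norm_I, one_mul, div_one] at h1
  have h3 : Real.exp (-B) ≤ Real.exp (H w).im :=
    Real.exp_le_exp.2 (abs_le.1 (hB w (mem_closedBall_self zero_le_one))).1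
  have h4 : Real.exp (-B) * ‖deriv H w‖ ≤ Real.exp B :=
    (mul_le_mul_of_nonneg_right h3 (norm_nonneg _)).trans h1
  have h5 : Real.exp B = Real.exp (-B) * Real.exp (2 * B) := by rw [← Real.exp_add]; ring_nf
  rw [h5] at h4
  exact le_of_mul_le_mul_left h4 (Real.exp_pos _)

theorem S3_closedBall {w : ℂ} (hw : w.re < R - 1) (h0 : 0 ≤ w.im) (h1 : w.im ≤ Real.pi) :
    closedBall w 1 ⊆ S3 R := by
  intro z hz
  rw [mem_closedBall, dist_eq_norm] at hz
  have n1 := (abs_le.1 ((Complex.abs_re_le_norm _).trans hz))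
  have n2 := (abs_le.1 ((Complex.abs_im_le_norm _).trans hz))
  simp only [Complex.sub_re, Complex.sub_im] at n1 n2
  have := Real.pi_gt_three
  exact ⟨by linarith, by linarith, by linarith⟩

/-- vertical oscillation -/
theorem StripExt.osc (S : StripExt d A B R R₁ M b t H) (P : Pair A B R₁ M) (dd : DData d r L)
    (hL : R₁ ≤ L) : ∃ C, ∀ x < R - 1, ∀ y ∈ Icc 0 Real.pi, ∀ y' ∈ Icc 0 Real.pi,
      (H (x + y * Complex.I)).re ≤ (H (x + y' * Complex.I)).re + C := by
  set B₀ := 2 * Real.pi + 2 * M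
  refine ⟨Real.exp (2 * B₀) * Real.pi, fun x hx y hy y' hy' => ?_⟩
  set V : Set ℂ := {z : ℂ | z.re = x ∧ z.im ∈ Icc 0 Real.pi} with hV
  have hVc : Convex ℝ V := by
    exact ((convex_singleton (𝕜 := ℝ) x).linear_preimage Complex.reLm).inter
      ((convex_Icc (𝕜 := ℝ) 0 Real.pi).linear_preimage Complex.imLm)
  have hdiff : ∀ z ∈ V, DifferentiableAt ℂ H z := fun z hz => by
    have : z ∈ S3 R := SS_sub_S3 (by rw [hz.1]; linarith) hz.2.1 hz.2.2
    exact (S.diff z this).differentiableAt ((S3_isOpen R).mem_nhds this)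
  have hb : ∀ z ∈ V, ‖deriv H z‖ ≤ Real.exp (2 * B₀) := fun z hz => by
    have hs : closedBall z 1 ⊆ S3 R := S3_closedBall (by rw [hz.1]; exact hx) hz.2.1 hz.2.2
    exact deriv_bdd_of_im (S.diff.mono hs) (hdiff z hz) (fun u hu => S.im_bdd P dd hL (hs hu))
  have h := hVc.norm_image_sub_le_of_norm_deriv_le hdiff hb (x := (x + y' * Complex.I : ℂ)) (y := (x + y * Complex.I : ℂ))
    (by simpa [hV] using hy') (by simpa [hV] using hy)
  have e : ‖(x + y * Complex.I : ℂ) - (x + y' * Complex.I)‖ ≤ Real.pi := by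
    have : (x + y * Complex.I : ℂ) - (x + y' * Complex.I) = ((y - y' : ℝ) : ℂ) * Complex.I := by push_cast; ring
    rw [this, norm_mul, Complex.norm_I, mul_one, Complex.norm_real, Real.norm_eq_abs, abs_le]
    exact ⟨by linarith [hy.1, hy'.2], by linarith [hy'.1, hy.2]⟩
  have := re_le_of_norm (h.trans (mul_le_mul_of_nonneg_left e (Real.exp_pos _).le))
  exact this

/-- the vertical mean -/
noncomputable def vm (H : ℂ → ℂ) (x : ℝ) : ℝ := ∫ y in (0:ℝ)..Real.pi, (H (x + y * Complex.I)).re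

theorem vm_diff (hH : DifferentiableOn ℂ H (S3 R)) {x₁ x₂ : ℝ} (h12 : x₁ ≤ x₂) (h2 : x₂ < R) :
    vm H x₂ - vm H x₁ = ∫ x in x₁..x₂, ((H (x + Real.pi * Complex.I)).im - (H x).im) := by
  have hpi := Real.pi_pos
  have hsub : ∀ x ∈ Icc x₁ x₂, ∀ y ∈ Icc 0 Real.pi, (x + y * Complex.I : ℂ) ∈ S3 R := by
    intro x hx y hy
    refine SS_sub_S3 ?_ ?_ ?_
    · simpa using hx.2.trans_lt h2
    · simpa using hy.1
    · simpa using hy.2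
  have hcv : ∀ x ∈ Icc x₁ x₂, IntervalIntegrable (fun y : ℝ => H (x + y * Complex.I)) MeasureTheory.volume 0 Real.pi := by
    intro x hx
    refine ContinuousOn.intervalIntegrable ?_
    rw [uIcc_of_le hpi.le]
    exact hH.continuousOn.comp (by fun_prop) (fun y hy => hsub x hx y hy)
  have hch : ∀ y ∈ Icc 0 Real.pi, IntervalIntegrable (fun x : ℝ => H (x + y * Complex.I)) MeasureTheory.volume x₁ x₂ := by
    intro y hy
    refine ContinuousOn.intervalIntegrable ?_
    rw [uIcc_of_le h12]
    exact hH.continuousOn.comp (by fun_prop) (fun x hx => hsub x hx y hy)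
  have key := Complex.integral_boundary_rect_eq_zero_of_differentiableOn H (x₁ : ℂ) (x₂ + Real.pi * Complex.I) (by
    refine hH.mono ?_
    intro z hz
    simp only [Complex.mem_reProdIm] at hz
    simp at hz
    rw [uIcc_of_le h12, uIcc_of_le hpi.le] at hz
    exact SS_sub_S3 (hz.1.2.trans_lt h2) hz.2.1 hz.2.2)
  simp at key
  have im_int : ∀ (f : ℝ → ℂ) (a b : ℝ), IntervalIntegrable f MeasureTheory.volume a b →
      (∫ x in a..b, f x).im = ∫ x in a..b, (f x).im := fun f a b hf => by
    have := Complex.imCLM.intervalIntegral_comp_comm hf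
    exact this.symm
  have re_int : ∀ (f : ℝ → ℂ) (a b : ℝ), IntervalIntegrable f MeasureTheory.volume a b →
      (∫ x in a..b, f x).re = ∫ x in a..b, (f x).re := fun f a b hf => by
    have := Complex.reCLM.intervalIntegral_comp_comm hf
    exact this.symm
  have h0 : IntervalIntegrable (fun x : ℝ => H x) MeasureTheory.volume x₁ x₂ := by
    simpa using hch 0 ⟨le_rfl, hpi.le⟩
  have hp := hch Real.pi ⟨hpi.le, le_rfl⟩
  have k2 := congrArg Complex.im key
  simp only [Complex.add_im, Complex.sub_im, Complex.mul_im, Complex.I_re, Complex.I_im, zero_mul, one_mul, zero_add, Complex.zero_im] at k2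
  rw [im_int _ _ _ h0, im_int _ _ _ hp, re_int _ _ _ (hcv x₁ ⟨le_rfl, h12⟩), re_int _ _ _ (hcv x₂ ⟨h12, le_rfl⟩)] at k2
  have i1 : IntervalIntegrable (fun x : ℝ => (H x).im) MeasureTheory.volume x₁ x₂ := ⟨h0.1.im, h0.2.im⟩
  have i2 : IntervalIntegrable (fun x : ℝ => (H (x + Real.pi * Complex.I)).im) MeasureTheory.volume x₁ x₂ := ⟨hp.1.im, hp.2.im⟩
  rw [intervalIntegral.integral_sub i2 i1]
  unfold vm
  linarith

end
end

section
open ComplexConjugate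

section
variable {d A B H : ℂ → ℂ} {R R₁ M r L : ℝ} {b t : Bool}

theorem DData.d0_real (dd : DData d r L) : ((d 0).re : ℂ) = d 0 := by
  have h := dd.symm 0 (mem_ball_self dd.rpos)
  rw [map_zero] at h
  exact Complex.conj_eq_iff_re.1 h.symm

theorem DData.hh_tendsto (dd : DData d r L) : Tendsto (hh d) atBot (𝓝 (d 0).re) := by
  have h1 : ContinuousAt d 0 := (dd.diff.continuousOn).continuousAt (ball_mem_nhds 0 dd.rpos)
  have h2 : Tendsto (fun x : ℝ => ((Real.exp x : ℝ) : ℂ)) atBot (𝓝 0) := by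
    have := (Complex.continuous_ofReal.tendsto 0).comp Real.tendsto_exp_atBot
    rw [Complex.ofReal_zero] at this
    exact this
  exact (Complex.continuous_re.tendsto _).comp (h1.tendsto.comp h2)

theorem StripExt.vm_alt (S : StripExt d A B R R₁ M b t H) (P : Pair A B R₁ M) (dd : DData d r L)
    (hbt : b ≠ t) (hd0 : d 0 ≠ 0) :
    ∃ a > 0, ∃ R' < R, ∀ x₁ x₂ : ℝ, x₁ ≤ x₂ → x₂ < R' → vm H x₁ ≤ vm H x₂ - a * (x₂ - x₁) := by
  have hpi := Real.pi_pos
  set D0 := (d 0).re with hD0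
  have hD : D0 ≠ 0 := by
    intro h
    apply hd0
    rw [← dd.d0_real, ← hD0, h]; simp
  have ha : 0 < |D0| / 2 := by positivity
  obtain ⟨X₀, hX⟩ := eventually_atBot.1 ((Metric.tendsto_nhds.1 dd.hh_tendsto) (|D0| / 2) ha)
  obtain ⟨R₀, hR0, hR0'⟩ := S.lt_closed X₀
  -- sign of the jump
  have hq : ∃ ε : ℝ, (ε = 1 ∨ ε = -1) ∧ ∀ x : ℝ, x < R₀ →
      |D0| / 2 ≤ ε * ((H (x + Real.pi * Complex.I)).im - (H x).im) := by
    have main : ∀ v : ℂ, v.re < R₀ → 0 ≤ v.im → v.im ≤ Real.pi → |D0| / 2 ≤ SignType.sign D0 * hh d (H v).re := by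
      intro v h1 h2 h3
      have := hX _ (hR0' v h1 h2 h3).le
      rw [Real.dist_eq, ← hD0, abs_lt] at this
      rcases lt_or_gt_of_ne hD with h | h
      · rw [sign_neg h]; rw [abs_of_neg h] at this ⊢; simp; linarith [this.2]
      · rw [sign_pos h]; rw [abs_of_pos h] at this ⊢; simp; linarith [this.1]
    have hs : ((SignType.sign D0 : SignType) : ℝ) = 1 ∨ ((SignType.sign D0 : SignType) : ℝ) = -1 := by
      rcases lt_or_gt_of_ne hD with h | h
      · right; rw [sign_neg h]; simp
      · left; rw [sign_pos h]; simp
    have hb' := fun (x : ℝ) (hx : x < R₀) => (S.bb x (hx.trans_le hR0)).2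
    have ht' := fun (x : ℝ) (hx : x < R₀) => (S.bt x (hx.trans_le hR0)).2
    cases b <;> cases t
    · exact absurd rfl hbt
    · refine ⟨_, hs, fun x hx => ?_⟩
      rw [hb' x hx, ht' x hx]
      simpa [bv] using main (x + Real.pi * Complex.I) (by simpa using hx) (by simpa using hpi.le) (by simp)
    · refine ⟨-(SignType.sign D0 : SignType), ?_, fun x hx => ?_⟩
      · rcases hs with h | h
        · right; rw [h]
        · left; rw [h]; simp
      rw [hb' x hx, ht' x hx]
      simpa [bv] using main x (by simpa using hx) (by simp) (by simpa using hpi.le)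
    · exact absurd rfl hbt
  obtain ⟨ε, hε, hq⟩ := hq
  set R' := min R₀ (R - 1) with hR'
  have hR'R : R' < R := (min_le_right _ _).trans_lt (by linarith)
  have hintg : ∀ x₁ x₂ : ℝ, x₁ ≤ x₂ → x₂ < R' →
      |D0| / 2 * (x₂ - x₁) ≤ ε * (vm H x₂ - vm H x₁) := by
    intro x₁ x₂ h12 h2
    rw [vm_diff S.diff h12 (h2.trans hR'R), ← intervalIntegral.integral_const_mul]
    have hc : ∫ x in x₁..x₂, (|D0| / 2) = |D0| / 2 * (x₂ - x₁) := by
      rw [intervalIntegral.integral_const, smul_eq_mul]; ring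
    rw [← hc]
    refine intervalIntegral.integral_mono_on h12 (by simp) ?_ ?_
    · refine ContinuousOn.intervalIntegrable ?_
      rw [uIcc_of_le h12]
      have c1 : ContinuousOn (fun x : ℝ => H (x + Real.pi * Complex.I)) (Icc x₁ x₂) :=
        S.diff.continuousOn.comp (by fun_prop) (fun x hx => SS_sub_S3
          (by simpa using (hx.2.trans_lt h2).trans hR'R) (by simpa using hpi.le) (by simp))
      have c2 : ContinuousOn (fun x : ℝ => H x) (Icc x₁ x₂) :=
        S.diff.continuousOn.comp (by fun_prop) (fun x hx => SS_sub_S3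
          (by simpa using (hx.2.trans_lt h2).trans hR'R) (by simp) (by simpa using hpi.le))
      exact continuousOn_const.mul ((Complex.continuous_im.comp_continuousOn c1).sub (Complex.continuous_im.comp_continuousOn c2))
    · intro x hx
      exact hq x ((hx.2.trans_lt h2).trans_le (min_le_left _ _))
  have hvm : ∀ x < R, vm H x ≤ R₁ * Real.pi := by
    intro x hx
    have hc : ∫ y in (0:ℝ)..Real.pi, R₁ = R₁ * Real.pi := by
      rw [intervalIntegral.integral_const, smul_eq_mul]; ring
    rw [← hc]
    unfold vm
    refine intervalIntegral.integral_mono_on hpi.le ?_ (by simp) ?_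
    · refine ContinuousOn.intervalIntegrable ?_
      rw [uIcc_of_le hpi.le]
      refine Complex.continuous_re.comp_continuousOn (S.diff.continuousOn.comp (by fun_prop) (fun y hy => SS_sub_S3 ?_ ?_ ?_))
      · simpa using hx
      · simpa using hy.1
      · simpa using hy.2
    · intro y hy
      have := (S.closed (v := x + y * Complex.I) (by simpa using hx) (by simpa using hy.1) (by simpa using hy.2)).1
      linarith [P.M0]
  refine ⟨|D0| / 2, ha, R', hR'R, ?_⟩
  rcases hε with rfl | rfl
  · intro x₁ x₂ h12 h2
    have := hintg x₁ x₂ h12 h2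
    linarith
  · exfalso
    set x₂ := R' - 1
    set N := (|R₁ * Real.pi - vm H x₂| + 1) / (|D0| / 2) with hN
    have hN0 : 0 < N := by positivity
    have h1 := hintg (x₂ - N) x₂ (by linarith) (by simp [x₂])
    have h2 := hvm (x₂ - N) (by simp only [x₂]; linarith)
    have h3 : |D0| / 2 * (x₂ - (x₂ - N)) = |R₁ * Real.pi - vm H x₂| + 1 := by
      rw [hN]; field_simp; ring
    rw [h3] at h1
    have := le_abs_self (R₁ * Real.pi - vm H x₂)
    linarith

theorem StripExt.growth (S : StripExt d A B R R₁ M b t H) (P : Pair A B R₁ M) (dd : DData d r L)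
    (hL : R₁ ≤ L) (hbt : b ≠ t) (hd0 : d 0 ≠ 0) :
    ∃ a > 0, ∃ C, ∃ R' ≤ R, ∀ w ∈ S3 R', (H w).re ≤ a * w.re + C := by
  have hpi := Real.pi_pos
  obtain ⟨a, ha, R', hR', h⟩ := S.vm_alt P dd hbt hd0
  obtain ⟨C, hC⟩ := S.osc P dd hL
  set x₂ := min (R' - 1) (R - 1) with hx₂
  have e1 : x₂ ≤ R' - 1 := min_le_left _ _
  have e2 : x₂ ≤ R - 1 := min_le_right _ _
  refine ⟨a / Real.pi, by positivity, (vm H x₂ - a * x₂) / Real.pi + C + 2 * M, x₂, by linarith, fun w hw => ?_⟩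
  obtain ⟨v, h1, h2, h3, h4, -⟩ := S.fold_near P (w := w) ⟨by linarith [hw.1], hw.2.1, hw.2.2⟩
  have h4 := (abs_le.1 h4).2
  have hx : v.re < x₂ := by rw [h1]; exact hw.1
  have ev : (v.re + v.im * Complex.I : ℂ) = v := Complex.re_add_im v
  have h5 : Real.pi * ((H v).re - C) ≤ vm H v.re := by
    have hc : ∫ y in (0:ℝ)..Real.pi, ((H v).re - C) = Real.pi * ((H v).re - C) := by
      rw [intervalIntegral.integral_const, smul_eq_mul]; ring
    rw [← hc]
    unfold vm
    refine intervalIntegral.integral_mono_on hpi.le (by simp) ?_ ?_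
    · refine ContinuousOn.intervalIntegrable ?_
      rw [uIcc_of_le hpi.le]
      refine Complex.continuous_re.comp_continuousOn (S.diff.continuousOn.comp (by fun_prop) (fun y hy => SS_sub_S3 ?_ ?_ ?_))
      · simp; linarith
      · simpa using hy.1
      · simpa using hy.2
    · intro y hy
      have := hC v.re (by linarith) v.im ⟨h2, h3⟩ y hy
      rw [ev] at this
      linarith
  have h6 := h v.re x₂ hx.le (by linarith)
  have h7 : (H v).re - C ≤ (vm H x₂ - a * (x₂ - v.re)) / Real.pi := by
    rw [le_div_iff₀ hpi]; linarith
  have h8 : (vm H x₂ - a * (x₂ - v.re)) / Real.pi = a / Real.pi * v.re + (vm H x₂ - a * x₂) / Real.pi := by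
    field_simp; ring
  rw [h1] at h8 h7
  linarith
end
end

section
open ComplexConjugate

section
variable {d E T : ℂ → ℂ} {R₁ r L : ℝ}

theorem Disp.corner (hE : Disp d E) (dd : DData d r L) :
    ∃ δ > 0, ∃ K > 0, ∀ z : ℂ, ‖z‖ < δ → |(E z).re| ≤ K * ‖z‖ := by
  obtain ⟨s, j, hs, hj, hj0, -, hEz⟩ := hE.ex
  have hda : AnalyticAt ℂ d 0 := dd.diff.analyticAt (ball_mem_nhds 0 dd.rpos)
  have hdj : DifferentiableAt ℂ (fun z => d (j z)) 0 := by
    have h : DifferentiableAt ℂ d (j 0) := by rw [hj0]; exact hda.differentiableAt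
    exact h.comp 0 hj.differentiableAt
  obtain ⟨C, hC, hb⟩ := (hdj.hasDerivAt.isBigO_sub).exists_pos
  rw [Asymptotics.isBigOWith_iff] at hb
  obtain ⟨δ, hδ, hb⟩ := Metric.eventually_nhds_iff.1 hb
  refine ⟨δ, hδ, 2 * C, by positivity, fun z hz => ?_⟩
  have h1 := hb (y := z) (by simpa using hz)
  rw [hj0, sub_zero] at h1
  have h2 : (d 0).im = 0 := by rw [← dd.d0_real]; simp
  have h3 := (Complex.abs_im_le_norm _).trans h1
  rw [Complex.sub_im, h2, sub_zero] at h3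
  have h4 : (E z).re = -(s * 2 * (d (j z)).im) := by rw [hEz]; simp
  rw [h4, abs_neg, abs_mul, abs_mul]
  have h5 : |s| = 1 := by rcases hs with rfl | rfl <;> simp
  rw [h5, one_mul, abs_of_pos (two_pos : (0:ℝ) < 2)]
  linarith

/-- orbits in the corner case -/
theorem corner_orbit (hE : Disp d E) (dd : DData d r L)
    (hT : ∀ u ∈ LH R₁, T u = u + E (Complex.exp u)) :
    ∃ Y₀ K : ℝ, 0 < K ∧ ∀ Y, Y₀ ≤ Y → ∀ n : ℕ, n * (K * Real.exp (-Y / 2)) ≤ Y / 2 →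
      ∀ u : ℂ, u.re ≤ -Y → (T^[n] u).re ≤ -Y / 2 := by
  obtain ⟨δ, hδ, K, hK, h⟩ := hE.corner dd
  refine ⟨2 * (|R₁| + |Real.log δ| + 1), K, hK, fun Y hY n hn u hu => ?_⟩
  have hY1 : -Y / 2 < R₁ := by linarith [neg_abs_le R₁, abs_nonneg (Real.log δ)]
  have hY2 : -Y / 2 < Real.log δ := by linarith [neg_abs_le (Real.log δ), abs_nonneg R₁]
  have key : ∀ i ≤ n, (T^[i] u).re ≤ -Y + i * (K * Real.exp (-Y / 2)) := by
    intro i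
    induction i with
    | zero => intro _; simpa using hu
    | succ i ih =>
      intro hi
      have h1 := ih (by omega)
      have hp : 0 ≤ K * Real.exp (-Y / 2) := by positivity
      have hin : (i : ℝ) ≤ n := by exact_mod_cast (by omega : i ≤ n)
      have h2 : (T^[i] u).re ≤ -Y / 2 := by nlinarith
      rw [Function.iterate_succ_apply', hT _ (show (T^[i] u).re < R₁ by linarith), Complex.add_re]
      have hn2 : ‖Complex.exp (T^[i] u)‖ ≤ Real.exp (-Y / 2) := by
        rw [Complex.norm_exp]; exact Real.exp_le_exp.2 h2
      have hlt : Real.exp (-Y / 2) < δ := by rwa [← Real.lt_log_iff_exp_lt hδ]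
      have h3 := h _ (hn2.trans_lt hlt)
      have h4 := (le_abs_self _).trans h3
      have h5 := mul_le_mul_of_nonneg_left hn2 hK.le
      push_cast
      linarith
  have := key n le_rfl
  linarith

/-- the numerical part of the corner case -/
theorem corner_num {a K : ℝ} (ha : 0 < a) (hK : 0 < K) (C Y₀ X : ℝ) :
    ∃ R' : ℝ, ∀ x < R', ∃ Y, Y₀ ≤ Y ∧ a * x + C ≤ -Y ∧ -Y / 2 < X ∧
      ∀ n : ℕ, (n : ℝ) ≤ x ^ 2 + 3 → n * (K * Real.exp (-Y / 2)) ≤ Y / 2 := by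
  have h1 : Tendsto (fun Y : ℝ => (((Y + C) / a) ^ 2 + 3) * (K * Real.exp (-Y / 2))) atTop (𝓝 0) := by
    have e : (fun Y : ℝ => (((Y + C) / a) ^ 2 + 3) * (K * Real.exp (-Y / 2))) =
        fun Y => (K / a ^ 2 * 4) * ((Y / 2) ^ 2 * Real.exp (-(Y / 2))) + (4 * K * C / a ^ 2) * ((Y / 2) ^ 1 * Real.exp (-(Y / 2)))
          + (K * C ^ 2 / a ^ 2 + 3 * K) * ((Y / 2) ^ 0 * Real.exp (-(Y / 2))) := by
      funext Y; rw [neg_div]; field_simp; ring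
    rw [e]
    have hh : Tendsto (fun Y : ℝ => Y / 2) atTop atTop := tendsto_id.atTop_div_const two_pos
    have t := fun k : ℕ => (Real.tendsto_pow_mul_exp_neg_atTop_nhds_zero k).comp hh
    have := (((t 2).const_mul (K / a ^ 2 * 4)).add ((t 1).const_mul (4 * K * C / a ^ 2))).add
      ((t 0).const_mul (K * C ^ 2 / a ^ 2 + 3 * K))
    simpa using this
  obtain ⟨Y₁, hY₁⟩ := eventually_atTop.1 (h1.eventually (gt_mem_nhds (zero_lt_one (α := ℝ))))
  refine ⟨-(|Y₁| + |Y₀| + 2 * |X| + |C| + 3) / a, fun x hx => ?_⟩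
  rw [lt_div_iff₀ ha] at hx
  have a1 := le_abs_self Y₁
  have a2 := le_abs_self Y₀
  have a3 := neg_abs_le X
  have a4 := le_abs_self C
  have a5 := abs_nonneg Y₁
  have a6 := abs_nonneg Y₀
  have a7 := abs_nonneg X
  refine ⟨-(a * x + C), by linarith, by linarith, by linarith, fun n hn => ?_⟩
  have h2 := hY₁ (-(a * x + C)) (by linarith)
  have e : (-(a * x + C) + C) / a = -x := by field_simp; ring
  rw [e, neg_sq] at h2
  have h3 : (n : ℝ) * (K * Real.exp (-(-(a * x + C)) / 2)) ≤ (x ^ 2 + 3) * (K * Real.exp (-(-(a * x + C)) / 2)) :=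
    mul_le_mul_of_nonneg_right hn (by positivity)
  linarith
end
end

section
open ComplexConjugate

section
variable {d E T : ℂ → ℂ} {R₁ r L : ℝ}

theorem tendsto_expc : Tendsto (fun x : ℝ => ((Real.exp x : ℝ) : ℂ)) atBot (𝓝 0) := by
  have := (Complex.continuous_ofReal.tendsto 0).comp Real.tendsto_exp_atBot
  rw [Complex.ofReal_zero] at this
  exact this

theorem DData.order (dd : DData d r L) (h0 : d 0 = 0) :
    ∃ k : ℕ, 1 ≤ k ∧ ∃ e : ℂ → ℂ, AnalyticAt ℂ e 0 ∧ e 0 ≠ 0 ∧ (e 0).im = 0 ∧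
      ∀ᶠ z in 𝓝 0, d z = z ^ k * e z := by
  have hda : AnalyticAt ℂ d 0 := dd.diff.analyticAt (ball_mem_nhds 0 dd.rpos)
  have hne : ¬ ∀ᶠ z in 𝓝 0, d z = 0 := by
    intro h
    obtain ⟨x, hx1, hx2⟩ := ((tendsto_expc.eventually h).and (eventually_lt_atBot L)).exists
    rw [dd.real hx2] at hx1
    exact dd.ne x hx2 (by exact_mod_cast hx1)
  obtain ⟨k, e, he, he0, hk⟩ := hda.exists_eventuallyEq_pow_smul_nonzero_iff.2 hne
  simp only [sub_zero, smul_eq_mul] at hk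
  refine ⟨k, ?_, e, he, he0, ?_, hk⟩
  · by_contra hc
    have : k = 0 := by omega
    subst this
    have := hk.self_of_nhds
    simp [h0] at this
    exact he0 this.symm
  · have t1 : Tendsto (fun x : ℝ => (e ((Real.exp x : ℝ) : ℂ)).im) atBot (𝓝 (e 0).im) :=
      (Complex.continuous_im.tendsto _).comp (he.continuousAt.tendsto.comp tendsto_expc)
    refine tendsto_nhds_unique t1 (Tendsto.congr' ?_ tendsto_const_nhds)
    filter_upwards [tendsto_expc.eventually hk, eventually_lt_atBot L] with x hx1 hx2
    rw [dd.real hx2, ← Complex.ofReal_pow] at hx1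
    have := congrArg Complex.im hx1
    rw [Complex.ofReal_im, Complex.im_ofReal_mul] at this
    have hp : (Real.exp x) ^ k ≠ 0 := by positivity
    rcases mul_eq_zero.1 this.symm with h | h
    · exact absurd h hp
    · exact h.symm

/-- the cusp coordinate -/
noncomputable def ZZ (k : ℕ) (u : ℂ) : ℂ := Complex.exp (-(k : ℂ) * u)

theorem ZZ_norm (k : ℕ) (u : ℂ) : ‖ZZ k u‖ = Real.exp (-(k * u.re)) := by
  rw [ZZ, Complex.norm_exp]; simp

theorem ZZ_lim (hE : Disp d E) (h0 : d 0 = 0) {k : ℕ} (hk : 1 ≤ k) {e : ℂ → ℂ}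
    (he : AnalyticAt ℂ e 0) (he0 : e 0 ≠ 0) (hei : (e 0).im = 0) (hde : ∀ᶠ z in 𝓝 0, d z = z ^ k * e z) :
    ∃ ω : ℂ, ω ≠ 0 ∧ ω.re = 0 ∧
      Tendsto (fun z => (Complex.exp (-(k : ℂ) * E z) - 1) / z ^ k) (𝓝[≠] 0) (𝓝 ω) := by
  obtain ⟨s, j, hs, hj, hj0, hj1, hEz⟩ := hE.ex
  have hj1 := hj1 h0
  have hjd : HasDerivAt j 1 0 := by rw [← hj1]; exact hj.differentiableAt.hasDerivAt
  have q1 : Tendsto (fun z => j z / z) (𝓝[≠] 0) (𝓝 1) := by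
    have := hjd.tendsto_slope
    refine this.congr (fun z => ?_)
    rw [slope_def_field, hj0, sub_zero, sub_zero]
  have hjt : Tendsto j (𝓝[≠] 0) (𝓝 0) := by
    have := hj.continuousAt.tendsto
    rw [hj0] at this
    exact this.mono_left nhdsWithin_le_nhds
  have q2 : Tendsto (fun z => e (j z)) (𝓝[≠] 0) (𝓝 (e 0)) := he.continuousAt.tendsto.comp hjt
  have q3 : Tendsto (fun z => E z / z ^ k) (𝓝[≠] 0) (𝓝 (s * 2 * Complex.I * e 0)) := by
    have := (q1.pow k).mul q2
    rw [one_pow, one_mul] at this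
    refine (this.const_mul (s * 2 * Complex.I : ℂ)).congr' ?_
    filter_upwards [hjt.eventually hde] with z hz
    rw [hEz, hz, div_pow]; ring
  have hz0 : Tendsto (fun z : ℂ => z ^ k) (𝓝[≠] 0) (𝓝 0) := by
    have : Tendsto (fun z : ℂ => z ^ k) (𝓝 0) (𝓝 (0 ^ k)) := (continuous_pow k).tendsto 0
    rw [zero_pow (by omega)] at this
    exact this.mono_left nhdsWithin_le_nhds
  have q4 : Tendsto (fun z => -(k : ℂ) * E z) (𝓝[≠] 0) (𝓝 0) := by
    have := (q3.mul hz0).const_mul (-(k : ℂ))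
    rw [mul_zero, mul_zero] at this
    refine this.congr' ?_
    filter_upwards [self_mem_nhdsWithin] with z hz
    have : z ≠ 0 := hz
    field_simp
  have q5 : Tendsto (fun z => dslope Complex.exp 0 (-(k : ℂ) * E z)) (𝓝[≠] 0) (𝓝 1) := by
    have hc : ContinuousAt (dslope Complex.exp 0) 0 :=
      continuousAt_dslope_same.2 Complex.differentiable_exp.differentiableAt
    have := hc.tendsto.comp q4
    rw [dslope_same, Complex.deriv_exp, Complex.exp_zero] at this
    exact this
  refine ⟨-(k : ℂ) * (s * 2 * Complex.I * e 0), ?_, ?_, ?_⟩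
  · have hs0 : (s : ℂ) ≠ 0 := by rcases hs with rfl | rfl <;> simp
    have hk0 : (k : ℂ) ≠ 0 := by exact_mod_cast (by omega : k ≠ 0)
    simp [hs0, hk0, he0]
  · simp [hei]
  · have := (q3.const_mul (-(k : ℂ))).mul q5
    rw [mul_one] at this
    refine this.congr (fun z => ?_)
    have h := sub_smul_dslope Complex.exp 0 (-(k : ℂ) * E z)
    rw [sub_zero, Complex.exp_zero, smul_eq_mul] at h
    rw [← h]; ring

theorem cusp_step (hE : Disp d E) (h0 : d 0 = 0) {k : ℕ} (hk : 1 ≤ k) {e : ℂ → ℂ}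
    (he : AnalyticAt ℂ e 0) (he0 : e 0 ≠ 0) (hei : (e 0).im = 0) (hde : ∀ᶠ z in 𝓝 0, d z = z ^ k * e z)
    (hT : ∀ u ∈ LH R₁, T u = u + E (Complex.exp u)) :
    ∃ ω : ℂ, ω ≠ 0 ∧ ω.re = 0 ∧ ∃ Q : ℝ, ∀ u : ℂ, u.re < Q → ‖ZZ k (T u) - ZZ k u - ω‖ ≤ ‖ω‖ / 4 := by
  obtain ⟨ω, h1, h2, h3⟩ := ZZ_lim hE h0 hk he he0 hei hde
  have hp : 0 < ‖ω‖ / 4 := by have := norm_pos_iff.2 h1; positivity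
  have h4 := (Metric.tendsto_nhds.1 h3) _ hp
  rw [eventually_nhdsWithin_iff] at h4
  obtain ⟨δ, hδ, h5⟩ := Metric.eventually_nhds_iff.1 h4
  refine ⟨ω, h1, h2, min R₁ (Real.log δ), fun u hu => ?_⟩
  have hu1 : u.re < R₁ := hu.trans_le (min_le_left _ _)
  have hu2 : u.re < Real.log δ := hu.trans_le (min_le_right _ _)
  have h6 := h5 (y := Complex.exp u) (by
    rw [dist_zero_right, Complex.norm_exp]; exact (Real.lt_log_iff_exp_lt hδ).1 hu2) (Complex.exp_ne_zero u)
  rw [dist_eq_norm] at h6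
  rw [hT u hu1]
  have e1 : ZZ k (u + E (Complex.exp u)) - ZZ k u =
      (Complex.exp (-(k : ℂ) * E (Complex.exp u)) - 1) / Complex.exp u ^ k := by
    rw [ZZ, ZZ, mul_add, Complex.exp_add, ← Complex.exp_nat_mul, neg_mul, Complex.exp_neg]
    field_simp
  rw [e1]
  exact h6.le

/-- orbits in the cusp case -/
theorem cusp_orbit {k : ℕ} (hk : 1 ≤ k) {ω : ℂ} (hω : ω ≠ 0) (hre : ω.re = 0) {Q : ℝ}
    (hst : ∀ u : ℂ, u.re < Q → ‖ZZ k (T u) - ZZ k u - ω‖ ≤ ‖ω‖ / 4) (B X : ℝ) :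
    ∃ Y : ℝ, ∀ u : ℂ, |(ZZ k u).im| ≤ B → Y ≤ (ZZ k u).re → ∀ n : ℕ, (T^[n] u).re < X := by
  have hk0 : (0:ℝ) < k := by exact_mod_cast hk
  set q := min Q X with hq
  set Y := 2 * Real.exp (-(k * q)) + |B| + 1 with hY
  have deep : ∀ u : ℂ, Y / 2 ≤ ‖ZZ k u‖ → u.re < q := by
    intro u hu
    have : Real.exp (-(k * q)) < Real.exp (-(k * u.re)) := by
      rw [← ZZ_norm]
      have : Real.exp (-(k * q)) < Y / 2 := by rw [hY]; linarith [abs_nonneg B]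
      linarith
    have := Real.exp_lt_exp.1 this
    by_contra hc
    push Not at hc
    nlinarith
  refine ⟨Y, fun u hB hYu => ?_⟩
  have hωp := norm_pos_iff.2 hω
  have hωi : |ω.im| = ‖ω‖ := by
    have : ω = (ω.im : ℂ) * Complex.I := by apply Complex.ext <;> simp [hre]
    conv_rhs => rw [this]
    simp
  have hYp : 0 < Y := by positivity
  have hBY : B ≤ Y := by have := le_abs_self B; have := Real.exp_pos (-(k * q)); rw [hY]; linarith
  have big : ∀ n : ℕ, ‖ZZ k (T^[n] u) - ZZ k u - n * ω‖ ≤ n * (‖ω‖ / 4) → Y / 2 ≤ ‖ZZ k (T^[n] u)‖ := by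
    intro n hn
    have r1 := (Complex.abs_re_le_norm _).trans hn
    have r2 := (Complex.abs_im_le_norm _).trans hn
    simp only [Complex.sub_re, Complex.sub_im, Complex.mul_re, Complex.mul_im, Complex.natCast_re, Complex.natCast_im, hre, mul_zero, zero_mul, sub_zero, add_zero] at r1 r2
    have r1 := abs_le.1 r1
    by_cases hc : n * (‖ω‖ / 4) ≤ Y / 2
    · have := (le_abs_self _).trans (Complex.abs_re_le_norm (ZZ k (T^[n] u)))
      linarith [r1.1]
    · push Not at hc
      have h1 := Complex.abs_im_le_norm (ZZ k (T^[n] u))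
      have h2 : |(n : ℝ) * ω.im| = n * ‖ω‖ := by rw [abs_mul, hωi, Nat.abs_cast]
      have h3 : |(n : ℝ) * ω.im| ≤ |(ZZ k (T^[n] u)).im| + |(ZZ k u).im| + |(ZZ k (T^[n] u)).im - (ZZ k u).im - n * ω.im| := by
        have e : (n : ℝ) * ω.im = (ZZ k (T^[n] u)).im - (ZZ k u).im - ((ZZ k (T^[n] u)).im - (ZZ k u).im - n * ω.im) := by ring
        calc |(n : ℝ) * ω.im| = |(ZZ k (T^[n] u)).im - (ZZ k u).im - ((ZZ k (T^[n] u)).im - (ZZ k u).im - n * ω.im)| := by rw [← e]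
          _ ≤ |(ZZ k (T^[n] u)).im - (ZZ k u).im| + _ := abs_sub _ _
          _ ≤ _ := by gcongr; exact abs_sub _ _
      rw [h2] at h3
      linarith
  have key : ∀ n : ℕ, ‖ZZ k (T^[n] u) - ZZ k u - n * ω‖ ≤ n * (‖ω‖ / 4) := by
    intro n
    induction n with
    | zero => simp
    | succ n ih =>
      have h1 := deep _ (big n ih)
      have h2 := hst _ (h1.trans_le (min_le_left _ _))
      rw [Function.iterate_succ_apply']
      have e : ZZ k (T (T^[n] u)) - ZZ k u - ((n + 1 : ℕ) : ℂ) * ω =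
        (ZZ k (T^[n] u) - ZZ k u - n * ω) + (ZZ k (T (T^[n] u)) - ZZ k (T^[n] u) - ω) := by push_cast; ring
      rw [e]
      refine (norm_add_le _ _).trans ?_
      push_cast
      linarith
  intro n
  exact (deep _ (big n (key n))).trans_le (min_le_right _ _)

theorem cusp_start {k : ℕ} (hk : 1 ≤ k) {e : ℂ → ℂ}
    (he : AnalyticAt ℂ e 0) (hde : ∀ᶠ z in 𝓝 0, d z = z ^ k * e z) :
    ∃ B : ℝ, ∀ Y : ℝ, ∃ Q : ℝ, ∀ u : ℂ, u.re < Q → |u.im| ≤ |hh d u.re| → |(ZZ k u).im| ≤ B ∧ Y ≤ (ZZ k u).re := by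
  have hk0 : (0:ℝ) < k := by exact_mod_cast hk
  set C := ‖e 0‖ + 1 with hC
  have hev : ∀ᶠ x : ℝ in atBot, |hh d x| ≤ Real.exp (k * x) * C := by
    have h1 : ∀ᶠ z in 𝓝 (0:ℂ), ‖e z‖ < C := he.continuousAt.norm.eventually (gt_mem_nhds (by simp [hC]))
    filter_upwards [tendsto_expc.eventually h1, tendsto_expc.eventually hde] with x hx1 hx2
    unfold hh
    refine (Complex.abs_re_le_norm _).trans ?_
    rw [hx2, norm_mul, norm_pow, Complex.norm_real, Real.norm_eq_abs, abs_of_pos (Real.exp_pos _), ← Real.exp_nat_mul]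
    exact mul_le_mul_of_nonneg_left hx1.le (Real.exp_pos _).le
  have hev2 : Tendsto (fun x : ℝ => Real.exp (-(k * x))) atBot atTop := by
    refine Real.tendsto_exp_atTop.comp ?_
    exact tendsto_neg_atBot_atTop.comp (tendsto_id.const_mul_atBot hk0)
  refine ⟨k * C, fun Y => ?_⟩
  obtain ⟨Q, hQ⟩ := eventually_atBot.1 (hev.and (hev2.eventually_ge_atTop (2 * |Y| + k * C)))
  refine ⟨Q, fun u hu hi => ?_⟩
  obtain ⟨h1, h2⟩ := hQ _ hu.le
  have hp := Real.exp_pos (-(k * u.re))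
  have hyb : |u.im| ≤ Real.exp (k * u.re) * C := hi.trans h1
  have hee : Real.exp (-(k * u.re)) * Real.exp (k * u.re) = 1 := by rw [← Real.exp_add]; simp
  have hyb2 : Real.exp (-(k * u.re)) * (k * |u.im|) ≤ k * C := by
    calc Real.exp (-(k * u.re)) * (k * |u.im|) ≤ Real.exp (-(k * u.re)) * (k * (Real.exp (k * u.re) * C)) := by gcongr
      _ = k * C * (Real.exp (-(k * u.re)) * Real.exp (k * u.re)) := by ring
      _ = k * C := by rw [hee, mul_one]
  have hC0 : 0 ≤ C := by positivity
  have hCk : 0 ≤ k * C := by positivity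
  constructor
  · have e1 : (ZZ k u).im = Real.exp (-(k * u.re)) * Real.sin (-(k * u.im)) := by
      rw [ZZ, Complex.exp_im]; simp
    rw [e1, abs_mul, abs_of_pos hp]
    refine le_trans ?_ hyb2
    refine mul_le_mul_of_nonneg_left ?_ hp.le
    refine Real.abs_sin_le_abs.trans ?_
    rw [abs_neg, abs_mul, Nat.abs_cast]
  · have e1 : (ZZ k u).re = Real.exp (-(k * u.re)) * Real.cos (-(k * u.im)) := by
      rw [ZZ, Complex.exp_re]; simp
    have h3 : k * |u.im| ≤ 1 := by
      by_contra hc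
      push Not at hc
      nlinarith [abs_nonneg Y, mul_lt_mul_of_pos_left hc hp]
    have h4 : 1 / 2 ≤ Real.cos (-(k * u.im)) := by
      have := Real.one_sub_sq_div_two_le_cos (x := -(k * u.im))
      have h5 : (-(k * u.im)) ^ 2 ≤ 1 := by
        rw [sq_le_one_iff_abs_le_one, abs_neg, abs_mul, Nat.abs_cast]; exact h3
      linarith
    rw [e1]
    have := mul_le_mul_of_nonneg_left h4 hp.le
    have := le_abs_self Y
    linarith
end
end

section
open ComplexConjugate

section
variable {d A B H E E' T T' : ℂ → ℂ} {R R₁ M r L : ℝ} {b t : Bool}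

theorem orbit_corner (S : StripExt d A B R R₁ M b t H) (P : Pair A B R₁ M) (dd : DData d r L)
    (hL : R₁ ≤ L) (hbt : b ≠ t) (hd0 : d 0 ≠ 0) (hE : Disp d E)
    (hT : ∀ u ∈ LH R₁, T u = u + E (Complex.exp u)) (X : ℝ) :
    ∃ R' ≤ R, ∀ w ∈ S3 R', ∀ j : ℕ, (j : ℝ) ≤ w.re ^ 2 + 3 → (T^[j] (H w)).re < X := by
  obtain ⟨a, ha, C, R', hR', hg⟩ := S.growth P dd hL hbt hd0
  obtain ⟨Y₀, K, hK, ho⟩ := corner_orbit hE dd hT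
  obtain ⟨R'', hn⟩ := corner_num ha hK C Y₀ X
  refine ⟨min R' R'', (min_le_left _ _).trans hR', fun w hw j hj => ?_⟩
  obtain ⟨Y, y1, y2, y3, y4⟩ := hn w.re (hw.1.trans_le (min_le_right _ _))
  have h1 := hg w ⟨hw.1.trans_le (min_le_left _ _), hw.2.1, hw.2.2⟩
  exact (ho Y y1 j (y4 j hj) (H w) (h1.trans y2)).trans_lt y3

theorem orbit_cusp (S : StripExt d A B R R₁ M b t H) (dd : DData d r L)
    (hd0 : d 0 = 0) (hE : Disp d E) (hE' : Disp d E')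
    (hTA : ∀ u, rho A B true u = T (conj u))
    (hT : ∀ u ∈ LH R₁, T u = u + E (Complex.exp u))
    (hT' : ∀ u ∈ LH R₁, T' u = u + E' (Complex.exp u)) (X : ℝ) :
    ∃ R' ≤ R, ∀ w ∈ S3 R', ∀ j : ℕ, (T^[j] (H w)).re < X ∧ (T'^[j] (H w)).re < X := by
  obtain ⟨k, hk, e, he, he0, hei, hde⟩ := dd.order hd0
  obtain ⟨ω, w1, w2, Q, hst⟩ := cusp_step hE hd0 hk he he0 hei hde hT
  obtain ⟨ω', w1', w2', Q', hst'⟩ := cusp_step hE' hd0 hk he he0 hei hde hT'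
  obtain ⟨B₀, hB₀⟩ := cusp_start hk he hde
  have hωp := norm_nonneg ω
  obtain ⟨Y, hY⟩ := cusp_orbit hk w1 w2 hst (B₀ + 2 * ‖ω‖) X
  obtain ⟨Y', hY'⟩ := cusp_orbit hk w1' w2' hst' (B₀ + 2 * ‖ω‖) X
  obtain ⟨Q₀, hQ₀⟩ := hB₀ (max Y Y' + 2 * ‖ω‖)
  obtain ⟨R', hR', hlt⟩ := S.lt_closed (min Q₀ Q)
  refine ⟨R', hR', fun w hw j => ?_⟩
  have hm1 := le_max_left Y Y'
  have hm2 := le_max_right Y Y'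
  -- it suffices to control the starting point
  suffices h : |(ZZ k (H w)).im| ≤ B₀ + 2 * ‖ω‖ ∧ max Y Y' ≤ (ZZ k (H w)).re from
    ⟨hY _ h.1 (hm1.trans h.2) j, hY' _ h.1 (hm2.trans h.2) j⟩
  obtain ⟨v, h1, h2, h3, h4⟩ := S.fold (w := w) ⟨hw.1.trans_le hR', hw.2.1, hw.2.2⟩
  have hv := hlt v (by rw [h1]; exact hw.1) h2 h3
  obtain ⟨-, c, hc, hce⟩ := S.closed (v := v) (by rw [h1]; exact hw.1.trans_le hR') h2 h3
  have him : |(H v).im| ≤ |hh d (H v).re| := by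
    rw [hce, abs_mul, abs_of_nonneg hc.1]
    nlinarith [hc.2, abs_nonneg (hh d (H v).re)]
  have hg1 := hQ₀ (H v) (hv.trans_le (min_le_left _ _)) him
  have hg2 := hQ₀ (conj (H v)) (by rw [Complex.conj_re]; exact hv.trans_le (min_le_left _ _))
    (by rw [Complex.conj_re, Complex.conj_im, abs_neg]; exact him)
  rcases h4 with h4 | ⟨c, h4⟩
  · rw [h4]; exact ⟨by linarith [hg1.1], by linarith [hg1.2]⟩
  cases c with
  | false =>
    have : H w = conj (H v) := by rw [h4]; simp [rho]
    rw [this]; exact ⟨by linarith [hg2.1], by linarith [hg2.2]⟩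
  | true =>
    rw [h4, hTA]
    have hs := hst (conj (H v)) (by rw [Complex.conj_re]; exact hv.trans_le (min_le_right _ _))
    have hs2 : ‖ZZ k (T (conj (H v))) - ZZ k (conj (H v))‖ ≤ 2 * ‖ω‖ := by
      have e1 : ZZ k (T (conj (H v))) - ZZ k (conj (H v)) = (ZZ k (T (conj (H v))) - ZZ k (conj (H v)) - ω) + ω := by ring
      rw [e1]
      exact (norm_add_le _ _).trans (by linarith)
    have r1 := abs_le.1 ((Complex.abs_re_le_norm _).trans hs2)
    have r2 := (Complex.abs_im_le_norm _).trans hs2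
    rw [Complex.sub_re] at r1
    rw [Complex.sub_im] at r2
    refine ⟨?_, by linarith [hg2.2, r1.1]⟩
    have := abs_sub_abs_le_abs_sub (ZZ k (T (conj (H v)))).im (ZZ k (conj (H v))).im
    linarith [hg2.1]

theorem orbit_all (S : StripExt d A B R R₁ M b t H) (P : Pair A B R₁ M) (dd : DData d r L)
    (hL : R₁ ≤ L) (hbt : b ≠ t) (hE : Disp d E) (hE' : Disp d E')
    (hTA : ∀ u, rho A B true u = T (conj u))
    (hT : ∀ u ∈ LH R₁, T u = u + E (Complex.exp u))
    (hT' : ∀ u ∈ LH R₁, T' u = u + E' (Complex.exp u)) (X : ℝ) :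
    ∃ R' ≤ R, ∀ w ∈ S3 R', ∀ j : ℕ, (j : ℝ) ≤ w.re ^ 2 + 3 →
      (T^[j] (H w)).re < X ∧ (T'^[j] (H w)).re < X := by
  by_cases hd0 : d 0 = 0
  · obtain ⟨R', h, h'⟩ := orbit_cusp S dd hd0 hE hE' hTA hT hT' X
    exact ⟨R', h, fun w hw j _ => h' w hw j⟩
  · obtain ⟨R', h, h'⟩ := orbit_corner S P dd hL hbt hd0 hE hT X
    obtain ⟨R'', g, g'⟩ := orbit_corner S P dd hL hbt hd0 hE' hT' X
    refine ⟨min R' R'', (min_le_left _ _).trans h, fun w hw j hj => ⟨?_, ?_⟩⟩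
    · exact h' w ⟨hw.1.trans_le (min_le_left _ _), hw.2.1, hw.2.2⟩ j hj
    · exact g' w ⟨hw.1.trans_le (min_le_right _ _), hw.2.1, hw.2.2⟩ j hj

theorem final_ext {φ Ψ : ℂ → ℂ} (hφ : DifferentiableOn ℂ φ (ball 0 1))
    (S : StripExt d A B R R₁ M b t H) (P : Pair A B R₁ M) (dd : DData d r L)
    (hL : R₁ ≤ L) (hE : Disp d E) (hE' : Disp d E')
    (hT : ∀ u ∈ LH R₁, B (conj (A (conj u))) = u + E (Complex.exp u))
    (hT' : ∀ u ∈ LH R₁, conj (B (conj (A u))) = u + E' (Complex.exp u))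
    (hΨ : ∀ w ∈ SS R, φ (Complex.exp (H w)) = Ψ w) :
    ∃ c C : ℝ, 0 < c ∧ 0 < C ∧ ∃ G : ℂ → ℂ,
      DifferentiableOn ℂ G {w : ℂ | w.re < Real.log c - C * Real.sqrt |w.im|} ∧
      ∀ w ∈ {w : ℂ | w.re < Real.log c - C * Real.sqrt |w.im|}, 0 < w.im → w.im < Real.pi →
        G w = Ψ w := by
  have hM := P.M0
  set T : ℂ → ℂ := fun u => B (conj (A (conj u))) with hTd
  set T' : ℂ → ℂ := fun u => conj (B (conj (A u))) with hTd'
  set X := min (R₁ - M) 0 with hX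
  have hX1 : X ≤ R₁ - M := min_le_left _ _
  have hX0 : X ≤ 0 := min_le_right _ _
  have hTdiff : DifferentiableOn ℂ T (LH X) := by
    have h1 : DifferentiableOn ℂ (fun u => conj (A (conj u))) (LH X) :=
      (diffOn_conj (LH_isOpen R₁) P.Ad).mono (fun u hu => by
        have hu' : u.re < X := hu
        show (conj u).re < R₁
        rw [Complex.conj_re]; linarith)
    refine P.Bd.comp h1 (fun u hu => ?_)
    have hu' : u.re < X := hu
    have h2 := re_le_of_norm (P.AM (conj u) (show (conj u).re < R₁ by rw [Complex.conj_re]; linarith))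
    rw [Complex.conj_re] at h2
    show (conj (A (conj u))).re < R₁
    rw [Complex.conj_re]; linarith
  have hTdiff' : DifferentiableOn ℂ T' (LH X) := by
    have h1 := (diffOn_conj (LH_isOpen R₁) P.Bd)
    have : T' = fun u => (fun v => conj (B (conj v))) (A u) := by funext u; rfl
    rw [this]
    refine h1.comp (P.Ad.mono (fun u hu => ?_)) (fun u hu => ?_)
    · have hu' : u.re < X := hu
      show u.re < R₁
      linarith
    · have hu' : u.re < X := hu
      have h2 := re_le_of_norm (P.AM u (show u.re < R₁ by linarith))
      show (conj (A u)).re < R₁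
      rw [Complex.conj_re]; linarith
  have hTA : ∀ u, rho A B true u = T (conj u) := by intro u; simp [rho, hTd]
  -- relation between the two ends of the strip
  have hfold : ∀ w ∈ S3 R, w.im < 0 → (H (conj w)).re < R₁ - M - 1 ∧ H w = rho A B b (H (conj w)) ∧
      H (w + 2 * Real.pi * Complex.I) = rho A B t (H (conj w)) := by
    intro w hw hw0
    obtain ⟨a1, a2, a3⟩ := hw
    refine ⟨S.re _ ⟨by simpa using a1, by simpa using hw0, by simp; linarith⟩, S.rb w ⟨a1, a2, a3⟩ hw0, ?_⟩
    have := S.rt (w + 2 * Real.pi * Complex.I) ⟨by simpa using a1, by simp; linarith, by simp; linarith⟩ (by simp; linarith)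
    rw [this]
    congr 2
    apply Complex.ext <;> simp
  have hTT' : ∀ a : ℂ, a.re < R₁ - M - 1 → T' (T (conj a)) = conj a := by
    intro a ha
    have ha1 : a ∈ LH R₁ := by show a.re < R₁; linarith
    have h2 := re_le_of_norm (P.AM a ha1)
    have h3 : conj (A a) ∈ LH R₁ := by show (conj (A a)).re < R₁; rw [Complex.conj_re]; linarith
    simp only [hTd, hTd', Complex.conj_conj]
    rw [P.AB _ h3, Complex.conj_conj, P.BA a ha1]
  have hT'a : ∀ a : ℂ, a.re < R₁ - M - 1 → T' (T (conj a)) = conj a ∧ T (conj a) = rho A B true a :=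
    fun a ha => ⟨hTT' a ha, (hTA a).symm⟩
  by_cases hbt : b = t
  · obtain ⟨R', hR', h⟩ := S.lt_S3 P X
    have hm1 : min R' 0 ≤ R := (min_le_left _ _).trans hR'
    refine glue_ext (H := H) (τ := id) (τi := id) (φ := φ) (R := min R' 0) (R' := X) hX0 (min_le_right _ _) hφ
      (S.diff.mono ?_) differentiableOn_id differentiableOn_id ?_ ?_ ?_ ?_
    · intro w hw; exact ⟨hw.1.trans_le hm1, hw.2.1, hw.2.2⟩
    · intro w hw hw0
      obtain ⟨-, e1, e2⟩ := hfold w ⟨hw.1.trans_le hm1, hw.2.1, hw.2.2⟩ hw0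
      rw [e1, e2, hbt]; rfl
    · intro w hw hw0
      obtain ⟨-, e1, e2⟩ := hfold w ⟨hw.1.trans_le hm1, hw.2.1, hw.2.2⟩ hw0
      rw [e1, e2, hbt]; rfl
    · intro w hw j _
      have := h w ⟨hw.1.trans_le (min_le_left _ _), hw.2.1, hw.2.2⟩
      simp only [Function.iterate_id, id]
      exact ⟨this, this⟩
    · intro w hw; exact hΨ w ⟨hw.1.trans_le hm1, hw.2.1, hw.2.2⟩
  · obtain ⟨R', hR', h⟩ := orbit_all S P dd hL hbt hE hE' hTA hT hT' X
    have hm1 : min R' 0 ≤ R := (min_le_left _ _).trans hR'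
    -- the composition in the other order
    have hTT : ∀ a : ℂ, a.re < R₁ - M - 1 → T (T' (rho A B true a)) = rho A B true a := by
      intro a ha
      rw [hTA, hTT' a ha]
    cases hb : b <;> cases ht : t
    · exact absurd (hb.trans ht.symm) hbt
    · subst hb ht
      refine glue_ext (H := H) (τ := T) (τi := T') (φ := φ) (R := min R' 0) (R' := X) hX0 (min_le_right _ _) hφ
        (S.diff.mono ?_) hTdiff hTdiff' ?_ ?_ ?_ ?_
      · intro w hw; exact ⟨hw.1.trans_le hm1, hw.2.1, hw.2.2⟩
      · intro w hw hw0
        obtain ⟨e0, e1, e2⟩ := hfold w ⟨hw.1.trans_le hm1, hw.2.1, hw.2.2⟩ hw0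
        rw [e1, e2, hTA]; simp [rho]
      · intro w hw hw0
        obtain ⟨e0, e1, e2⟩ := hfold w ⟨hw.1.trans_le hm1, hw.2.1, hw.2.2⟩ hw0
        rw [e1, e2, hTA, hTT' _ e0]; simp [rho]
      · intro w hw j hj
        exact h w ⟨hw.1.trans_le (min_le_left _ _), hw.2.1, hw.2.2⟩ j hj
      · intro w hw; exact hΨ w ⟨hw.1.trans_le hm1, hw.2.1, hw.2.2⟩
    · subst hb ht
      refine glue_ext (H := H) (τ := T') (τi := T) (φ := φ) (R := min R' 0) (R' := X) hX0 (min_le_right _ _) hφ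
        (S.diff.mono ?_) hTdiff' hTdiff ?_ ?_ ?_ ?_
      · intro w hw; exact ⟨hw.1.trans_le hm1, hw.2.1, hw.2.2⟩
      · intro w hw hw0
        obtain ⟨e0, e1, e2⟩ := hfold w ⟨hw.1.trans_le hm1, hw.2.1, hw.2.2⟩ hw0
        rw [e1, e2, hTA, hTT' _ e0]; simp [rho]
      · intro w hw hw0
        obtain ⟨e0, e1, e2⟩ := hfold w ⟨hw.1.trans_le hm1, hw.2.1, hw.2.2⟩ hw0
        rw [e1, e2, hTA]; simp [rho]
      · intro w hw j hj
        exact (h w ⟨hw.1.trans_le (min_le_left _ _), hw.2.1, hw.2.2⟩ j hj).symm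
      · intro w hw; exact hΨ w ⟨hw.1.trans_le hm1, hw.2.1, hw.2.2⟩
    · exact absurd (hb.trans ht.symm) hbt
end
end

/-- Theorem 2.17: a Riemann map `Φ : ℍ → D` onto a simply connected domain with an analytic
corner at `0` of interior angle `θ ∈ (0, 2π]`, continuously extended by `Φ 0 = 0`, extends
holomorphically to a standard quadratic domain of the Riemann surface of the logarithm:
there are `c, C > 0` and `G` holomorphic on `W(c,C)` with `G w = Φ (e^w)` on the strip
`0 < Im w < π`. -/
theorem riemann_map_extends_to_quadratic_domain
    (D : Set ℂ) (θ : ℝ) (hθ : 0 < θ) (hθ' : θ ≤ 2 * Real.pi)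
    (hD : IsOpen D) (hDconn : IsConnected D) (hDsc : SimplyConnectedSpace D)
    (h0 : (0 : ℂ) ∈ frontier D) (hcorner : HasAnalyticCorner D θ)
    (Φ : ℂ → ℂ)
    (hΦd : DifferentiableOn ℂ Φ UpperHalf)
    (hΦbij : BijOn Φ UpperHalf D)
    (hΦ0 : Tendsto Φ (nhdsWithin 0 UpperHalf) (nhds 0)) :
    ∃ c C : ℝ, 0 < c ∧ 0 < C ∧ ∃ G : ℂ → ℂ,
      DifferentiableOn ℂ G (StdQuadDomain c C) ∧
      ∀ w ∈ StdQuadDomain c C, 0 < w.im → w.im < Real.pi →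
        G w = Φ (Complex.exp w) := by
  obtain ⟨φ₁, φ₂, h1d, h1i, h10, -, h2d, h2i, h20, h2n, ⟨ρ, hρ, hB⟩, -⟩ := hcorner
  obtain ⟨φ, d, r, L, r₁, ℓ, I⟩ :=
    iface_exists hD h0 hρ h1d h1i h10 h2d h2i h20 h2n hB hΦd hΦbij.mapsTo hΦ0
  obtain ⟨R₁, hR₁, M, K, A, B, E, E', P, hA0, hK, hAK, hE, hE', hT, hT'⟩ := pair_exists I.dd
  obtain ⟨R, b, t, H, S, hS⟩ := strip_exists I hD hΦd hΦbij hR₁ P hA0 hK hAK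
  exact final_ext (Ψ := fun w => Φ (Complex.exp w)) I.φd S P I.dd hR₁ hE hE' hT hT' hS
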